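/- Let ŵ ∈ C([0,T),ℝ) generate a chordal Loewner curve η and hulls K_t such that η[0,T) ∩ ℝ has Lebesgue measure zero. Define c(0)=d(0)=ŵ(0) and c(t)=c_{K_t}, d(t)=d_{K_t} for t>0. Then c ≤ ŵ ≤ d on [0,T); the set of t with c(t)=ŵ(t) or d(t)=ŵ(t) has Lebesgue measure zero; c and d are absolutely continuous with c'(t) = 2/(c(t)-ŵ(t)) and d'(t) = 2/(d(t)-ŵ(t)) almost everywhere; and hence c is strictly decreasing and d strictly increasing on [0,T). -/

import Mathlib

open Complex Filter Set Metric Bornology Topology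

noncomputable section

/-- The open upper half-plane `ℍ`. -/
def UHP : Set ℂ := {z : ℂ | 0 < z.im}

/-- `K^doub`: the closure of `K` together with its reflection across `ℝ`. -/
def Kdoub (K : Set ℂ) : Set ℂ := closure K ∪ (starRingEnd ℂ) '' closure K

/-- `a_K = min (cl K ∩ ℝ)`. -/
def aK (K : Set ℂ) : ℝ := sInf {x : ℝ | (x : ℂ) ∈ closure K}

/-- `b_K = max (cl K ∩ ℝ)`. -/
def bK (K : Set ℂ) : ℝ := sSup {x : ℝ | (x : ℂ) ∈ closure K}

/-- The segment `[a_K, b_K]` regarded as a subset of `ℂ`. -/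
def seg (K : Set ℂ) : Set ℂ := (fun t : ℝ => (t : ℂ)) '' Set.Icc (aK K) (bK K)

/-- `K` is an `ℍ`-hull with mapping-out function `g` (normalized hydrodynamically at `∞`),
whose Schwarz reflection maps the complement of `K^doub ∪ [a_K, b_K]` onto `ℂ \ S_K`
for the compact set `S = S_K ⊆ ℝ`. -/
structure IsHullMap (K : Set ℂ) (g : ℂ → ℂ) (S : Set ℝ) : Prop where
  subset_UHP : K ⊆ UHP
  bounded : IsBounded K
  relClosed : ∀ z ∈ closure K, 0 < z.im → z ∈ K
  holo : DifferentiableOn ℂ g (UHP \ K)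
  bij : Set.BijOn g (UHP \ K) UHP
  hydro : Tendsto (fun z => g z - z) (Bornology.cobounded ℂ) (nhds 0)
  compactS : IsCompact S
  ext_holo : K.Nonempty → DifferentiableOn ℂ g {z : ℂ | z ∉ Kdoub K}
  real_vals : K.Nonempty → ∀ x : ℝ, (x : ℂ) ∉ Kdoub K → (g (x : ℂ)).im = 0
  conj_symm : K.Nonempty → ∀ z : ℂ, z ∉ Kdoub K → g ((starRingEnd ℂ) z) = (starRingEnd ℂ) (g z)
  extBij : K.Nonempty →
    Set.BijOn g {z : ℂ | z ∉ Kdoub K ∧ z ∉ seg K} {z : ℂ | ∀ s ∈ S, z ≠ (s : ℂ)}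

/-- `g` has half-plane capacity `c` : `g z = z + c / z + O(1/z²)` near `∞`. -/
def HasHcap (g : ℂ → ℂ) (c : ℝ) : Prop :=
  Tendsto (fun z : ℂ => z * (g z - z)) (Bornology.cobounded ℂ) (nhds (c : ℂ))

theorem isOpen_UHP : IsOpen UHP := isOpen_lt continuous_const Complex.continuous_im

theorem convex_UHP : Convex ℝ UHP := convex_halfSpace_im_gt 0

theorem isPreconnected_UHP : IsPreconnected UHP := convex_UHP.isPreconnected

/-- A minimum principle: if the imaginary part of a holomorphic function on `ℍ` is asymptotically
nonnegative at every boundary point, including `∞`, then it is nonnegative. -/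
theorem im_nonneg_of_boundary {H : ℂ → ℂ} (hd : DifferentiableOn ℂ H UHP)
    (hinf : ∀ ε > 0, ∃ R, ∀ ζ ∈ UHP, R ≤ ‖ζ‖ → -ε ≤ (H ζ).im)
    (hbd : ∀ x : ℝ, ∀ ε > 0, ∀ᶠ ζ in 𝓝 (x : ℂ), ζ ∈ UHP → -ε ≤ (H ζ).im) :
    ∀ ζ ∈ UHP, 0 ≤ (H ζ).im := by
  by_contra! hcon
  obtain ⟨ζ₀, hζ₀, hneg⟩ := hcon
  set v := -(H ζ₀).im with hv
  have hvpos : 0 < v := by linarith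
  obtain ⟨R, hR⟩ := hinf (v / 2) (by linarith)
  set E : Set ℂ := {ζ | ζ ∈ UHP ∧ (H ζ).im ≤ -v} with hE
  have hEsub : E ⊆ UHP := fun ζ h => h.1
  have hcont : ContinuousOn (fun ζ => (H ζ).im) UHP :=
    Complex.continuous_im.comp_continuousOn hd.continuousOn
  have hclosed : IsClosed E := by
    refine isClosed_of_closure_subset fun z hz => ?_
    have him : 0 ≤ z.im := by
      have : z ∈ closure {z : ℂ | 0 ≤ z.im} :=
        closure_mono (fun ζ h => (show (0:ℝ) < ζ.im from h.1).le) hz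
      rwa [(isClosed_le continuous_const Complex.continuous_im).closure_eq] at this
    rcases him.lt_or_eq with h | h
    · refine ⟨h, ?_⟩
      have hc : ContinuousAt (fun ζ => (H ζ).im) z := hcont.continuousAt (isOpen_UHP.mem_nhds h)
      by_contra! hlt
      have := hc.eventually (lt_mem_nhds hlt)
      obtain ⟨y, hy1, hy2⟩ := (mem_closure_iff_frequently.1 hz).and_eventually this |>.exists
      exact absurd hy1.2 (not_le.2 hy2)
    · have hzr : ((z.re : ℝ) : ℂ) = z := by apply Complex.ext <;> simp [h]
      have := hbd z.re (v / 2) (by linarith)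
      rw [hzr] at this
      obtain ⟨y, hy1, hy2⟩ := (mem_closure_iff_frequently.1 hz).and_eventually this |>.exists
      have := hy2 hy1.1
      have := hy1.2
      linarith
  have hbdd : IsBounded E := by
    refine (isBounded_iff_forall_norm_le).2 ⟨R, fun ζ h => ?_⟩
    by_contra! hlt
    have := hR ζ h.1 hlt.le
    have := h.2
    linarith
  have hcomp : IsCompact E := isCompact_of_isClosed_isBounded hclosed hbdd
  obtain ⟨ζ₁, h₁, hmin⟩ := hcomp.exists_isMinOn ⟨ζ₀, hζ₀, by simp [hv]⟩ (hcont.mono hEsub)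
  have hglob : ∀ ζ ∈ UHP, (H ζ₁).im ≤ (H ζ).im := by
    intro ζ hζ
    by_cases h : (H ζ).im ≤ -v
    · exact hmin (show ζ ∈ E from ⟨hζ, h⟩)
    · have := h₁.2
      linarith
  have hconst := Complex.norm_eqOn_of_isPreconnected_of_isMaxOn (f := fun ζ => exp (I * H ζ))
    isPreconnected_UHP isOpen_UHP ((hd.const_mul I).cexp) h₁.1 (by
      intro ζ hζ
      simp only [Set.mem_ofPred_eq, Function.comp, Complex.norm_exp]
      have := hglob ζ hζ
      simpa using this)
  have hi : ((max R 1 : ℝ) : ℂ) * I ∈ UHP := by simp [UHP]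
  have h2 := hconst hi
  simp only [Function.comp, Function.const, Complex.norm_exp, Real.exp_eq_exp] at h2
  have h3 := hR _ hi (by
    rw [norm_mul, Complex.norm_real, norm_I, mul_one, Real.norm_eq_abs]
    exact (le_max_left R 1).trans (le_abs_self _))
  have h4 := h₁.2
  simp at h2 h3
  linarith

/-- A holomorphic function with bounded imaginary part has bounded derivative. -/
theorem norm_deriv_le_of_abs_im_le {H : ℂ → ℂ} {z : ℂ} {R M : ℝ} (hR : 0 < R) (hM : 0 < M)
    (hd : DifferentiableOn ℂ H (ball z R)) (hb : ∀ ζ ∈ ball z R, |(H ζ).im| ≤ M) :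
    ‖deriv H z‖ ≤ 16 * M / R := by
  have hz : z ∈ ball z R := mem_ball_self hR
  have hda : DifferentiableAt ℂ H z := hd.differentiableAt (isOpen_ball.mem_nhds hz)
  set a : ℂ := I / M with ha
  set E : ℂ → ℂ := fun ζ => exp (a * H ζ) with hE
  have haI : ∀ ζ, (a * H ζ).re = -(H ζ).im / M := by
    intro ζ
    have : a * H ζ = (I * H ζ) / (M : ℝ) := by rw [ha]; ring
    rw [this, Complex.div_ofReal_re]
    simp
  have hEn : ∀ ζ ∈ ball z R, ‖E ζ‖ ≤ Real.exp 1 := by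
    intro ζ hζ
    rw [hE, Complex.norm_exp, Real.exp_le_exp, haI, div_le_one hM]
    exact (neg_le_abs _).trans (hb ζ hζ)
  have hEz : Real.exp (-1) ≤ ‖E z‖ := by
    rw [hE, Complex.norm_exp, Real.exp_le_exp, haI, le_div_iff₀ hM]
    have := (le_abs_self _).trans (hb z hz)
    linarith
  have hEd : DifferentiableOn ℂ E (ball z R) := (hd.const_mul a).cexp
  have h1 : ‖deriv E z‖ ≤ Real.exp 1 / (R / 2) := by
    refine Complex.norm_deriv_le_of_forall_mem_sphere_norm_le (by linarith) ?_ ?_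
    · refine (hEd.mono ?_).diffContOnCl
      exact closure_ball_subset_closedBall.trans (closedBall_subset_ball (by linarith))
    · intro ζ hζ
      exact hEn ζ (sphere_subset_closedBall.trans (closedBall_subset_ball (by linarith)) hζ)
  have h2 : deriv E z = E z * (a * deriv H z) := by
    have := (hda.hasDerivAt.const_mul a).cexp
    exact this.deriv
  rw [h2, norm_mul, norm_mul] at h1
  have han : ‖a‖ = 1 / M := by
    rw [ha, norm_div, norm_I, Complex.norm_real, Real.norm_of_nonneg hM.le]
  rw [han] at h1
  have he : Real.exp 1 < 2.8 := Real.exp_one_lt_d9.trans (by norm_num)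
  have he' : Real.exp (-1) * Real.exp 1 = 1 := by rw [← Real.exp_add]; simp
  have hepos := Real.exp_pos 1
  set D := ‖deriv H z‖
  have hD : 0 ≤ D := norm_nonneg _
  have h3 : Real.exp (-1) * (1 / M * D) ≤ Real.exp 1 / (R / 2) :=
    (mul_le_mul_of_nonneg_right hEz (by positivity)).trans h1
  have h4 : 1 / M * D ≤ Real.exp 1 * Real.exp 1 / (R / 2) := by
    calc 1 / M * D = Real.exp 1 * (Real.exp (-1) * (1 / M * D)) := by
          rw [← mul_assoc, mul_comm (Real.exp 1), he', one_mul]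
      _ ≤ Real.exp 1 * (Real.exp 1 / (R / 2)) := mul_le_mul_of_nonneg_left h3 hepos.le
      _ = _ := by ring
  have h5 : Real.exp 1 * Real.exp 1 ≤ 8 := by nlinarith
  have h6 : 1 / M * D ≤ 8 / (R / 2) := h4.trans (by gcongr)
  calc D = M * (1 / M * D) := by field_simp
    _ ≤ M * (8 / (R / 2)) := mul_le_mul_of_nonneg_left h6 hM.le
    _ = 16 * M / R := by field_simp; norm_num

/-- A holomorphic self-map `F` of `ℍ` with `F ζ = ζ - m / ζ + o(1 / ζ)` at infinity. -/
structure PickShift (F : ℂ → ℂ) (m : ℝ) : Prop where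
  pos : 0 < m
  holo : DifferentiableOn ℂ F UHP
  maps : MapsTo F UHP UHP
  asymp : Tendsto (fun ζ => ζ * (F ζ - ζ)) (cobounded ℂ ⊓ 𝓟 UHP) (𝓝 (-(m : ℂ)))

theorem tendsto_zero_of_mul_id {h : ℂ → ℂ} {l : Filter ℂ} {c : ℂ} (hl : l ≤ cobounded ℂ)
    (hh : Tendsto (fun ζ => ζ * h ζ) l (𝓝 c)) : Tendsto h l (𝓝 0) := by
  have h1 : Tendsto (fun ζ : ℂ => ζ⁻¹) l (𝓝 0) := tendsto_inv₀_cobounded.mono_left hl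
  have h2 := h1.mul hh
  rw [zero_mul] at h2
  refine h2.congr' ?_
  have : ∀ᶠ ζ : ℂ in l, ζ ≠ 0 := hl (eventually_ne_cobounded 0)
  filter_upwards [this] with ζ hζ
  field_simp

theorem exists_norm_bound_of_eventually {P : ℂ → Prop}
    (h : ∀ᶠ ζ in cobounded ℂ ⊓ 𝓟 UHP, P ζ) : ∃ R : ℝ, ∀ ζ ∈ UHP, R ≤ ‖ζ‖ → P ζ := by
  rw [eventually_inf_principal, (hasBasis_cobounded_norm (E := ℂ)).eventually_iff] at h
  obtain ⟨R, -, hR⟩ := h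
  exact ⟨R, fun ζ h1 h2 => hR h2 h1⟩

theorem tendsto_mul_I_atTop :
    Tendsto (fun y : ℝ => (y : ℂ) * I) atTop (cobounded ℂ ⊓ 𝓟 UHP) := by
  refine tendsto_inf.2 ⟨?_, tendsto_principal.2 ?_⟩
  · rw [← tendsto_norm_atTop_iff_cobounded]
    simpa using tendsto_abs_atTop_atTop
  · filter_upwards [eventually_gt_atTop 0] with y hy
    simpa [UHP] using hy

namespace PickShift

variable {F : ℂ → ℂ} {m : ℝ}

theorem tendsto_sub (hF : PickShift F m) :
    Tendsto (fun ζ => F ζ - ζ) (cobounded ℂ ⊓ 𝓟 UHP) (𝓝 0) :=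
  tendsto_zero_of_mul_id inf_le_left hF.asymp

theorem holo_sub (hF : PickShift F m) : DifferentiableOn ℂ (fun ζ => F ζ - ζ) UHP :=
  hF.holo.sub differentiableOn_id

theorem im_sub_nonneg (hF : PickShift F m) : ∀ ζ ∈ UHP, 0 ≤ (F ζ - ζ).im := by
  refine im_nonneg_of_boundary hF.holo_sub ?_ ?_
  · intro ε hε
    refine exists_norm_bound_of_eventually ?_
    have := (Metric.tendsto_nhds.1 hF.tendsto_sub) ε hε
    filter_upwards [this] with ζ hζ
    rw [dist_zero_right] at hζ
    have := (Complex.abs_im_le_norm (F ζ - ζ)).trans hζ.le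
    exact (abs_le.1 this).1
  · intro x ε hε
    have : ∀ᶠ ζ : ℂ in 𝓝 (x : ℂ), ζ.im < ε :=
      Complex.continuous_im.continuousAt.eventually_lt continuousAt_const (by simpa using hε)
    filter_upwards [this] with ζ h1 h2
    have : 0 < (F ζ).im := hF.maps h2
    simp only [Complex.sub_im]
    linarith

theorem im_sub_pos (hF : PickShift F m) : ∀ ζ ∈ UHP, 0 < (F ζ - ζ).im := by
  intro ζ₀ h₀
  refine lt_of_le_of_ne (hF.im_sub_nonneg ζ₀ h₀) fun heq => ?_
  have hconst := Complex.norm_eqOn_of_isPreconnected_of_isMaxOn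
    (f := fun ζ => exp (I * (F ζ - ζ))) isPreconnected_UHP isOpen_UHP
    ((hF.holo_sub.const_mul I).cexp) h₀ (by
      intro ζ hζ
      simp only [Set.mem_ofPred_eq, Function.comp, Complex.norm_exp]
      have := hF.im_sub_nonneg ζ hζ
      simp only [Complex.sub_im] at this heq
      simp
      linarith)
  have him : ∀ ζ ∈ UHP, (F ζ - ζ).im = 0 := by
    intro ζ hζ
    have h2 := hconst hζ
    simp only [Function.comp, Function.const, Complex.norm_exp, Real.exp_eq_exp] at h2
    simp only [Complex.sub_im] at heq ⊢
    simp at h2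
    linarith
  have h1 := hF.asymp.comp tendsto_mul_I_atTop
  have h2 := (Complex.continuous_re.tendsto _).comp h1
  have h3 : Tendsto (fun _ : ℝ => (0 : ℝ)) atTop (𝓝 (-(m : ℂ)).re) := by
    refine h2.congr' ?_
    filter_upwards [eventually_gt_atTop 0] with y hy
    have := him (y * I) (by simpa [UHP] using hy)
    simp only [Complex.sub_im] at this
    simp at this
    simp [this]
  have := tendsto_nhds_unique h3 tendsto_const_nhds
  simp at this
  exact hF.pos.ne' this

end PickShift

/-- Julia's inequality at infinity for a holomorphic function with nonnegative imaginary part. -/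
theorem mul_im_le_of_tendsto {N : ℂ → ℂ} {κ : ℝ} (hd : DifferentiableOn ℂ N UHP)
    (hN : ∀ ζ ∈ UHP, 0 ≤ (N ζ).im)
    (hlim : Tendsto (fun y : ℝ => (N (y * I)).im / y) atTop (𝓝 κ)) :
    ∀ ζ ∈ UHP, κ * ζ.im ≤ (N ζ).im := by
  intro ζ hζ
  have key : ∀ ε, 0 < ε → ε < ζ.im → (κ - ε) * ζ.im - (N ζ).im ≤ κ * ε := by
    intro ε hε hεζ
    set Z : ℂ → ℂ := fun z => I * z + I * (ε : ℂ) with hZ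
    have hZim : ∀ z, (Z z).im = z.re + ε := fun z => by simp [hZ]
    have hZd : Differentiable ℂ Z := by fun_prop
    set Φ : ℂ → ℂ := fun z => exp (I * (N (Z z) - ((κ - ε : ℝ) : ℂ) * Z z)) with hΦ
    have hΦn : ∀ z, ‖Φ z‖ = Real.exp ((κ - ε) * (z.re + ε) - (N (Z z)).im) := by
      intro z
      rw [hΦ, Complex.norm_exp, ← hZim]
      congr 1
      simp
    have hZU : ∀ z : ℂ, 0 ≤ z.re → Z z ∈ UHP := by
      intro z hz
      change 0 < (Z z).im
      rw [hZim]; linarith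
    have hΦd : DiffContOnCl ℂ Φ {z | 0 < z.re} := by
      refine DifferentiableOn.diffContOnCl ?_
      rw [Complex.closure_setOfPred_lt_re]
      refine DifferentiableOn.cexp (DifferentiableOn.const_mul ?_ I)
      refine (hd.comp hZd.differentiableOn fun z hz => hZU z hz).sub ?_
      exact (hZd.differentiableOn.const_mul _)
    have hfin := PhragmenLindelof.right_half_plane_of_bounded_on_real (C := Real.exp (κ * ε))
      (z := -I * ζ - ε) hΦd ?_ ?_ ?_ ?_
    · rw [hΦn, Real.exp_le_exp] at hfin
      have h1 : Z (-I * ζ - ε) = ζ := by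
        simp only [hZ]
        linear_combination -ζ * I_mul_I
      rw [h1] at hfin
      simpa using hfin
    · refine ⟨1, by norm_num, |κ - ε|, Asymptotics.IsBigO.of_bound (Real.exp (|κ - ε| * ε)) ?_⟩
      rw [eventually_inf_principal]
      refine Eventually.of_forall fun z hz => ?_
      rw [hΦn, Real.norm_of_nonneg (Real.exp_nonneg _), ← Real.exp_add, Real.exp_le_exp,
        Real.rpow_one]
      have h1 := hN _ (hZU z (show (0:ℝ) < z.re from hz).le)
      have h2 : (κ - ε) * (z.re + ε) ≤ |κ - ε| * (‖z‖ + ε) := by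
        have : (0:ℝ) < z.re := hz
        have := Complex.re_le_norm z
        gcongr
        exact le_abs_self _
      linarith
    · refine isBoundedUnder_of_eventually_le (a := 1) ?_
      have h1 : ∀ᶠ y : ℝ in atTop, κ - ε < (N (y * I)).im / y :=
        hlim.eventually (lt_mem_nhds (by linarith))
      have h2 := (tendsto_atTop_add_const_right atTop ε tendsto_id).eventually h1
      filter_upwards [h2, eventually_gt_atTop 0] with x hx hx0
      have hZx : Z (x : ℂ) = ((id x + ε : ℝ) : ℂ) * I := by
        simp only [hZ]; push_cast; simp; ring
      rw [← hZx, lt_div_iff₀ (by simp; linarith)] at hx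
      rw [hΦn, Real.exp_le_one_iff]
      simp only [id, ofReal_re] at hx ⊢
      linarith
    · intro x
      rw [hΦn, Real.exp_le_exp]
      have h1 := hN (Z (x * I)) (hZU _ (by simp))
      simp at h1 ⊢
      nlinarith
    · simp
      linarith
  have hlim2 : Tendsto (fun ε : ℝ => (κ - ε) * ζ.im - (N ζ).im) (𝓝[>] 0)
      (𝓝 ((κ - 0) * ζ.im - (N ζ).im)) :=
    (Continuous.tendsto (by fun_prop) _).mono_left nhdsWithin_le_nhds
  have hlim3 : Tendsto (fun ε : ℝ => κ * ε) (𝓝[>] 0) (𝓝 (κ * 0)) :=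
    (Continuous.tendsto (by fun_prop) _).mono_left nhdsWithin_le_nhds
  have := le_of_tendsto_of_tendsto hlim2 hlim3 (by
    filter_upwards [Ioo_mem_nhdsGT (show (0:ℝ) < ζ.im from hζ)] with ε hε
    exact key ε hε.1 hε.2)
  linarith

namespace PickShift

variable {F : ℂ → ℂ} {m : ℝ}

theorem sub_ne_zero (hF : PickShift F m) {ζ : ℂ} (hζ : ζ ∈ UHP) : F ζ - ζ ≠ 0 := by
  intro h
  have := hF.im_sub_pos ζ hζ
  rw [h] at this
  simp at this

theorem normSq_sub_le (hF : PickShift F m) {ζ : ℂ} (hζ : ζ ∈ UHP) :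
    ζ.im * normSq (F ζ - ζ) ≤ m * (F ζ - ζ).im := by
  have h1 := mul_im_le_of_tendsto (N := fun ζ => -(F ζ - ζ)⁻¹) (κ := m⁻¹)
    (hF.holo_sub.inv fun ζ hζ => hF.sub_ne_zero hζ).neg ?_ ?_ ζ hζ
  · have h2 : 0 < normSq (F ζ - ζ) := normSq_pos.2 (hF.sub_ne_zero hζ)
    have hm := hF.pos
    simp only [neg_im, inv_im, neg_div, neg_neg] at h1
    rw [le_div_iff₀ h2, inv_mul_eq_div, div_mul_eq_mul_div, div_le_iff₀ hm] at h1
    linarith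
  · intro z hz
    simp only [neg_im, inv_im, neg_div, neg_neg]
    exact div_nonneg (hF.im_sub_nonneg z hz) (normSq_nonneg _)
  · have h2 := hF.asymp.comp tendsto_mul_I_atTop
    have h3 := (h2.inv₀ (by simpa using hF.pos.ne')).neg
    have h4 := (Complex.continuous_re.tendsto _).comp h3
    have h5 : (-(-(m : ℂ))⁻¹).re = m⁻¹ := by
      rw [inv_neg, neg_neg, ← ofReal_inv, ofReal_re]
    rw [h5] at h4
    refine h4.congr' ?_
    filter_upwards [eventually_gt_atTop 0] with y hy
    simp only [Function.comp]
    have : -((y : ℂ) * I * (F (y * I) - y * I))⁻¹ = -(F (y * I) - y * I)⁻¹ * (-I) / (y : ℝ) := by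
      have : (y : ℂ) ≠ 0 := by exact_mod_cast hy.ne'
      rw [mul_inv, mul_inv, inv_I]
      field_simp
    rw [this, div_ofReal_re]
    congr 1
    simp

theorem norm_sub_le (hF : PickShift F m) {ζ : ℂ} (hζ : ζ ∈ UHP) : ‖F ζ - ζ‖ ≤ m / ζ.im := by
  have h1 := hF.normSq_sub_le hζ
  have h2 := Complex.im_le_norm (F ζ - ζ)
  have h3 : 0 < ‖F ζ - ζ‖ := norm_pos_iff.2 (hF.sub_ne_zero hζ)
  rw [normSq_eq_norm_sq] at h1
  rw [le_div_iff₀ hζ]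
  have hm := hF.pos
  have : ζ.im * ‖F ζ - ζ‖ ^ 2 ≤ m * ‖F ζ - ζ‖ := h1.trans (by gcongr)
  by_contra! hlt
  nlinarith

/-- `F` covers the half-plane `{Im > 2√m}`, moving points by at most `√m`. -/
theorem exists_preimage (hF : PickShift F m) {z : ℂ} (hz : 2 * √m < z.im) :
    ∃ ζ, √m < ζ.im ∧ F ζ = z := by
  have hm := hF.pos
  set r := √m with hr
  have hrpos : 0 < r := Real.sqrt_pos.2 hm
  have hrr : r * r = m := Real.mul_self_sqrt hm.le
  set U : Set ℂ := {ζ | r < ζ.im} with hU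
  set W : Set ℂ := {ζ | 2 * r < ζ.im} with hW
  have hUopen : IsOpen U := isOpen_lt continuous_const Complex.continuous_im
  have hUsub : U ⊆ UHP := fun ζ h => lt_trans hrpos h
  have hUpre : IsPreconnected U := (convex_halfSpace_im_gt r).isPreconnected
  have hWpre : IsPreconnected W := (convex_halfSpace_im_gt (2 * r)).isPreconnected
  have hclose : ∀ ζ ∈ U, ‖F ζ - ζ‖ ≤ r := by
    intro ζ hζ
    refine (hF.norm_sub_le (hUsub hζ)).trans ?_
    rw [div_le_iff₀ (hUsub hζ)]
    have : r < ζ.im := hζ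
    nlinarith
  have hopen : IsOpen (F '' U) := by
    rcases AnalyticOnNhd.is_constant_or_isOpen (g := F) (U := U)
      ((hF.holo.mono hUsub).analyticOnNhd hUopen) hUpre with ⟨w, hw⟩ | h
    · exfalso
      have h1 := hclose (((w.im + 3 * r + |w.im| + r : ℝ) : ℂ) * I)
        (by simp [hU]; have := neg_abs_le w.im; linarith)
      rw [hw _ (by simp [hU]; have := neg_abs_le w.im; linarith)] at h1
      have h2 := (Complex.abs_im_le_norm _).trans h1
      have h3 := (abs_le.1 h2).1
      simp at h3
      have := abs_nonneg w.im
      linarith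
    · exact h U Subset.rfl hUopen
  have hsub : W ⊆ F '' U := by
    refine hWpre.subset_of_closure_inter_subset hopen ?_ ?_
    · set ζ₁ : ℂ := ((4 * r : ℝ) : ℂ) * I
      have h1 : ζ₁ ∈ U := by simp [hU, ζ₁]; linarith
      refine ⟨F ζ₁, ?_, mem_image_of_mem F h1⟩
      have h2 := (abs_le.1 ((Complex.abs_im_le_norm _).trans (hclose ζ₁ h1))).1
      have h3 : ζ₁.im = 4 * r := by simp [ζ₁]
      simp only [sub_im] at h2
      change 2 * r < (F ζ₁).im
      linarith
    · rintro p ⟨hp, hpW⟩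
      obtain ⟨x, hx, hlim⟩ := mem_closure_iff_seq_limit.1 hp
      choose u hu hux using hx
      have hxp : ∀ᶠ n in atTop, u n ∈ closedBall p (r + 1) := by
        filter_upwards [(Metric.tendsto_nhds.1 hlim) 1 one_pos] with n hn
        rw [mem_closedBall]
        have h1 := hclose (u n) (hu n)
        rw [hux n, ← dist_eq_norm] at h1
        calc dist (u n) p ≤ dist (u n) (x n) + dist (x n) p := dist_triangle _ _ _
          _ ≤ r + 1 := by rw [dist_comm]; linarith
      obtain ⟨q, -, φ, hφ, hq⟩ := (isCompact_closedBall p (r + 1)).tendsto_subseq' hxp.frequently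
      have hqx : Tendsto (fun n => x (φ n)) atTop (𝓝 p) := hlim.comp hφ.tendsto_atTop
      have h1 : ‖p - q‖ ≤ r := by
        refine le_of_tendsto (hqx.sub hq).norm (Eventually.of_forall fun n => ?_)
        have := hclose (u (φ n)) (hu _)
        rwa [hux] at this
      have hqU : q ∈ U := by
        have h2 := (abs_le.1 ((Complex.abs_im_le_norm _).trans h1)).2
        simp only [sub_im] at h2
        have : 2 * r < p.im := hpW
        change r < q.im
        linarith
      refine ⟨q, hqU, ?_⟩
      have hc : ContinuousAt F q :=
        (hF.holo.continuousOn.continuousAt (isOpen_UHP.mem_nhds (hUsub hqU)))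
      refine tendsto_nhds_unique (hc.tendsto.comp hq) (hqx.congr fun n => ?_)
      simp [hux]
  obtain ⟨ζ, hζ, h⟩ := hsub hz
  exact ⟨ζ, hζ, h⟩

theorem norm_sub_le_sqrt (hF : PickShift F m) {ζ : ℂ} (hζ : √m ≤ ζ.im) : ‖F ζ - ζ‖ ≤ √m := by
  have hr : 0 < √m := Real.sqrt_pos.2 hF.pos
  have hrr : √m * √m = m := Real.mul_self_sqrt hF.pos.le
  refine (hF.norm_sub_le (hr.trans_le hζ)).trans ?_
  rw [div_le_iff₀ (hr.trans_le hζ)]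
  nlinarith

theorem abs_im_mul_sub_le (hF : PickShift F m) {w ρ : ℝ} (hρ : 0 < ρ)
    (hbd : ∀ x : ℝ, 2 * ρ < |x - w| → Tendsto (fun ζ => (F ζ).im) (𝓝[UHP] (x : ℂ)) (𝓝 0))
    (hloc : ∀ x : ℝ, ∃ C, ∀ᶠ ζ in 𝓝[UHP] (x : ℂ), ‖F ζ - ζ‖ ≤ C) {ζ : ℂ} (hζ : ζ ∈ UHP) :
    |((ζ - w) * (F ζ - ζ)).im| ≤ 3 * ρ * (F ζ - ζ).im := by
  have key : ∀ σ : ℝ, |σ| = 1 → ∀ ζ ∈ UHP,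
      0 ≤ (3 * ρ * (F ζ - ζ) + σ * ((ζ - w) * (F ζ - ζ))).im := by
    intro σ hσ
    have him : ∀ ζ : ℂ, (3 * ρ * (F ζ - ζ) + σ * ((ζ - w) * (F ζ - ζ))).im =
        (3 * ρ + σ * (ζ.re - w)) * (F ζ - ζ).im + σ * (ζ.im * (F ζ - ζ).re) := by
      intro ζ
      simp
      ring
    refine im_nonneg_of_boundary ?_ ?_ ?_
    · have := hF.holo_sub
      exact (this.const_mul _).add (((differentiableOn_id.sub_const _).mul this).const_mul _)
    · intro ε hε
      refine exists_norm_bound_of_eventually ?_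
      have h0 := hF.tendsto_sub
      have h1 : Tendsto (fun ζ => 3 * ρ * (F ζ - ζ) + σ * (ζ * (F ζ - ζ) - w * (F ζ - ζ)))
          (cobounded ℂ ⊓ 𝓟 UHP) (𝓝 (3 * ρ * 0 + σ * (-(m : ℂ) - w * 0))) :=
        (h0.const_mul _).add ((hF.asymp.sub (h0.const_mul _)).const_mul _)
      have h2 := (Complex.continuous_im.tendsto _).comp h1
      have h3 := h2.eventually (lt_mem_nhds (show -ε < _ by simpa using hε))
      filter_upwards [h3] with ζ hζ
      simp only [Function.comp, ← sub_mul] at hζ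
      exact hζ.le
    · intro x ε hε
      rw [← eventually_nhdsWithin_iff]
      simp only [him]
      obtain ⟨C, hC⟩ := hloc x
      have hy : Tendsto (fun ζ : ℂ => ζ.im) (𝓝[UHP] (x : ℂ)) (𝓝 0) := by
        have := (Complex.continuous_im.tendsto (x : ℂ)).mono_left
          (nhdsWithin_le_nhds (s := UHP))
        simpa using this
      have hx : Tendsto (fun ζ : ℂ => ζ.re) (𝓝[UHP] (x : ℂ)) (𝓝 x) := by
        have := (Complex.continuous_re.tendsto (x : ℂ)).mono_left
          (nhdsWithin_le_nhds (s := UHP))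
        simpa using this
      have hyre : Tendsto (fun ζ : ℂ => σ * (ζ.im * (F ζ - ζ).re)) (𝓝[UHP] (x : ℂ))
          (𝓝 (σ * 0)) := by
        refine (hy.zero_mul_isBoundedUnder_le ?_).const_mul σ
        refine isBoundedUnder_of_eventually_le (a := C) ?_
        filter_upwards [hC] with ζ h
        exact (Complex.abs_re_le_norm _).trans h
      rw [mul_zero] at hyre
      have h2 := hyre.eventually (lt_mem_nhds (show -(ε / 2) < 0 by linarith))
      rcases le_or_gt |x - w| (2 * ρ) with hcase | hcase
      · have h3 : Tendsto (fun ζ : ℂ => 3 * ρ + σ * (ζ.re - w)) (𝓝[UHP] (x : ℂ))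
            (𝓝 (3 * ρ + σ * (x - w))) := ((hx.sub_const w).const_mul σ).const_add _
        have h4 : 0 < 3 * ρ + σ * (x - w) := by
          have := neg_abs_le (σ * (x - w))
          rw [abs_mul, hσ, one_mul] at this
          linarith
        filter_upwards [h2, h3.eventually (lt_mem_nhds h4), self_mem_nhdsWithin] with ζ k1 k2 k3
        have := mul_nonneg k2.le (hF.im_sub_nonneg ζ k3)
        linarith
      · have h3 : Tendsto (fun ζ : ℂ => (3 * ρ + σ * (ζ.re - w)) * (F ζ - ζ).im)
            (𝓝[UHP] (x : ℂ)) (𝓝 ((3 * ρ + σ * (x - w)) * (0 - 0))) := by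
          refine Tendsto.mul (((hx.sub_const w).const_mul σ).const_add _) ?_
          exact (hbd x hcase).sub hy
        rw [sub_zero, mul_zero] at h3
        filter_upwards [h2, h3.eventually (lt_mem_nhds (show -(ε / 2) < 0 by linarith))]
          with ζ k1 k2
        linarith
  have e : (3 * (ρ : ℂ) * (F ζ - ζ)).im = 3 * ρ * (F ζ - ζ).im := by
    have : 3 * (ρ : ℂ) * (F ζ - ζ) = ((3 * ρ : ℝ) : ℂ) * (F ζ - ζ) := by push_cast; ring
    rw [this, im_ofReal_mul]
  have h1 := key 1 (by simp) ζ hζ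
  have h2 := key (-1) (by simp) ζ hζ
  rw [add_im, e, im_ofReal_mul] at h1 h2
  rw [abs_le]
  constructor <;> linarith

/-- If `F` extends continuously to the real line away from `[w - 2ρ, w + 2ρ]`, taking real values
there, then `F ζ - ζ` is close to `-m / (ζ - w)`. -/
theorem norm_mul_sub_add_le (hF : PickShift F m) {w ρ : ℝ} (hρ : 0 < ρ)
    (hbd : ∀ x : ℝ, 2 * ρ < |x - w| → Tendsto (fun ζ => (F ζ).im) (𝓝[UHP] (x : ℂ)) (𝓝 0))
    (hloc : ∀ x : ℝ, ∃ C, ∀ᶠ ζ in 𝓝[UHP] (x : ℂ), ‖F ζ - ζ‖ ≤ C) {ζ : ℂ} (hζ : ζ ∈ UHP) :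
    ‖(ζ - w) * (F ζ - ζ) + m‖ ≤ 192 * ρ * m / ζ.im := by
  have hm := hF.pos
  set A : ℂ → ℂ := fun ζ => (ζ - w) * (F ζ - ζ) with hA
  have hAd : DifferentiableOn ℂ A UHP := (differentiableOn_id.sub_const _).mul hF.holo_sub
  have hderiv : ∀ z ∈ UHP, ‖deriv A z‖ ≤ 192 * ρ * m / z.im ^ 2 := by
    intro z hz
    have hz0 : (0:ℝ) < z.im := hz
    have him : ∀ ξ ∈ ball z (z.im / 2), z.im / 2 < ξ.im := by
      intro ξ hξ
      rw [mem_ball, dist_eq_norm] at hξ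
      have := (abs_lt.1 ((Complex.abs_im_le_norm _).trans_lt hξ)).1
      simp only [sub_im] at this
      linarith
    have hsub : ball z (z.im / 2) ⊆ UHP := fun ξ hξ => (half_pos hz0).trans (him ξ hξ)
    have := norm_deriv_le_of_abs_im_le (H := A) (z := z) (half_pos hz0)
      (M := 6 * ρ * m / z.im) (by positivity) (hAd.mono hsub) (by
        intro ξ hξ
        refine (hF.abs_im_mul_sub_le hρ hbd hloc (hsub hξ)).trans ?_
        have h1 := (Complex.im_le_norm _).trans (hF.norm_sub_le (hsub hξ))
        calc 3 * ρ * (F ξ - ξ).im ≤ 3 * ρ * (m / ξ.im) := by gcongr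
          _ ≤ 3 * ρ * (m / (z.im / 2)) := by
            gcongr
            exact (him ξ hξ).le
          _ = 6 * ρ * m / z.im := by field_simp; norm_num)
    refine this.trans (le_of_eq ?_)
    field_simp
    norm_num
  have hy : (0:ℝ) < ζ.im := hζ
  set γ : ℝ → ℂ := fun v => ζ.re + ((v⁻¹ : ℝ) : ℂ) * I with hγ
  have hγim : ∀ v, (γ v).im = v⁻¹ := fun v => by simp [hγ]
  have hγd : ∀ v : ℝ, 0 < v → HasDerivAt γ (((-(v ^ 2)⁻¹ : ℝ) : ℂ) * I) v := by
    intro v hv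
    have := ((hasDerivAt_inv hv.ne').ofReal_comp.mul_const I).const_add (ζ.re : ℂ)
    simpa [hγ] using this
  have hBd : ∀ v ∈ Ioi (0:ℝ), HasDerivWithinAt (A ∘ γ)
      (deriv A (γ v) * (((-(v ^ 2)⁻¹ : ℝ) : ℂ) * I)) (Ioi 0) v := by
    intro v hv
    have hv' : γ v ∈ UHP := by
      change 0 < (γ v).im
      rw [hγim]
      exact inv_pos.2 hv
    have h1 : HasDerivAt A (deriv A (γ v)) (γ v) :=
      (hAd.differentiableAt (isOpen_UHP.mem_nhds hv')).hasDerivAt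
    exact (h1.comp v (hγd v hv)).hasDerivWithinAt
  have hb : ∀ v ∈ Ioi (0:ℝ), ‖deriv A (γ v) * (((-(v ^ 2)⁻¹ : ℝ) : ℂ) * I)‖ ≤ 192 * ρ * m := by
    intro v hv
    have hv0 : (0:ℝ) < v := hv
    have hv' : γ v ∈ UHP := by
      change 0 < (γ v).im
      rw [hγim]
      exact inv_pos.2 hv
    rw [norm_mul, norm_mul, norm_I, mul_one, Complex.norm_real, norm_neg,
      Real.norm_of_nonneg (by positivity)]
    calc ‖deriv A (γ v)‖ * (v ^ 2)⁻¹ ≤ 192 * ρ * m / (γ v).im ^ 2 * (v ^ 2)⁻¹ := by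
          gcongr
          exact hderiv _ hv'
      _ = 192 * ρ * m := by rw [hγim]; field_simp
  have hγζ : γ (ζ.im)⁻¹ = ζ := by
    simp [hγ, Complex.re_add_im]
  have hmv : ∀ v ∈ Ioi (0:ℝ), ‖A ζ - A (γ v)‖ ≤ 192 * ρ * m * ‖(ζ.im)⁻¹ - v‖ := by
    intro v hv
    have := (convex_Ioi (0:ℝ)).norm_image_sub_le_of_norm_hasDerivWithin_le hBd hb hv
      (inv_pos.2 hy)
    simpa [hγζ] using this
  have hAinf : Tendsto A (cobounded ℂ ⊓ 𝓟 UHP) (𝓝 (-(m : ℂ))) := by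
    have := hF.asymp.sub (hF.tendsto_sub.const_mul (w : ℂ))
    rw [mul_zero, sub_zero] at this
    refine this.congr fun z => ?_
    simp only [hA]
    ring
  have hγinf : Tendsto γ (𝓝[>] 0) (cobounded ℂ ⊓ 𝓟 UHP) := by
    refine tendsto_inf.2 ⟨?_, tendsto_principal.2 ?_⟩
    · rw [← tendsto_norm_atTop_iff_cobounded]
      refine tendsto_atTop_mono (fun v => ?_) tendsto_inv_nhdsGT_zero
      rw [← hγim]
      exact Complex.im_le_norm _
    · filter_upwards [self_mem_nhdsWithin] with v hv
      change 0 < (γ v).im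
      rw [hγim]
      exact inv_pos.2 hv
  have h1 : Tendsto (fun v => ‖A ζ - A (γ v)‖) (𝓝[>] 0) (𝓝 ‖A ζ - -(m : ℂ)‖) :=
    ((hAinf.comp hγinf).const_sub _).norm
  have h2 : Tendsto (fun v : ℝ => 192 * ρ * m * ‖(ζ.im)⁻¹ - v‖) (𝓝[>] 0)
      (𝓝 (192 * ρ * m * ‖(ζ.im)⁻¹ - 0‖)) :=
    (Continuous.tendsto (by fun_prop) _).mono_left nhdsWithin_le_nhds
  have h3 := le_of_tendsto_of_tendsto h1 h2 (by
    filter_upwards [self_mem_nhdsWithin] with v hv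
    exact hmv v hv)
  rw [sub_neg_eq_add, sub_zero, Real.norm_of_nonneg (inv_nonneg.2 hy.le)] at h3
  rwa [div_eq_mul_inv]

end PickShift

/-- The part of an annulus about a real point lying in `ℍ` is connected. -/
theorem isPreconnected_UHP_annulus (w : ℝ) {J : Set ℝ} (hJ : J.OrdConnected) :
    IsPreconnected {ζ : ℂ | ζ ∈ UHP ∧ ‖ζ - w‖ ∈ J} := by
  have h1 : IsPreconnected ((J ∩ Ioi 0) ×ˢ Ioo 0 Real.pi) :=
    (hJ.inter ordConnected_Ioi).isPreconnected.prod isPreconnected_Ioo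
  have h2 := h1.image (fun q : ℝ × ℝ => (w : ℂ) + q.1 * exp (q.2 * I)) (by fun_prop)
  have h3 : {ζ : ℂ | ζ ∈ UHP ∧ ‖ζ - w‖ ∈ J} =
      (fun q : ℝ × ℝ => (w : ℂ) + q.1 * exp (q.2 * I)) ''
        ((J ∩ Ioi 0) ×ˢ Ioo 0 Real.pi) := by
    ext ζ
    constructor
    · rintro ⟨hζ, hn⟩
      have him : 0 < (ζ - w).im := by simpa using (show 0 < ζ.im from hζ)
      have hne : ζ - w ≠ 0 := fun h => by simp [h] at him
      refine ⟨(‖ζ - w‖, (ζ - w).arg), ⟨⟨hn, norm_pos_iff.2 hne⟩, ?_, ?_⟩, ?_⟩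
      · refine lt_of_le_of_ne (Complex.arg_nonneg_iff.2 him.le) fun h => ?_
        have := (Complex.arg_eq_zero_iff.1 h.symm).2
        exact him.ne' this
      · refine lt_of_le_of_ne (Complex.arg_le_pi _) fun h => ?_
        have := (Complex.arg_eq_pi_iff.1 h).2
        exact him.ne' this
      · simp only [Complex.norm_mul_exp_arg_mul_I]
        ring
    · rintro ⟨⟨r, θ⟩, ⟨⟨hrJ, hr⟩, hθ⟩, rfl⟩
      simp only [mem_Ioi] at hr
      constructor
      · change 0 < ((w : ℂ) + r * exp (θ * I)).im
        rw [add_im, ofReal_im, zero_add, im_ofReal_mul, Complex.exp_ofReal_mul_I_im]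
        exact mul_pos hr (Real.sin_pos_of_mem_Ioo hθ)
      · rw [add_sub_cancel_left, norm_mul, Complex.norm_exp_ofReal_mul_I, mul_one,
          Complex.norm_real, Real.norm_of_nonneg hr.le]
        exact hrJ
  rw [h3]
  exact h2

theorem eq_of_const_on_real_interval {f : ℂ → ℂ} {p : ℂ}
    (hc : ContinuousOn f {z : ℂ | 0 ≤ z.im}) (hd : DifferentiableOn ℂ f UHP)
    (hp : ∀ x ∈ Icc (-1 : ℝ) 1, f x = p) {z : ℂ} (hzx : |z.re| < 1) (hz0 : 0 < z.im)
    (hz1 : z.im < 1 / 2) (hu : 0 < 1 - 4 * z.im - 2 * (z.re ^ 2 - z.im ^ 2)) : f z = p := by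
  set U : Set ℂ := Ioo (-1) 1 ×ℂ Ioo 0 (1 / 2) with hU
  have hUbdd : IsBounded U := isBounded_Ioo _ _ |>.reProdIm (isBounded_Ioo _ _)
  have hUopen : IsOpen U := isOpen_Ioo.reProdIm isOpen_Ioo
  have hUcl : closure U = Icc (-1) 1 ×ℂ Icc 0 (1 / 2) := by
    rw [hU, Complex.closure_reProdIm, closure_Ioo (by norm_num), closure_Ioo (by norm_num)]
  have hclsub : closure U ⊆ {z : ℂ | 0 ≤ z.im} := by
    rw [hUcl]
    exact fun z hz => hz.2.1
  have hUsub : U ⊆ UHP := fun z hz => hz.2.1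
  have hcomp : IsCompact (closure U) := hUbdd.isCompact_closure
  obtain ⟨M, hM⟩ := hcomp.exists_bound_of_continuousOn
    (f := fun z => f z - p) ((hc.mono hclsub).sub continuousOn_const)
  have hMn : ∀ l : ℝ, 0 ≤ l → ‖f z - p‖ ≤
      M * Real.exp (-l * (1 - 4 * z.im - 2 * (z.re ^ 2 - z.im ^ 2))) := by
    intro l hl
    set L : ℂ → ℂ := fun z => l * (1 + 4 * I * z - 2 * z ^ 2) with hL
    have hLd : Differentiable ℂ L := by fun_prop
    have hLre : ∀ z : ℂ, (L z).re = l * (1 - 4 * z.im - 2 * (z.re ^ 2 - z.im ^ 2)) := by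
      intro z
      simp only [hL]
      rw [re_ofReal_mul]
      congr 1
      simp [sq]
      ring
    have hbound := Complex.norm_le_of_forall_mem_frontier_norm_le (f := fun z => (f z - p) *
      exp (L z)) (C := M) hUbdd ?_ ?_ (z := z)
      (subset_closure ⟨abs_lt.1 hzx, hz0, hz1⟩)
    · rw [norm_mul, Complex.norm_exp, hLre] at hbound
      rw [neg_mul, Real.exp_neg, ← div_eq_mul_inv, le_div_iff₀ (Real.exp_pos _)]
      exact hbound
    · refine ⟨((hd.mono hUsub).sub_const p).mul hLd.cexp.differentiableOn, ?_⟩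
      exact ((hc.mono hclsub).sub continuousOn_const).mul hLd.cexp.continuous.continuousOn
    · intro ξ hξ
      rw [norm_mul, Complex.norm_exp, hLre]
      have hξcl : ξ ∈ closure U := hξ.1
      have hξU : ξ ∉ U := by
        have := hξ.2
        rwa [hUopen.interior_eq] at this
      have hM0 : ‖f ξ - p‖ ≤ M := hM ξ hξcl
      rw [hUcl] at hξcl
      obtain ⟨hx, hy⟩ := hξcl
      simp only [mem_preimage, mem_Icc] at hx hy
      have h1 := sq_nonneg ξ.re
      by_cases hy0 : ξ.im = 0
      · have : ξ = (ξ.re : ℂ) := by apply Complex.ext <;> simp [hy0]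
        rw [this, hp ξ.re hx]
        simpa using (norm_nonneg _).trans hM0
      · have hneg : l * (1 - 4 * ξ.im - 2 * (ξ.re ^ 2 - ξ.im ^ 2)) ≤ 0 := by
          refine mul_nonpos_of_nonneg_of_nonpos hl ?_
          by_cases hy1 : ξ.im = 1 / 2
          · rw [hy1]; nlinarith
          · have hx1 : ξ.re ^ 2 = 1 := by
              by_contra hne
              refine hξU ⟨⟨lt_of_le_of_ne hx.1 ?_, lt_of_le_of_ne hx.2 ?_⟩,
                lt_of_le_of_ne hy.1 (Ne.symm hy0), lt_of_le_of_ne hy.2 hy1⟩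
              · intro h; apply hne; rw [← h]; norm_num
              · intro h; apply hne; rw [h]; norm_num
            nlinarith
        calc ‖f ξ - p‖ * Real.exp _ ≤ M * 1 := by
              gcongr
              · exact (norm_nonneg _).trans hM0
              · exact Real.exp_le_one_iff.2 hneg
          _ = M := mul_one M
  have hlim : Tendsto (fun l : ℝ => M * Real.exp
      (-l * (1 - 4 * z.im - 2 * (z.re ^ 2 - z.im ^ 2)))) atTop (𝓝 (M * 0)) := by
    refine (Real.tendsto_exp_atBot.comp ?_).const_mul M
    exact tendsto_neg_atTop_atBot.atBot_mul_const hu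
  rw [mul_zero] at hlim
  have := ge_of_tendsto hlim (by filter_upwards [eventually_ge_atTop 0] with l hl using hMn l hl)
  exact sub_eq_zero.1 (norm_le_zero_iff.1 this)

/-- An injective holomorphic function on `ℍ` cannot extend continuously to a real interval on which
it is constant. -/
theorem not_injOn_of_const_on_interval {f : ℂ → ℂ} {p : ℂ} {a b : ℝ} (hab : a < b)
    (hc : ContinuousOn f {z : ℂ | 0 ≤ z.im}) (hd : DifferentiableOn ℂ f UHP)
    (hp : ∀ x ∈ Icc a b, f x = p) : ¬ InjOn f UHP := by
  intro hinj
  set r := (b - a) / 2 with hr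
  have hr0 : 0 < r := by linarith
  set e : ℂ → ℂ := fun z => ((a + b) / 2 : ℝ) + (r : ℂ) * z with he
  have heim : ∀ z, (e z).im = r * z.im := fun z => by simp only [he]; simp
  have hed : Differentiable ℂ e := by fun_prop
  have heU : MapsTo e UHP UHP := fun z hz => by
    change 0 < (e z).im
    rw [heim]
    exact mul_pos hr0 hz
  have key := fun z => eq_of_const_on_real_interval (f := f ∘ e) (p := p) (z := z)
    (hc.comp hed.continuous.continuousOn fun z hz => by
      change 0 ≤ (e z).im
      rw [heim]
      exact mul_nonneg hr0.le hz)
    (hd.comp hed.differentiableOn heU) (by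
      intro x hx
      have : e x = (((a + b) / 2 + r * x : ℝ) : ℂ) := by simp only [he]; push_cast; ring
      simp only [Function.comp]
      rw [this]
      apply hp
      constructor <;> nlinarith [hx.1, hx.2])
  have h1 := key ⟨0, 1 / 10⟩ (by norm_num) (by norm_num) (by norm_num) (by norm_num)
  have h2 := key ⟨0, 1 / 20⟩ (by norm_num) (by norm_num) (by norm_num) (by norm_num)
  have h3 := hinj (heU (show (0:ℝ) < 1 / 10 by norm_num)) (heU (show (0:ℝ) < 1 / 20 by norm_num))
    (h1.trans h2.symm)
  have h4 := congrArg Complex.im h3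
  rw [heim, heim] at h4
  simp only at h4
  nlinarith

/-- A continuous inverse of an injective holomorphic function is holomorphic. -/
theorem differentiableOn_of_continuous_inverse {f g : ℂ → ℂ} {Ω U : Set ℂ} (hΩ : IsOpen Ω)
    (hU : IsOpen U) (hg : DifferentiableOn ℂ g Ω) (hgi : InjOn g Ω) (hf : ContinuousOn f U)
    (hfm : MapsTo f U Ω) (hgf : ∀ ζ ∈ U, g (f ζ) = ζ) : DifferentiableOn ℂ f U := by
  intro ζ₀ h₀
  refine DifferentiableAt.differentiableWithinAt ?_
  have hfi : InjOn f U := fun a ha b hb hab => by rw [← hgf a ha, ← hgf b hb, hab]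
  have hfc : ∀ ζ ∈ U, ContinuousAt f ζ := fun ζ hζ => hf.continuousAt (hU.mem_nhds hζ)
  have hgan : AnalyticOnNhd ℂ g Ω := hg.analyticOnNhd hΩ
  have hstep : ∀ ζ ∈ U, deriv g (f ζ) ≠ 0 → DifferentiableAt ℂ f ζ := by
    intro ζ hζ hne
    have h1 : HasDerivAt g (deriv g (f ζ)) (f ζ) :=
      (hg.differentiableAt (hΩ.mem_nhds (hfm hζ))).hasDerivAt
    refine (HasDerivAt.of_local_left_inverse (hfc ζ hζ) h1 hne ?_).differentiableAt
    filter_upwards [hU.mem_nhds hζ] with y hy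
    exact hgf y hy
  rcases (hgan (f ζ₀) (hfm h₀)).deriv.eventually_eq_zero_or_eventually_ne_zero with h | h
  · exfalso
    obtain ⟨ε, hε, hball⟩ := Metric.mem_nhds_iff.1 (Filter.inter_mem h (hΩ.mem_nhds (hfm h₀)))
    have hy : f ζ₀ + (ε / 2 : ℝ) ∈ ball (f ζ₀) ε := by
      rw [mem_ball, dist_eq_norm, add_sub_cancel_left, Complex.norm_real,
        Real.norm_of_nonneg (by linarith)]
      linarith
    have hconst := isOpen_ball.is_const_of_deriv_eq_zero (convex_ball (f ζ₀) ε).isPreconnected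
      (hg.mono fun y hy => (hball hy).2) (fun y hy => (hball hy).1) hy (mem_ball_self hε)
    have := hgi (hball hy).2 (hfm h₀) hconst
    simp at this
    exact hε.ne' this
  · have htend : Tendsto f (𝓝[≠] ζ₀) (𝓝[≠] (f ζ₀)) := by
      refine tendsto_nhdsWithin_iff.2 ⟨(hfc ζ₀ h₀).tendsto.mono_left nhdsWithin_le_nhds, ?_⟩
      filter_upwards [self_mem_nhdsWithin, mem_nhdsWithin_of_mem_nhds (hU.mem_nhds h₀)]
        with y hy hyU hyeq
      exact hy (hfi hyU h₀ hyeq)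
    refine (analyticAt_of_differentiable_on_punctured_nhds_of_continuousAt ?_
      (hfc ζ₀ h₀)).differentiableAt
    filter_upwards [htend.eventually h, mem_nhdsWithin_of_mem_nhds (hU.mem_nhds h₀)] with y h1 h2
    exact hstep y h2 h1

/-- A chordal Loewner curve `η` with driving function `w`, hulls `K t`, mapping-out functions `g t`
and continuous inverses `f t`, whose trace on the real line is Lebesgue-null. -/
structure LoewnerCurve (T : ℝ) (w : ℝ → ℝ) (η : ℝ → ℂ) (K : ℝ → Set ℂ) (g : ℝ → ℂ → ℂ)
    (S : ℝ → Set ℝ) (f : ℝ → ℂ → ℂ) : Prop where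
  w_cont : ContinuousOn w (Set.Ico 0 T)
  η_cont : ContinuousOn η (Set.Ico 0 T)
  η_im : ∀ t ∈ Set.Ico 0 T, 0 ≤ (η t).im
  K_zero : K 0 = ∅
  g_zero : ∀ z, g 0 z = z
  hull : ∀ t ∈ Set.Ioo 0 T, IsHullMap (K t) (g t) (S t) ∧ (K t).Nonempty
  mono : ∀ s t : ℝ, 0 ≤ s → s ≤ t → t < T → K s ⊆ K t
  cap : ∀ t ∈ Set.Ico 0 T, HasHcap (g t) (2 * t)
  gen : ∀ t ∈ Set.Ico 0 T,
      η '' Set.Icc 0 t ∩ UHP ⊆ K t ∧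
      ¬ IsBounded (UHP \ K t) ∧
      ∃ z₀ ∈ UHP \ closure (η '' Set.Icc 0 t),
        UHP \ K t = connectedComponentIn (UHP \ closure (η '' Set.Icc 0 t)) z₀
  f_spec : ∀ t ∈ Set.Ico 0 T,
      ContinuousOn (f t) {z : ℂ | 0 ≤ z.im} ∧ ∀ z ∈ UHP \ K t, f t (g t z) = z
  curve : ∀ t ∈ Set.Ico 0 T, η t = f t ((w t : ℝ) : ℂ)
  drive : ∀ t ∈ Set.Ico 0 T, ∀ δ > (0:ℝ), t + δ < T →
      ((w t : ℝ) : ℂ) ∈ closure (g t '' (K (t + δ) \ K t))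
  null : MeasureTheory.volume {x : ℝ | (x : ℂ) ∈ η '' Set.Ico 0 T} = 0

namespace LoewnerCurve

variable {T : ℝ} {w : ℝ → ℝ} {η : ℝ → ℂ} {K : ℝ → Set ℂ} {g : ℝ → ℂ → ℂ}
    {S : ℝ → Set ℝ} {f : ℝ → ℂ → ℂ} {s t τ : ℝ}

theorem isCompact_trace (L : LoewnerCurve T w η K g S f) (ht : t ∈ Ico 0 T) :
    IsCompact (η '' Icc 0 t) :=
  isCompact_Icc.image_of_continuousOn (L.η_cont.mono fun _ hx => ⟨hx.1, hx.2.trans_lt ht.2⟩)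

theorem closure_trace (L : LoewnerCurve T w η K g S f) (ht : t ∈ Ico 0 T) :
    closure (η '' Icc 0 t) = η '' Icc 0 t :=
  (L.isCompact_trace ht).isClosed.closure_eq

theorem isOpen_compl (L : LoewnerCurve T w η K g S f) (ht : t ∈ Ico 0 T) :
    IsOpen (UHP \ K t) := by
  obtain ⟨-, -, z₀, -, h⟩ := L.gen t ht
  rw [h]
  exact (isOpen_UHP.sdiff isClosed_closure).connectedComponentIn

theorem isPreconnected_compl (L : LoewnerCurve T w η K g S f) (ht : t ∈ Ico 0 T) :
    IsPreconnected (UHP \ K t) := by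
  obtain ⟨-, -, z₀, -, h⟩ := L.gen t ht
  rw [h]
  exact isPreconnected_connectedComponentIn

/-- A connected subset of `ℍ` missing the trace and meeting the complement of the hull lies in the
complement of the hull. -/
theorem subset_compl_of_isPreconnected (L : LoewnerCurve T w η K g S f) (ht : t ∈ Ico 0 T)
    {A : Set ℂ} (hA : IsPreconnected A) (hAU : A ⊆ UHP) (hAη : Disjoint A (η '' Icc 0 t))
    {p : ℂ} (hp : p ∈ A) (hpK : p ∉ K t) : A ⊆ UHP \ K t := by
  obtain ⟨-, -, z₀, -, h⟩ := L.gen t ht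
  rw [L.closure_trace ht] at h
  have hpΩ : p ∈ UHP \ K t := ⟨hAU hp, hpK⟩
  rw [h] at hpΩ ⊢
  rw [connectedComponentIn_eq hpΩ]
  exact hA.subset_connectedComponentIn hp (subset_sdiff.2 ⟨hAU, hAη⟩)

theorem eta_notMem_compl (L : LoewnerCurve T w η K g S f) (ht : t ∈ Ico 0 T) (hs : s ∈ Icc 0 t) :
    η s ∉ UHP \ K t :=
  fun h => h.2 ((L.gen t ht).1 ⟨mem_image_of_mem η hs, h.1⟩)

theorem compl_subset (L : LoewnerCurve T w η K g S f) (hs : 0 ≤ s) (hst : s ≤ t) (ht : t < T) :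
    UHP \ K t ⊆ UHP \ K s :=
  sdiff_subset_sdiff_right (L.mono s t hs hst ht)

theorem bijOn (L : LoewnerCurve T w η K g S f) (ht : t ∈ Ico 0 T) :
    BijOn (g t) (UHP \ K t) UHP := by
  rcases ht.1.eq_or_lt with h | h
  · subst h
    have : g 0 = id := funext L.g_zero
    rw [this, L.K_zero, sdiff_empty]
    exact bijOn_id _
  · exact (L.hull t ⟨h, ht.2⟩).1.bij

theorem holo (L : LoewnerCurve T w η K g S f) (ht : t ∈ Ico 0 T) :
    DifferentiableOn ℂ (g t) (UHP \ K t) := by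
  rcases ht.1.eq_or_lt with h | h
  · subst h
    have : g 0 = id := funext L.g_zero
    rw [this]
    exact differentiableOn_id
  · exact (L.hull t ⟨h, ht.2⟩).1.holo

theorem isBounded_hull (L : LoewnerCurve T w η K g S f) (ht : t ∈ Ico 0 T) :
    IsBounded (K t) := by
  rcases ht.1.eq_or_lt with h | h
  · subst h
    rw [L.K_zero]
    exact isBounded_empty
  · exact (L.hull t ⟨h, ht.2⟩).1.bounded

theorem hull_subset (L : LoewnerCurve T w η K g S f) (ht : t ∈ Ico 0 T) : K t ⊆ UHP := by
  rcases ht.1.eq_or_lt with h | h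
  · subst h
    rw [L.K_zero]
    exact empty_subset _
  · exact (L.hull t ⟨h, ht.2⟩).1.subset_UHP

theorem f_g (L : LoewnerCurve T w η K g S f) (ht : t ∈ Ico 0 T) {z : ℂ} (hz : z ∈ UHP \ K t) :
    f t (g t z) = z :=
  (L.f_spec t ht).2 z hz

theorem f_mem (L : LoewnerCurve T w η K g S f) (ht : t ∈ Ico 0 T) {ζ : ℂ} (hζ : ζ ∈ UHP) :
    f t ζ ∈ UHP \ K t := by
  obtain ⟨z, hz, rfl⟩ := (L.bijOn ht).surjOn hζ
  rwa [L.f_g ht hz]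

theorem g_f (L : LoewnerCurve T w η K g S f) (ht : t ∈ Ico 0 T) {ζ : ℂ} (hζ : ζ ∈ UHP) :
    g t (f t ζ) = ζ := by
  obtain ⟨z, hz, rfl⟩ := (L.bijOn ht).surjOn hζ
  rw [L.f_g ht hz]

theorem g_mem (L : LoewnerCurve T w η K g S f) (ht : t ∈ Ico 0 T) {z : ℂ} (hz : z ∈ UHP \ K t) :
    g t z ∈ UHP :=
  (L.bijOn ht).mapsTo hz

theorem f_cont (L : LoewnerCurve T w η K g S f) (ht : t ∈ Ico 0 T) :
    ContinuousOn (f t) {z : ℂ | 0 ≤ z.im} :=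
  (L.f_spec t ht).1

theorem UHP_subset : UHP ⊆ {z : ℂ | 0 ≤ z.im} := fun z (h : 0 < z.im) => h.le

theorem f_injOn (L : LoewnerCurve T w η K g S f) (ht : t ∈ Ico 0 T) : InjOn (f t) UHP :=
  fun a ha b hb hab => by rw [← L.g_f ht ha, ← L.g_f ht hb, hab]

theorem f_holo (L : LoewnerCurve T w η K g S f) (ht : t ∈ Ico 0 T) :
    DifferentiableOn ℂ (f t) UHP :=
  differentiableOn_of_continuous_inverse (L.isOpen_compl ht) isOpen_UHP (L.holo ht)
    (L.bijOn ht).injOn ((L.f_cont ht).mono UHP_subset) (fun _ h => L.f_mem ht h)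
    (fun _ h => L.g_f ht h)

theorem f_ofReal_notMem (L : LoewnerCurve T w η K g S f) (ht : t ∈ Ico 0 T) (x : ℝ) :
    f t x ∉ UHP \ K t := by
  intro h
  have h1 : ContinuousAt (g t) (f t x) :=
    ((L.holo ht).differentiableAt ((L.isOpen_compl ht).mem_nhds h)).continuousAt
  have h2 : ContinuousWithinAt (f t) {z : ℂ | 0 ≤ z.im} x := L.f_cont ht x (by simp)
  have h3 : Tendsto (fun y : ℝ => (x : ℂ) + y * I) (𝓝[>] 0) (𝓝[UHP] (x : ℂ)) := by
    refine tendsto_nhdsWithin_iff.2 ⟨?_, ?_⟩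
    · exact (Continuous.tendsto' (by fun_prop) _ _ (by simp)).mono_left nhdsWithin_le_nhds
    · filter_upwards [self_mem_nhdsWithin] with y hy
      simpa [UHP] using hy
  have h4 := (h1.tendsto.comp (h2.tendsto.mono_left (nhdsWithin_mono _ UHP_subset))).comp h3
  have h5 : Tendsto (fun y : ℝ => (x : ℂ) + y * I) (𝓝[>] 0) (𝓝 (g t (f t x))) := by
    refine h4.congr' ?_
    filter_upwards [h3.eventually self_mem_nhdsWithin] with y hy
    exact L.g_f ht hy
  have h6 := tendsto_nhds_unique h5 (h3.mono_right nhdsWithin_le_nhds)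
  have h7 := L.g_mem ht h
  rw [h6] at h7
  simp [UHP] at h7

theorem tendsto_hcap (L : LoewnerCurve T w η K g S f) (ht : t ∈ Ico 0 T) :
    Tendsto (fun z : ℂ => z * (g t z - z)) (cobounded ℂ) (𝓝 ((2 * t : ℝ) : ℂ)) :=
  L.cap t ht

theorem tendsto_g_sub (L : LoewnerCurve T w η K g S f) (ht : t ∈ Ico 0 T) :
    Tendsto (fun z : ℂ => g t z - z) (cobounded ℂ) (𝓝 0) :=
  tendsto_zero_of_mul_id le_rfl (L.tendsto_hcap ht)

theorem exists_norm_f_sub_le (L : LoewnerCurve T w η K g S f) (ht : t ∈ Ico 0 T) :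
    ∃ R, 0 < R ∧ ∀ ζ ∈ UHP, R < ‖ζ‖ → ‖f t ζ - ζ‖ ≤ 1 := by
  have h1 := (Metric.tendsto_nhds.1 (L.tendsto_g_sub ht)) 1 one_pos
  rw [(hasBasis_cobounded_norm (E := ℂ)).eventually_iff] at h1
  obtain ⟨R₀, -, hR₀⟩ := h1
  obtain ⟨R₁, hR₁⟩ := isBounded_iff_forall_norm_le.1 (L.isBounded_hull ht)
  set R := max (max R₀ (R₁ + 1)) 1 with hR
  have hR1 : 1 ≤ R := le_max_right _ _
  have hg : ∀ z, R ≤ ‖z‖ → ‖g t z - z‖ ≤ 1 := fun z hz => by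
    have := hR₀ (show z ∈ {x : ℂ | R₀ ≤ ‖x‖} from
      ((le_max_left _ _).trans (le_max_left _ _)).trans hz)
    rw [dist_zero_right] at this
    exact this.le
  have hK : ∀ z ∈ K t, ‖z‖ < R := fun z hz => by
    have h2 : R₁ + 1 ≤ R := (le_max_right _ _).trans (le_max_left _ _)
    linarith [hR₁ z hz]
  set D : Set ℂ := {ζ | ζ ∈ UHP ∧ ‖ζ - (0 : ℝ)‖ ∈ Ioi (R + 1)} with hD
  have hDpre : IsPreconnected D := isPreconnected_UHP_annulus 0 ordConnected_Ioi
  have hmem : ∀ ζ, ζ ∈ D ↔ ζ ∈ UHP ∧ R + 1 < ‖ζ‖ := by simp [hD]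
  have him : IsPreconnected ((fun ζ => ‖f t ζ‖) '' D) := by
    refine hDpre.image _ (((L.f_cont ht).mono ?_).norm)
    exact fun ζ hζ => UHP_subset hζ.1
  have hne : ∀ ζ ∈ D, ‖f t ζ‖ ≠ R := by
    intro ζ hζ h
    have h2 := hg (f t ζ) h.ge
    rw [L.g_f ht hζ.1] at h2
    have h3 := norm_sub_norm_le ζ (f t ζ)
    have := ((hmem ζ).1 hζ).2
    linarith
  have hbig : ∀ ζ ∈ D, R < ‖f t ζ‖ := by
    set z₁ : ℂ := ((R + 3 : ℝ) : ℂ) * I with hz₁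
    have hz₁n : ‖z₁‖ = R + 3 := by
      rw [hz₁, norm_mul, norm_I, mul_one, Complex.norm_real, Real.norm_of_nonneg (by linarith)]
    have hz₁K : z₁ ∈ UHP \ K t := by
      refine ⟨by simp [UHP, hz₁]; linarith, fun h => ?_⟩
      have := hK _ h
      linarith
    have hgz : g t z₁ ∈ D := by
      rw [hmem]
      refine ⟨L.g_mem ht hz₁K, ?_⟩
      have h2 := hg z₁ (by linarith)
      have h3 := norm_sub_norm_le z₁ (g t z₁)
      rw [norm_sub_rev] at h3
      linarith
    intro ζ hζ
    by_contra! hle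
    have h2 : R ∈ (fun ζ => ‖f t ζ‖) '' D := by
      refine him.Icc_subset (mem_image_of_mem _ hζ) (mem_image_of_mem _ hgz) ⟨hle, ?_⟩
      simp only [L.f_g ht hz₁K, hz₁n]
      linarith
    obtain ⟨ξ, h3, h4⟩ := h2
    exact hne ξ h3 h4
  refine ⟨R + 1, by linarith, fun ζ h2 h3 => ?_⟩
  have h4 := hg (f t ζ) (hbig ζ ((hmem ζ).2 ⟨h2, h3⟩)).le
  rwa [L.g_f ht h2, norm_sub_rev] at h4

theorem tendsto_f_cobounded (L : LoewnerCurve T w η K g S f) (ht : t ∈ Ico 0 T) :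
    Tendsto (f t) (cobounded ℂ ⊓ 𝓟 UHP) (cobounded ℂ) := by
  obtain ⟨R, hR, h⟩ := L.exists_norm_f_sub_le ht
  rw [← tendsto_norm_atTop_iff_cobounded]
  have h1 : Tendsto (fun ζ : ℂ => ‖ζ‖ - 1) (cobounded ℂ ⊓ 𝓟 UHP) atTop :=
    (tendsto_atTop_add_const_right _ (-1) tendsto_norm_cobounded_atTop).mono_left inf_le_left
  refine tendsto_atTop_mono' _ ?_ h1
  rw [EventuallyLE, eventually_inf_principal]
  filter_upwards [tendsto_norm_cobounded_atTop.eventually_gt_atTop R] with ζ h2 h3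
  have h4 := h ζ h3 h2
  have h5 := norm_sub_norm_le ζ (f t ζ)
  rw [norm_sub_rev] at h5
  linarith

/-- The transition map `g t ∘ f s` of the Loewner chain. -/
theorem pickShift (L : LoewnerCurve T w η K g S f) (hs : 0 ≤ s) (hst : s < t) (ht : t < T) :
    PickShift (g s ∘ f t) (2 * (t - s)) := by
  have hs' : s ∈ Ico 0 T := ⟨hs, hst.trans ht⟩
  have ht' : t ∈ Ico 0 T := ⟨hs.trans hst.le, ht⟩
  have hsub := L.compl_subset hs hst.le ht
  refine ⟨by linarith, ?_, ?_, ?_⟩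
  · exact ((L.holo hs').mono hsub).comp (L.f_holo ht') fun ζ hζ => L.f_mem ht' hζ
  · exact fun ζ hζ => L.g_mem hs' (hsub (L.f_mem ht' hζ))
  · have hf := L.tendsto_f_cobounded ht'
    have h1 := (L.tendsto_hcap hs').comp hf
    have h2 := (L.tendsto_hcap ht').comp hf
    have hinv : Tendsto (fun ζ => (f t ζ)⁻¹) (cobounded ℂ ⊓ 𝓟 UHP) (𝓝 0) :=
      tendsto_inv₀_cobounded.comp hf
    have h3 := (hinv.mul ((L.tendsto_g_sub ht').comp hf)).const_add 1
    have h4 := h3.mul (h1.sub h2)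
    have e : (1 + 0 * 0) * (((2 * s : ℝ) : ℂ) - ((2 * t : ℝ) : ℂ)) =
        -((2 * (t - s) : ℝ) : ℂ) := by push_cast; ring
    rw [e] at h4
    refine h4.congr' ?_
    have h5 : ∀ᶠ ζ in cobounded ℂ ⊓ 𝓟 UHP, f t ζ ≠ 0 := hf.eventually (eventually_ne_cobounded 0)
    filter_upwards [h5, mem_inf_of_right (mem_principal_self UHP)] with ζ h6 h7
    simp only [Function.comp, L.g_f ht' h7]
    field_simp
    ring

theorem transition_apply (L : LoewnerCurve T w η K g S f) (ht : t ∈ Ico 0 T) {z : ℂ}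
    (hz : z ∈ UHP \ K t) : (g s ∘ f t) (g t z) = g s z := by
  simp only [Function.comp, L.f_g ht hz]

theorem im_g_lt (L : LoewnerCurve T w η K g S f) (hs : 0 ≤ s) (hst : s < t) (ht : t < T) {z : ℂ}
    (hz : z ∈ UHP \ K t) : (g t z).im < (g s z).im := by
  have ht' : t ∈ Ico 0 T := ⟨hs.trans hst.le, ht⟩
  have := (L.pickShift hs hst ht).im_sub_pos _ (L.g_mem ht' hz)
  rw [L.transition_apply ht' hz, sub_im] at this
  linarith

theorem im_g_le (L : LoewnerCurve T w η K g S f) (hs : 0 ≤ s) (hst : s ≤ t) (ht : t < T) {z : ℂ}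
    (hz : z ∈ UHP \ K t) : (g t z).im ≤ (g s z).im := by
  rcases hst.eq_or_lt with rfl | h
  · exact le_rfl
  · exact (L.im_g_lt hs h ht hz).le

theorem norm_g_sub_le (L : LoewnerCurve T w η K g S f) (hs : 0 ≤ s) (hst : s ≤ t) (htτ : t ≤ τ)
    (hτ : τ < T) {z : ℂ} (hz : z ∈ UHP \ K τ) :
    ‖g s z - g t z‖ ≤ 2 * (t - s) / (g τ z).im := by
  have hτ' : τ ∈ Ico 0 T := ⟨hs.trans (hst.trans htτ), hτ⟩
  have ht : t < T := htτ.trans_lt hτ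
  have ht' : t ∈ Ico 0 T := ⟨hs.trans hst, ht⟩
  have hzt := L.compl_subset ht'.1 htτ hτ hz
  have h0 : 0 < (g τ z).im := L.g_mem hτ' hz
  rcases hst.eq_or_lt with rfl | h
  · simp
  · have h1 := (L.pickShift hs h ht).norm_sub_le (L.g_mem ht' hzt)
    rw [L.transition_apply ht' hzt] at h1
    refine h1.trans ?_
    have := L.im_g_le ht'.1 htτ hτ hz
    gcongr

/-- Points whose image under `g s` is high enough survive until time `t`. -/
theorem survive (L : LoewnerCurve T w η K g S f) (hs : 0 ≤ s) (hst : s < t) (ht : t < T) {z : ℂ}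
    (hz : z ∈ UHP \ K s) (him : 2 * √(2 * (t - s)) < (g s z).im) :
    z ∈ UHP \ K t ∧ ‖g s z - g t z‖ ≤ √(2 * (t - s)) := by
  have ht' : t ∈ Ico 0 T := ⟨hs.trans hst.le, ht⟩
  have hs' : s ∈ Ico 0 T := ⟨hs, hst.trans ht⟩
  have hF := L.pickShift hs hst ht
  obtain ⟨ζ, h1, h2⟩ := hF.exists_preimage him
  have hζ : ζ ∈ UHP := lt_of_le_of_lt (Real.sqrt_nonneg _) h1
  have h3 : f t ζ = z := (L.bijOn hs').injOn (L.compl_subset hs hst.le ht (L.f_mem ht' hζ)) hz h2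
  have h4 : g t z = ζ := by rw [← h3, L.g_f ht' hζ]
  refine ⟨h3 ▸ L.f_mem ht' hζ, ?_⟩
  have h5 := hF.norm_sub_le_sqrt h1.le
  rwa [h2, ← h4] at h5

theorem tendsto_sqrt_shift (t : ℝ) :
    Tendsto (fun s : ℝ => √(2 * (s - t))) (𝓝[>] t) (𝓝 0) := by
  have : Continuous fun s : ℝ => √(2 * (s - t)) := by fun_prop
  exact (this.tendsto' t 0 (by simp)).mono_left nhdsWithin_le_nhds

theorem eventually_survive (L : LoewnerCurve T w η K g S f) (ht : t ∈ Ico 0 T) {z : ℂ}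
    (hz : z ∈ UHP \ K t) : ∀ᶠ s in 𝓝[>] t, z ∈ UHP \ K s := by
  have h0 : 0 < (g t z).im / 2 := half_pos (L.g_mem ht hz)
  filter_upwards [(tendsto_sqrt_shift t).eventually (gt_mem_nhds h0), Ioo_mem_nhdsGT ht.2]
    with s h1 h2
  exact (L.survive ht.1 h2.1 h2.2 hz (by linarith)).1

/-- The points of `ℝ` mapped to the tip of the curve do not fill an interval. -/
theorem exists_f_ne_tip (L : LoewnerCurve T w η K g S f) (ht : t ∈ Ico 0 T) {a b : ℝ}
    (hab : a < b) : ∃ x ∈ Ioo a b, f t x ≠ η t := by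
  by_contra! h
  refine not_injOn_of_const_on_interval (f := f t) (p := η t)
    (a := a + (b - a) / 3) (b := b - (b - a) / 3) (by linarith) (L.f_cont ht) (L.f_holo ht)
    (fun x hx => h x ⟨by linarith [hx.1], by linarith [hx.2]⟩) (L.f_injOn ht)

theorem continuous_f_ofReal (L : LoewnerCurve T w η K g S f) (ht : t ∈ Ico 0 T) :
    Continuous fun x : ℝ => f t x :=
  (L.f_cont ht).comp_continuous Complex.continuous_ofReal fun x => by simp

theorem exists_radius (L : LoewnerCurve T w η K g S f) (ht : t ∈ Ico 0 T) {ε : ℝ} (hε : 0 < ε) :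
    ∃ ρ κ, 0 < κ ∧ κ < ρ ∧ ρ + κ < ε ∧
      ∀ r ∈ Icc (ρ - κ) (ρ + κ), f t ((w t + r : ℝ) : ℂ) ≠ η t ∧
        f t ((w t - r : ℝ) : ℂ) ≠ η t := by
  obtain ⟨x, hx, hxne⟩ := L.exists_f_ne_tip ht (show w t < w t + ε by linarith)
  have ho : IsOpen {r : ℝ | f t ((w t + r : ℝ) : ℂ) ≠ η t} :=
    isOpen_ne.preimage ((L.continuous_f_ofReal ht).comp (continuous_const.add continuous_id))
  have ho' : IsOpen {r : ℝ | f t ((w t - r : ℝ) : ℂ) ≠ η t} :=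
    isOpen_ne.preimage ((L.continuous_f_ofReal ht).comp (continuous_const.sub continuous_id))
  have h1 : x - w t ∈ {r : ℝ | f t ((w t + r : ℝ) : ℂ) ≠ η t} ∩ Ioo 0 ε := by
    refine ⟨?_, ?_, ?_⟩
    · simpa using hxne
    · linarith [hx.1]
    · linarith [hx.2]
  obtain ⟨δ, hδ, hball⟩ := Metric.isOpen_iff.1 (ho.inter isOpen_Ioo) _ h1
  rw [Real.ball_eq_Ioo] at hball
  obtain ⟨y, hy, hyne⟩ := L.exists_f_ne_tip ht
    (show w t - (x - w t + δ) < w t - (x - w t - δ) by linarith)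
  have h2 : w t - y ∈ ({r : ℝ | f t ((w t + r : ℝ) : ℂ) ≠ η t} ∩ Ioo 0 ε) ∩
      {r : ℝ | f t ((w t - r : ℝ) : ℂ) ≠ η t} := by
    refine ⟨hball ⟨by linarith [hy.2], by linarith [hy.1]⟩, ?_⟩
    simpa using hyne
  obtain ⟨κ, hκ, hball2⟩ := Metric.isOpen_iff.1 ((ho.inter isOpen_Ioo).inter ho') _ h2
  rw [Real.ball_eq_Ioo] at hball2
  have hsub : Icc (w t - y - κ / 2) (w t - y + κ / 2) ⊆ Ioo (w t - y - κ) (w t - y + κ) :=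
    fun r hr => ⟨by linarith [hr.1], by linarith [hr.2]⟩
  have e1 := (hball2 (hsub ⟨le_rfl, by linarith⟩)).1.2
  have e2 := (hball2 (hsub ⟨by linarith, le_rfl⟩)).1.2
  exact ⟨w t - y, κ / 2, by linarith, by linarith [e1.1], e2.2,
    fun r hr => ⟨(hball2 (hsub hr)).1.1, (hball2 (hsub hr)).2⟩⟩

/-- There are arbitrarily small half-annuli around the driving point that survive for a while. -/
theorem exists_annulus (L : LoewnerCurve T w η K g S f) (ht : t ∈ Ico 0 T) {ε : ℝ} (hε : 0 < ε) :
    ∃ ρ κ, 0 < κ ∧ κ < ρ ∧ ρ + κ < ε ∧ ∀ᶠ s in 𝓝[>] t,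
      ∀ ζ ∈ UHP, ‖ζ - w t‖ ∈ Icc (ρ - κ) (ρ + κ) → f t ζ ∈ UHP \ K s := by
  obtain ⟨ρ, κ, hκ, hκρ, hρε, hne⟩ := L.exists_radius ht hε
  refine ⟨ρ, κ, hκ, hκρ, hρε, ?_⟩
  set N : Set ℂ := {ζ | 0 ≤ ζ.im ∧ ‖ζ - w t‖ ∈ Icc (ρ - κ) (ρ + κ)} with hN
  have hNcl : IsClosed N :=
    (isClosed_le continuous_const Complex.continuous_im).inter
      (isClosed_Icc.preimage (by fun_prop : Continuous fun ζ : ℂ => ‖ζ - w t‖))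
  have hNc : IsCompact N := by
    refine (isCompact_closedBall (w t : ℂ) (ρ + κ)).of_isClosed_subset hNcl fun ζ hζ => ?_
    rw [mem_closedBall, dist_eq_norm]
    exact hζ.2.2
  have himg : IsCompact (f t '' N) :=
    hNc.image_of_continuousOn ((L.f_cont ht).mono fun _ h => h.1)
  have hnot : η t ∉ f t '' N := by
    rintro ⟨ζ, ⟨h0, h1⟩, h2⟩
    rcases h0.eq_or_lt with h3 | h3
    · have hζ : ζ = (ζ.re : ℂ) := by apply Complex.ext <;> simp [← h3]
      have h4 : ‖ζ - w t‖ = |ζ.re - w t| := by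
        rw [hζ, ← ofReal_sub, Complex.norm_real, Real.norm_eq_abs, ofReal_re]
      have h5 := hne _ h1
      rw [h4] at h5
      rcases abs_cases (ζ.re - w t) with h6 | h6
      · apply h5.1
        rw [h6.1, add_sub_cancel, ← hζ, h2]
      · apply h5.2
        rw [h6.1, sub_neg_eq_add, add_sub_cancel, ← hζ, h2]
    · have := L.f_mem ht (show ζ ∈ UHP from h3)
      rw [h2] at this
      exact L.eta_notMem_compl ht ⟨ht.1, le_rfl⟩ this
  have hη : ∀ᶠ r in 𝓝[≥] t, η r ∉ f t '' N := by
    have h1 : ContinuousWithinAt η (Ici t) t :=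
      (L.η_cont t ht).mono_of_mem_nhdsWithin
        (mem_of_superset (Ico_mem_nhdsGE ht.2) fun r hr => ⟨ht.1.trans hr.1, hr.2⟩)
    exact h1.eventually (himg.isClosed.isOpen_compl.mem_nhds hnot)
  obtain ⟨b, hb, hbη⟩ := (mem_nhdsGE_iff_exists_Ico_subset).1 hη
  set p : ℂ := w t + ρ * I with hp
  have hpU : p ∈ UHP := by
    simp only [UHP, hp]
    simp
    linarith
  have hpn : ‖p - w t‖ = ρ := by
    rw [hp, add_sub_cancel_left, norm_mul, norm_I, mul_one, Complex.norm_real,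
      Real.norm_of_nonneg (by linarith)]
  filter_upwards [L.eventually_survive ht (L.f_mem ht hpU), Ioo_mem_nhdsGT ht.2,
    Ioo_mem_nhdsGT hb] with s h1 h2 h3
  have hs : s ∈ Ico 0 T := ⟨ht.1.trans h2.1.le, h2.2⟩
  have hpre : IsPreconnected (f t '' {ζ : ℂ | ζ ∈ UHP ∧ ‖ζ - w t‖ ∈ Icc (ρ - κ) (ρ + κ)}) :=
    (isPreconnected_UHP_annulus (w t) ordConnected_Icc).image _
      ((L.f_cont ht).mono fun ζ hζ => UHP_subset hζ.1)
  have hfin := L.subset_compl_of_isPreconnected hs hpre ?_ ?_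
    (mem_image_of_mem (f t) ⟨hpU, by rw [hpn]; constructor <;> linarith⟩) h1.2
  · exact fun ζ hζ hζ' => hfin (mem_image_of_mem (f t) ⟨hζ, hζ'⟩)
  · rintro _ ⟨ζ, hζ, rfl⟩
    exact (L.f_mem ht hζ.1).1
  · rw [Set.disjoint_left]
    rintro _ ⟨ζ, hζ, rfl⟩ ⟨r, hr, hr'⟩
    rcases le_or_gt r t with h | h
    · have := L.f_mem ht hζ.1
      rw [← hr'] at this
      exact L.eta_notMem_compl ht ⟨hr.1, h⟩ this
    · refine hbη ⟨h.le, hr.2.trans_lt h3.2⟩ ?_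
      rw [hr']
      exact mem_image_of_mem _ ⟨UHP_subset hζ.1, hζ.2⟩

/-- On a surviving half-circle the later mapping-out function moves points by little. -/
theorem norm_g_f_sub_le (L : LoewnerCurve T w η K g S f) (ht : 0 ≤ t) (hts : t < s) (hs : s < T)
    {ρ κ : ℝ}
    (hann : ∀ ζ ∈ UHP, ‖ζ - w t‖ ∈ Icc (ρ - κ) (ρ + κ) → f t ζ ∈ UHP \ K s)
    (hsmall : 6 * √(2 * (s - t)) ≤ κ) {ζ : ℂ} (hζ : ζ ∈ UHP) (hζρ : ‖ζ - w t‖ = ρ) :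
    ‖g s (f t ζ) - ζ‖ ≤ 200 * √(2 * (s - t)) := by
  have ht' : t ∈ Ico 0 T := ⟨ht, hts.trans hs⟩
  have hs' : s ∈ Ico 0 T := ⟨ht.trans hts.le, hs⟩
  set r := √(2 * (s - t)) with hr
  have hr0 : 0 < r := Real.sqrt_pos.2 (by linarith)
  set h : ℂ → ℂ := fun z => g s (f t z) - z with hh
  have hhigh : ∀ z ∈ UHP, 2 * r < z.im → ‖h z‖ ≤ r := by
    intro z hz him
    have := (L.survive ht hts hs (L.f_mem ht' hz) (by rwa [L.g_f ht' hz])).2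
    rwa [L.g_f ht' hz, norm_sub_rev] at this
  set A : Set ℂ := {z | z ∈ UHP ∧ ‖z - w t‖ ∈ Ioo (ρ - κ) (ρ + κ)} with hA
  have hAopen : IsOpen A := isOpen_UHP.inter
    (isOpen_Ioo.preimage (by fun_prop : Continuous fun z : ℂ => ‖z - w t‖))
  have hAm : ∀ z ∈ A, f t z ∈ UHP \ K s := fun z hz => hann z hz.1 (Ioo_subset_Icc_self hz.2)
  have hd : DifferentiableOn ℂ h A := by
    refine DifferentiableOn.sub ?_ differentiableOn_id
    exact (L.holo hs').comp ((L.f_holo ht').mono fun z hz => hz.1) hAm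
  have him : ∀ z ∈ A, |(h z).im| ≤ z.im := by
    intro z hz
    have h1 := L.g_mem hs' (hAm z hz)
    have h2 := L.im_g_le ht hts.le hs (hAm z hz)
    rw [L.g_f ht' hz.1] at h2
    have h3 : 0 < (g s (f t z)).im := h1
    simp only [hh, sub_im]
    rw [abs_le]
    constructor <;> linarith
  rcases lt_or_ge (2 * r) ζ.im with h1 | h1
  · exact (hhigh ζ hζ h1).trans (by linarith)
  · have hζ0 : 0 < ζ.im := hζ
    have hball : ∀ y ∈ Icc (0:ℝ) (2 * r), ∀ z ∈ ball (ζ + y * I) ((ζ.im + y) / 2),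
        z ∈ A ∧ z.im ≤ 2 * (ζ.im + y) := by
      intro y hy z hz
      rw [mem_ball, dist_eq_norm] at hz
      have h2 := abs_lt.1 ((Complex.abs_im_le_norm _).trans_lt hz)
      simp at h2
      have h3 : ‖z - ζ‖ ≤ ‖z - (ζ + y * I)‖ + y := by
        have : z - ζ = (z - (ζ + y * I)) + y * I := by ring
        rw [this]
        refine (norm_add_le _ _).trans ?_
        simp [abs_of_nonneg hy.1]
      have h4 : ‖z - ζ‖ < κ := by linarith [hy.2]
      have h5 : |‖z - w t‖ - ρ| ≤ ‖z - ζ‖ := by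
        rw [← hζρ]
        refine (abs_norm_sub_norm_le _ _).trans (le_of_eq ?_)
        congr 1
        ring
      have h6 := abs_le.1 h5
      refine ⟨⟨?_, ?_, ?_⟩, ?_⟩
      · change 0 < z.im
        linarith [hy.1]
      · linarith
      · linarith
      · linarith [hy.1]
    have hderiv : ∀ y ∈ Icc (0:ℝ) (2 * r), ‖deriv h (ζ + y * I)‖ ≤ 64 := by
      intro y hy
      have hpos : 0 < ζ.im + y := by linarith [hy.1]
      refine (norm_deriv_le_of_abs_im_le (R := (ζ.im + y) / 2) (M := 2 * (ζ.im + y))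
        (by linarith) (by linarith) (hd.mono fun z hz => (hball y hy z hz).1) ?_).trans
        (le_of_eq ?_)
      · intro z hz
        have := hball y hy z hz
        exact (him z this.1).trans this.2
      · field_simp
        norm_num
    have hder : ∀ y ∈ Icc (0:ℝ) (2 * r), HasDerivWithinAt (fun y : ℝ => h (ζ + y * I))
        (deriv h (ζ + y * I) * I) (Icc 0 (2 * r)) y := by
      intro y hy
      have hpos : 0 < ζ.im + y := by linarith [hy.1]
      have hmem := (hball y hy (ζ + y * I) (mem_ball_self (half_pos hpos))).1
      have h1 := (hd.differentiableAt (hAopen.mem_nhds hmem)).hasDerivAt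
      have h2 : HasDerivAt (fun y : ℝ => ζ + y * I) I y := by
        simpa using ((hasDerivAt_id y).ofReal_comp.mul_const I).const_add ζ
      exact (h1.comp y h2).hasDerivWithinAt
    have hmv := (convex_Icc (0:ℝ) (2 * r)).norm_image_sub_le_of_norm_hasDerivWithin_le hder
      (C := 64) (fun y hy => by rw [norm_mul, norm_I, mul_one]; exact hderiv y hy)
      (x := 2 * r) (y := 0) ⟨by linarith, le_rfl⟩ ⟨le_rfl, by linarith⟩
    have h2 : ‖h (ζ + ((2 * r : ℝ) : ℂ) * I)‖ ≤ r := by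
      refine hhigh _ ?_ ?_
      · have := (hball (2 * r) ⟨by linarith, le_rfl⟩ _
          (mem_ball_self (half_pos (by linarith)))).1
        exact this.1
      · simp
        exact hζ0
    simp only [ofReal_zero, zero_mul, add_zero, zero_sub, norm_neg, Real.norm_eq_abs,
      abs_of_pos (show (0:ℝ) < 2 * r by linarith)] at hmv
    calc ‖h ζ‖ = ‖(h ζ - h (ζ + ((2 * r : ℝ) : ℂ) * I)) + h (ζ + ((2 * r : ℝ) : ℂ) * I)‖ := by
          congr 1; ring
      _ ≤ 64 * (2 * r) + r := (norm_add_le _ _).trans (add_le_add hmv h2)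
      _ ≤ 200 * r := by linarith

/-- The transition map from time `s` back to time `t < s` respects the circle of radius `ρ` around
the driving point, up to a factor. -/
theorem exists_localized (L : LoewnerCurve T w η K g S f) (ht : t ∈ Ico 0 T) {ε : ℝ}
    (hε : 0 < ε) : ∃ ρ, 0 < ρ ∧ ρ < ε ∧ ∀ᶠ s in 𝓝[>] t, s < T ∧
      (∀ q ∈ UHP \ K t, ‖g t q - w t‖ = ρ → q ∈ UHP \ K s) ∧
      (∀ q ∈ UHP \ K s, ‖g s q - w t‖ < ρ / 2 → ‖g t q - w t‖ < ρ) ∧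
      (∀ q ∈ UHP \ K s, 3 * ρ / 2 < ‖g s q - w t‖ → ρ < ‖g t q - w t‖) := by
  obtain ⟨ρ, κ, hκ, hκρ, hρε, hann⟩ := L.exists_annulus ht hε
  have hρ : 0 < ρ := hκ.trans hκρ
  refine ⟨ρ, hρ, by linarith, ?_⟩
  have hsm : 0 < min (κ / 6) (ρ / 400) := by positivity
  filter_upwards [hann, Ioo_mem_nhdsGT ht.2,
    (tendsto_sqrt_shift t).eventually (gt_mem_nhds hsm)] with s hann hs hr
  have hs' : s ∈ Ico 0 T := ⟨ht.1.trans hs.1.le, hs.2⟩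
  have hr1 : 6 * √(2 * (s - t)) ≤ κ := by
    have := hr.trans_le (min_le_left _ _)
    linarith
  have hr2 : 200 * √(2 * (s - t)) < ρ / 2 := by
    have := hr.trans_le (min_le_right _ _)
    linarith
  have hsurv : ∀ q ∈ UHP \ K t, ‖g t q - w t‖ = ρ → q ∈ UHP \ K s := by
    intro q hq hqρ
    have := hann (g t q) (L.g_mem ht hq) (by rw [hqρ]; constructor <;> linarith)
    rwa [L.f_g ht hq] at this
  have hF := L.pickShift ht.1 hs.1 hs.2
  have hcirc : ∀ ζ ∈ UHP, ‖g t (f s ζ) - w t‖ = ρ → ‖g t (f s ζ) - ζ‖ < ρ / 2 := by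
    intro ζ hζ h
    have hq := L.f_mem hs' hζ
    have hq' := L.compl_subset ht.1 hs.1.le hs.2 hq
    have := L.norm_g_f_sub_le ht.1 hs.1 hs.2 hann hr1 (L.g_mem ht hq') h
    rw [L.f_g ht hq', L.g_f hs' hζ, norm_sub_rev] at this
    exact this.trans_lt hr2
  have hcont : ContinuousOn (fun ζ => ‖g t (f s ζ) - w t‖) UHP :=
    (hF.holo.continuousOn.sub continuousOn_const).norm
  refine ⟨hs.2, hsurv, ?_, ?_⟩
  · have hpre := ((isPreconnected_UHP_annulus (w t) (ordConnected_Iio (a := ρ / 2))).image _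
      (hcont.mono fun ζ hζ => hζ.1)).ordConnected
    intro q hq hqn
    by_contra! hle
    set p : ℂ := w t + (ρ / 4 : ℝ) * I with hp
    have hpU : p ∈ UHP := by
      simp only [UHP, hp]
      simp
      linarith
    have hpn : ‖p - w t‖ = ρ / 4 := by
      rw [hp, add_sub_cancel_left, norm_mul, norm_I, mul_one, Complex.norm_real,
        Real.norm_of_nonneg (by linarith)]
    have hpi : p.im = ρ / 4 := by simp [hp]
    have hpim : √(2 * (s - t)) ≤ p.im := by
      rw [hpi]
      linarith
    have h1 := hF.norm_sub_le_sqrt hpim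
    have h2 : ‖g t (f s p) - w t‖ < ρ := by
      have : g t (f s p) - w t = ((g t ∘ f s) p - p) + (p - w t) := by
        simp only [Function.comp]; ring
      rw [this]
      refine (norm_add_le _ _).trans_lt ?_
      rw [hpn]
      linarith
    have hpA : p ∈ {ζ | ζ ∈ UHP ∧ ‖ζ - w t‖ ∈ Iio (ρ / 2)} :=
      ⟨hpU, by rw [hpn, mem_Iio]; linarith⟩
    have hqA : g s q ∈ {ζ | ζ ∈ UHP ∧ ‖ζ - w t‖ ∈ Iio (ρ / 2)} := ⟨L.g_mem hs' hq, hqn⟩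
    obtain ⟨ζ, hζ, hζρ⟩ := hpre.out (mem_image_of_mem _ hpA) (mem_image_of_mem _ hqA)
      (show ρ ∈ Icc _ _ from ⟨h2.le, by simpa only [L.f_g hs' hq] using hle⟩)
    have h3 := hcirc ζ hζ.1 hζρ
    have h4 : ‖ζ - w t‖ < ρ / 2 := hζ.2
    have : g t (f s ζ) - w t = (g t (f s ζ) - ζ) + (ζ - w t) := by ring
    simp only [this] at hζρ
    have := norm_add_le (g t (f s ζ) - ζ) (ζ - w t)
    linarith
  · have hpre := ((isPreconnected_UHP_annulus (w t) (ordConnected_Ioi (a := 3 * ρ / 2))).image _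
      (hcont.mono fun ζ hζ => hζ.1)).ordConnected
    intro q hq hqn
    by_contra! hle
    set p : ℂ := w t + (2 * ρ : ℝ) * I with hp
    have hpU : p ∈ UHP := by
      simp only [UHP, hp]
      simp
      linarith
    have hpn : ‖p - w t‖ = 2 * ρ := by
      rw [hp, add_sub_cancel_left, norm_mul, norm_I, mul_one, Complex.norm_real,
        Real.norm_of_nonneg (by linarith)]
    have hpi : p.im = 2 * ρ := by simp [hp]
    have hpim : √(2 * (s - t)) ≤ p.im := by
      rw [hpi]
      linarith
    have h1 := hF.norm_sub_le_sqrt hpim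
    have h2 : ρ < ‖g t (f s p) - w t‖ := by
      have : p - w t = (g t (f s p) - w t) - ((g t ∘ f s) p - p) := by
        simp only [Function.comp]; ring
      have h5 := norm_sub_le (g t (f s p) - w t) ((g t ∘ f s) p - p)
      rw [← this, hpn] at h5
      linarith
    have hpA : p ∈ {ζ | ζ ∈ UHP ∧ ‖ζ - w t‖ ∈ Ioi (3 * ρ / 2)} :=
      ⟨hpU, by rw [hpn, mem_Ioi]; linarith⟩
    have hqA : g s q ∈ {ζ | ζ ∈ UHP ∧ ‖ζ - w t‖ ∈ Ioi (3 * ρ / 2)} := ⟨L.g_mem hs' hq, hqn⟩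
    obtain ⟨ζ, hζ, hζρ⟩ := hpre.out (mem_image_of_mem _ hqA) (mem_image_of_mem _ hpA)
      (show ρ ∈ Icc _ _ from ⟨by simpa only [L.f_g hs' hq] using hle, h2.le⟩)
    have h3 := hcirc ζ hζ.1 hζρ
    have h4 : 3 * ρ / 2 < ‖ζ - w t‖ := hζ.2
    have : ζ - w t = (g t (f s ζ) - w t) - (g t (f s ζ) - ζ) := by ring
    rw [this] at h4
    have := norm_sub_le (g t (f s ζ) - w t) (g t (f s ζ) - ζ)
    simp only at hζρ
    linarith

theorem w_continuousWithinAt (L : LoewnerCurve T w η K g S f) (ht : t ∈ Ico 0 T) :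
    ContinuousWithinAt w (Ici t) t :=
  (L.w_cont t ht).mono_of_mem_nhdsWithin
    (mem_of_superset (Ico_mem_nhdsGE ht.2) fun _ hr => ⟨ht.1.trans hr.1, hr.2⟩)

theorem eta_continuousWithinAt (L : LoewnerCurve T w η K g S f) (ht : t ∈ Ico 0 T) :
    ContinuousWithinAt η (Ici t) t :=
  (L.η_cont t ht).mono_of_mem_nhdsWithin
    (mem_of_superset (Ico_mem_nhdsGE ht.2) fun _ hr => ⟨ht.1.trans hr.1, hr.2⟩)

/-- The hulls grow locally at the driving point. -/
theorem local_growth (L : LoewnerCurve T w η K g S f) (ht : t ∈ Ico 0 T) {ε : ℝ} (hε : 0 < ε) :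
    ∃ ρ, 0 < ρ ∧ ρ < ε ∧ ∀ᶠ s in 𝓝[>] t, s < T ∧
      (∀ q ∈ UHP \ K t, ρ ≤ ‖g t q - w t‖ → q ∈ UHP \ K s) ∧
      (∀ q ∈ UHP \ K s, 3 * ρ / 2 < ‖g s q - w t‖ → ρ < ‖g t q - w t‖) := by
  obtain ⟨ρ, hρ, hρε, hev⟩ := L.exists_localized ht hε
  refine ⟨ρ, hρ, hρε, ?_⟩
  have hw : ∀ᶠ s in 𝓝[>] t, ‖w s - w t‖ < ρ / 2 := by
    have h1 := (L.w_continuousWithinAt ht).mono Ioi_subset_Ici_self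
    have h2 := (Metric.tendsto_nhds.1 h1) (ρ / 2) (by linarith)
    filter_upwards [h2] with s hs
    rwa [← dist_eq_norm]
  obtain ⟨b, hb, hball⟩ := mem_nhdsGT_iff_exists_Ioo_subset.1 (hev.and hw)
  filter_upwards [Ioo_mem_nhdsGT hb] with s hs
  have hsT : s < T := (hball hs).1.1
  have hs' : s ∈ Ico 0 T := ⟨ht.1.trans hs.1.le, hsT⟩
  refine ⟨hsT, ?_, (hball hs).1.2.2.2⟩
  intro q hq hqρ
  by_contra hqK
  set A : Set ℂ := f t '' {ζ : ℂ | ζ ∈ UHP ∧ ‖ζ - w t‖ ∈ Ici ρ} with hA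
  have hApre : IsPreconnected A :=
    (isPreconnected_UHP_annulus (w t) ordConnected_Ici).image _
      ((L.f_cont ht).mono fun ζ hζ => UHP_subset hζ.1)
  have hAΩ : A ⊆ UHP \ K t := by
    rintro _ ⟨ζ, hζ, rfl⟩
    exact L.f_mem ht hζ.1
  have hqA : q ∈ A := ⟨g t q, ⟨L.g_mem ht hq, hqρ⟩, L.f_g ht hq⟩
  set p : ℂ := w t + (ρ : ℝ) * I with hp
  have hpU : p ∈ UHP := by
    simp only [UHP, hp]
    simpa using hρ
  have hpn : ‖p - w t‖ = ρ := by
    rw [hp, add_sub_cancel_left, norm_mul, norm_I, mul_one, Complex.norm_real,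
      Real.norm_of_nonneg hρ.le]
  have hpA : f t p ∈ A := ⟨p, ⟨hpU, hpn.ge⟩, rfl⟩
  have hpK : f t p ∉ K s :=
    ((hball hs).1.2.1 _ (L.f_mem ht hpU) (by rw [L.g_f ht hpU, hpn])).2
  obtain ⟨r, hr, hrA⟩ : ∃ r ∈ Icc 0 s, η r ∈ A := by
    by_contra! hno
    refine hqK (L.subset_compl_of_isPreconnected hs' hApre (fun z hz => (hAΩ hz).1) ?_ hpA hpK hqA)
    rw [Set.disjoint_right]
    rintro _ ⟨r, hr, rfl⟩
    exact hno r hr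
  have htr : t < r := by
    by_contra! hle
    exact L.eta_notMem_compl ht ⟨hr.1, hle⟩ (hAΩ hrA)
  have hrT : r ∈ Ico 0 T := ⟨hr.1, hr.2.trans_lt hsT⟩
  have hrb : r ∈ Ioo t b := ⟨htr, hr.2.trans_lt hs.2⟩
  set Out : Set ℂ := (UHP \ K t) ∩ (fun q => ‖g t q - w t‖) ⁻¹' Ioi ρ with hOut
  have hgc : ContinuousOn (fun q => ‖g t q - w t‖) (UHP \ K t) :=
    ((L.holo ht).continuousOn.sub continuousOn_const).norm
  have hOutopen : IsOpen Out := hgc.isOpen_inter_preimage (L.isOpen_compl ht) isOpen_Ioi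
  have hrOut : η r ∈ Out := by
    obtain ⟨ζ, hζ, hζr⟩ := hrA
    have h1 : g t (η r) = ζ := by rw [← hζr, L.g_f ht hζ.1]
    refine ⟨hAΩ ⟨ζ, hζ, hζr⟩, ?_⟩
    simp only [mem_preimage, h1, mem_Ioi]
    refine lt_of_le_of_ne hζ.2 fun heq => ?_
    have := (hball hrb).1.2.1 _ (hAΩ ⟨ζ, hζ, hζr⟩) (by rw [h1, heq])
    exact L.eta_notMem_compl hrT ⟨hr.1, le_rfl⟩ this
  have hstay : ∀ᶠ v in 𝓝[≥] r, η v ∈ Out :=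
    (L.eta_continuousWithinAt hrT).eventually (hOutopen.mem_nhds hrOut)
  obtain ⟨c, hc, hcsub⟩ := mem_nhdsGE_iff_exists_Ico_subset.1 hstay
  obtain ⟨u, hu1, hu2⟩ := exists_between (lt_min hc (hrb.2))
  have hub : u ∈ Ioo t b := ⟨htr.trans hu1, hu2.trans_le (min_le_right _ _)⟩
  have huT : u < T := (hball hub).1.1
  have hu' : u ∈ Ico 0 T := ⟨hr.1.trans hu1.le, huT⟩
  have hηOut : ∀ v ∈ Icc r u, η v ∈ Out := fun v hv =>
    hcsub ⟨hv.1, hv.2.trans_lt (hu2.trans_le (min_le_left _ _))⟩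
  obtain ⟨q₁, hq₁, hq₁n⟩ : ∃ q₁ ∈ K u \ K r, ‖g t q₁ - w t‖ < ρ := by
    have h1 := L.drive r hrT (u - r) (by linarith) (by linarith)
    rw [add_sub_cancel] at h1
    have h2 : ‖w r - w t‖ < ρ / 2 := (hball hrb).2
    obtain ⟨_, ⟨q₁, hq₁, rfl⟩, h3⟩ := Metric.mem_closure_iff.1 h1 (ρ / 2 - ‖w r - w t‖)
      (by linarith)
    refine ⟨q₁, hq₁, (hball hrb).1.2.2.1 q₁ ⟨L.hull_subset hu' hq₁.1, hq₁.2⟩ ?_⟩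
    rw [dist_comm, dist_eq_norm] at h3
    have h4 : g r q₁ - w t = (g r q₁ - w r) + ((w r - w t : ℝ) : ℂ) := by push_cast; ring
    rw [h4]
    refine (norm_add_le _ _).trans_lt ?_
    rw [Complex.norm_real]
    linarith
  have hΩsub := L.compl_subset ht.1 htr.le hrT.2
  have hΩsub' := L.compl_subset hrT.1 hu1.le huT
  set In : Set ℂ := (UHP \ K t) ∩ (fun q => ‖g t q - w t‖) ⁻¹' Iio ρ with hIn
  have hInopen : IsOpen In := hgc.isOpen_inter_preimage (L.isOpen_compl ht) isOpen_Iio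
  set V : Set ℂ := ((UHP \ K r) ∩ In) \ closure (UHP \ K u) with hV
  have hVopen : IsOpen V := ((L.isOpen_compl hrT).inter hInopen).sdiff isClosed_closure
  have hclos : ∀ z ∈ UHP, z ∉ η '' Icc 0 u → z ∈ closure (UHP \ K u) → z ∈ UHP \ K u := by
    intro z hz hzη hzc
    have ho : IsOpen (UHP \ η '' Icc 0 u) := isOpen_UHP.sdiff (L.isCompact_trace hu').isClosed
    obtain ⟨ε, hε, hsub⟩ := Metric.isOpen_iff.1 ho z ⟨hz, hzη⟩
    obtain ⟨y, hy, hyd⟩ := Metric.mem_closure_iff.1 hzc ε hε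
    refine L.subset_compl_of_isPreconnected hu' (convex_ball z ε).isPreconnected
      (fun x hx => (hsub hx).1) ?_ (p := y) (by rwa [mem_ball, dist_comm]) hy.2 (mem_ball_self hε)
    exact Set.disjoint_left.2 fun x hx => (hsub hx).2
  have hnη : ∀ z ∈ UHP \ K r, ‖g t z - w t‖ < ρ → z ∉ η '' Icc 0 u := by
    rintro z hz hzn ⟨v, hv, rfl⟩
    rcases le_or_gt v r with h | h
    · exact L.eta_notMem_compl hrT ⟨hv.1, h⟩ hz
    · have := (hηOut v ⟨h.le, hv.2⟩).2
      simp only [mem_preimage, mem_Ioi] at this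
      linarith
  have hdisj := (L.isPreconnected_compl hrT) V (Out ∪ (UHP \ K u)) hVopen
    (hOutopen.union (L.isOpen_compl hu')) ?_ ?_ ?_
  · obtain ⟨z, -, hzV, hz | hz⟩ := hdisj
    · have h1 := hz.2
      have h2 := hzV.1.2.2
      simp only [mem_preimage, mem_Ioi, mem_Iio] at h1 h2
      linarith
    · exact hzV.2 (subset_closure hz)
  · intro z hz
    have hzt := hΩsub hz
    rcases lt_trichotomy ‖g t z - w t‖ ρ with h | h | h
    · by_cases hzc : z ∈ closure (UHP \ K u)
      · exact Or.inr (Or.inr (hclos z hz.1 (hnη z hz h) hzc))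
      · exact Or.inl ⟨⟨hz, hzt, h⟩, hzc⟩
    · exact Or.inr (Or.inr ((hball hub).1.2.1 z hzt h))
    · exact Or.inr (Or.inl ⟨hzt, h⟩)
  · have hq₁r : q₁ ∈ UHP \ K r := ⟨L.hull_subset hu' hq₁.1, hq₁.2⟩
    refine ⟨q₁, hq₁r, ⟨hq₁r, hΩsub hq₁r, hq₁n⟩, fun hcl => ?_⟩
    exact (hclos q₁ hq₁r.1 (hnη q₁ hq₁r hq₁n) hcl).2 hq₁.1
  · refine ⟨f u I, hΩsub' (L.f_mem hu' (by simp [UHP])), Or.inr (L.f_mem hu' (by simp [UHP]))⟩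

theorem tendsto_f_ofReal (L : LoewnerCurve T w η K g S f) (ht : t ∈ Ico 0 T) (x : ℝ) :
    Tendsto (f t) (𝓝[UHP] (x : ℂ)) (𝓝 (f t x)) :=
  (L.f_cont ht x (by simp)).tendsto.mono_left (nhdsWithin_mono _ UHP_subset)

theorem exists_norm_transition_le (L : LoewnerCurve T w η K g S f) (ht : 0 ≤ t) (hts : t < s)
    (hs : s < T) (x : ℝ) : ∃ C, ∀ᶠ ζ in 𝓝[UHP] (x : ℂ), ‖g t (f s ζ)‖ ≤ C := by
  have ht' : t ∈ Ico 0 T := ⟨ht, hts.trans hs⟩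
  have hs' : s ∈ Ico 0 T := ⟨ht.trans hts.le, hs⟩
  obtain ⟨R, hR, hb⟩ := L.exists_norm_f_sub_le ht'
  refine ⟨max R (‖f s x‖ + 2), ?_⟩
  filter_upwards [(L.tendsto_f_ofReal hs' x).norm.eventually (gt_mem_nhds (lt_add_one _)),
    self_mem_nhdsWithin] with ζ h1 hζ
  by_contra! h2
  have hm := L.compl_subset ht hts.le hs (L.f_mem hs' hζ)
  have h3 := hb _ (L.g_mem ht' hm) ((le_max_left _ _).trans_lt h2)
  rw [L.f_g ht' hm] at h3
  have h4 := (le_max_right _ _).trans_lt h2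
  have h5 := norm_sub_norm_le (g t (f s ζ)) (f s ζ)
  rw [norm_sub_rev] at h5
  linarith

theorem tendsto_transition_im (L : LoewnerCurve T w η K g S f) (ht : 0 ≤ t) (hts : t < s)
    (hs : s < T) {ρ : ℝ} (h1 : ∀ q ∈ UHP \ K t, ρ ≤ ‖g t q - w t‖ → q ∈ UHP \ K s)
    (h2 : ∀ q ∈ UHP \ K s, 3 * ρ / 2 < ‖g s q - w t‖ → ρ < ‖g t q - w t‖) (hρ : 0 < ρ) {x : ℝ}
    (hx : 2 * ρ < |x - w t|) :
    Tendsto (fun ζ => ((g t ∘ f s) ζ).im) (𝓝[UHP] (x : ℂ)) (𝓝 0) := by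
  have ht' : t ∈ Ico 0 T := ⟨ht, hts.trans hs⟩
  have hs' : s ∈ Ico 0 T := ⟨ht.trans hts.le, hs⟩
  obtain ⟨C, hC⟩ := L.exists_norm_transition_le ht hts hs x
  rw [Metric.tendsto_nhds]
  intro ε hε
  by_contra hcon
  rw [not_eventually] at hcon
  set M : Set ℂ := {z | ε ≤ z.im ∧ ρ ≤ ‖z - w t‖} ∩ closedBall 0 C with hM
  have hMc : IsCompact M := by
    refine (isCompact_closedBall 0 C).inter_left ?_
    exact (isClosed_le continuous_const Complex.continuous_im).inter
      (isClosed_le continuous_const (by fun_prop : Continuous fun z : ℂ => ‖z - w t‖))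
  have hMU : M ⊆ UHP := fun z hz => hε.trans_le hz.1.1
  have him : IsClosed (f t '' M) :=
    (hMc.image_of_continuousOn ((L.f_cont ht').mono (hMU.trans UHP_subset))).isClosed
  have hfar : ∀ᶠ ζ : ℂ in 𝓝[UHP] (x : ℂ), 3 * ρ / 2 < ‖ζ - w t‖ := by
    have hc : Continuous fun ζ : ℂ => ‖ζ - w t‖ := by fun_prop
    refine (hc.tendsto _).mono_left nhdsWithin_le_nhds (lt_mem_nhds ?_)
    rw [← ofReal_sub, Complex.norm_real, Real.norm_eq_abs]
    linarith
  have hfr : ∃ᶠ ζ in 𝓝[UHP] (x : ℂ), f s ζ ∈ f t '' M := by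
    refine (hcon.and_eventually (hC.and (hfar.and self_mem_nhdsWithin))).mono ?_
    rintro ζ ⟨h3, h4, h5, hζ⟩
    have hm := L.f_mem hs' hζ
    have hm' := L.compl_subset ht hts.le hs hm
    refine ⟨g t (f s ζ), ⟨⟨?_, ?_⟩, by simpa using h4⟩, L.f_g ht' hm'⟩
    · have h0 : 0 < (g t (f s ζ)).im := L.g_mem ht' hm'
      rw [not_lt, Real.dist_0_eq_abs, Function.comp, abs_of_pos h0] at h3
      exact h3
    · exact (h2 _ hm (by rwa [L.g_f hs' hζ])).le
  obtain ⟨z, hz, hzx⟩ := him.mem_of_frequently_of_tendsto hfr (L.tendsto_f_ofReal hs' x)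
  refine L.f_ofReal_notMem hs' x (hzx ▸ h1 _ (L.f_mem ht' (hMU hz)) ?_)
  rw [L.g_f ht' (hMU hz)]
  exact hz.1.2

theorem tendsto_g_right (L : LoewnerCurve T w η K g S f) (ht : t ∈ Ico 0 T) {z : ℂ}
    (hz : z ∈ UHP \ K t) : Tendsto (fun s => g s z) (𝓝[>] t) (𝓝 (g t z)) := by
  rw [tendsto_iff_norm_sub_tendsto_zero]
  refine squeeze_zero' (Eventually.of_forall fun _ => norm_nonneg _) ?_ (tendsto_sqrt_shift t)
  have h0 : 0 < (g t z).im / 2 := half_pos (L.g_mem ht hz)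
  filter_upwards [(tendsto_sqrt_shift t).eventually (gt_mem_nhds h0), Ioo_mem_nhdsGT ht.2]
    with s h1 h2
  rw [norm_sub_rev]
  exact (L.survive ht.1 h2.1 h2.2 hz (by linarith)).2

/-- The Loewner equation, as a right derivative. -/
theorem hasDerivWithinAt_g (L : LoewnerCurve T w η K g S f) (ht : t ∈ Ico 0 T) {z : ℂ}
    (hz : z ∈ UHP \ K t) :
    HasDerivWithinAt (fun s => g s z) (2 / (g t z - w t)) (Ici t) t := by
  rw [← hasDerivWithinAt_Ioi_iff_Ici, hasDerivWithinAt_iff_tendsto_slope' self_notMem_Ioi]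
  have hg := L.tendsto_g_right ht hz
  have hy : 0 < (g t z).im := L.g_mem ht hz
  have hne : g t z - w t ≠ 0 := fun h => by
    have := congrArg im h
    simp at this
    exact hy.ne' this
  have hgw : Tendsto (fun s => g s z - w t) (𝓝[>] t) (𝓝 (g t z - w t)) := hg.sub_const _
  have hkey : Tendsto (fun s => (g s z - w t) * slope (fun s => g s z) t s) (𝓝[>] t) (𝓝 2) := by
    rw [Metric.tendsto_nhds]
    intro ε hε
    have hε' : 0 < ε * (g t z).im / 800 := by positivity
    obtain ⟨ρ, hρ, hρε, hev⟩ := L.local_growth ht hε'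
    have him : ∀ᶠ s in 𝓝[>] t, (g t z).im / 2 < (g s z).im :=
      ((Complex.continuous_im.tendsto _).comp hg).eventually (lt_mem_nhds (by linarith))
    filter_upwards [hev, him, L.eventually_survive ht hz, self_mem_nhdsWithin]
      with s ⟨hs, h1, h2⟩ h3 h4 (hts : t < s)
    have hs' : s ∈ Ico 0 T := ⟨ht.1.trans hts.le, hs⟩
    have h5 := (L.pickShift ht.1 hts hs).norm_mul_sub_add_le hρ
      (fun x hx => L.tendsto_transition_im ht.1 hts hs h1 h2 hρ hx) (fun x => by
        obtain ⟨C, hC⟩ := L.exists_norm_transition_le ht.1 hts hs x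
        refine ⟨C + (‖(x : ℂ)‖ + 1), ?_⟩
        have hx : ∀ᶠ ζ : ℂ in 𝓝[UHP] (x : ℂ), ‖ζ‖ < ‖(x : ℂ)‖ + 1 :=
          (continuous_norm.tendsto _).mono_left nhdsWithin_le_nhds (gt_mem_nhds (lt_add_one _))
        filter_upwards [hC, hx] with ζ h6 h7
        exact (norm_sub_le _ _).trans (add_le_add h6 h7.le)) (L.g_mem hs' h4)
    rw [L.transition_apply hs' h4] at h5
    have hst : 0 < s - t := by linarith
    have e : (g s z - w t) * slope (fun s => g s z) t s - 2 =
        -(((g s z - w t) * (g t z - g s z) + (2 * (s - t) : ℝ)) / ((s - t : ℝ) : ℂ)) := by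
      have : ((s - t : ℝ) : ℂ) ≠ 0 := by exact_mod_cast hst.ne'
      rw [slope_def_module, Complex.real_smul]
      push_cast at this ⊢
      field_simp
      ring
    rw [dist_eq_norm, e, norm_neg, norm_div, Complex.norm_real, Real.norm_of_nonneg hst.le,
      div_lt_iff₀ hst]
    refine h5.trans_lt ?_
    rw [div_lt_iff₀ (by linarith)]
    have h6 : ρ * 400 < ε * (g s z).im := by nlinarith
    nlinarith
  refine (hkey.div hgw hne).congr' ?_
  filter_upwards [hgw.eventually_ne hne] with s h
  simp only [Pi.div_apply]
  field_simp

end LoewnerCurve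

theorem tendsto_add_mul_I (x : ℝ) :
    Tendsto (fun y : ℝ => (x : ℂ) + y * I) (𝓝[>] 0) (𝓝[UHP] (x : ℂ)) := by
  refine tendsto_nhdsWithin_iff.2 ⟨?_, ?_⟩
  · exact (Continuous.tendsto' (by fun_prop) _ _ (by simp)).mono_left nhdsWithin_le_nhds
  · filter_upwards [self_mem_nhdsWithin] with y hy
    simpa [UHP] using hy

theorem nhdsWithin_UHP_neBot (x : ℝ) : (𝓝[UHP] (x : ℂ)).NeBot :=
  (tendsto_add_mul_I x).neBot

theorem re_deriv_nonneg {h : ℂ → ℂ} {x : ℝ} (hd : DifferentiableAt ℂ h x) (h0 : (h x).im = 0)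
    (hp : ∀ᶠ z in 𝓝[UHP] (x : ℂ), 0 ≤ (h z).im) : 0 ≤ (deriv h x).re := by
  have h1 : HasDerivAt (fun y : ℝ => (x : ℂ) + y * I) I 0 := by
    simpa using ((ofRealCLM.hasDerivAt (x := (0 : ℝ))).mul_const I).const_add (x : ℂ)
  have h2 : HasDerivAt h (deriv h x) ((x : ℂ) + (0 : ℝ) * I) := by
    simpa using hd.hasDerivAt
  have h3 := h2.comp_of_eq (0 : ℝ) h1 rfl
  have h4 : HasDerivAt (fun y : ℝ => (h ((x : ℂ) + y * I)).im) ((deriv h x) * I).im 0 :=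
    (imCLM.hasFDerivAt.comp_hasDerivAt (0 : ℝ) h3)
  rw [mul_I_im] at h4
  have h5 := (hasDerivWithinAt_iff_tendsto_slope' (s := Ioi (0 : ℝ)) self_notMem_Ioi).1
    h4.hasDerivWithinAt
  refine ge_of_tendsto h5 ?_
  filter_upwards [(tendsto_add_mul_I x).eventually hp, self_mem_nhdsWithin] with y h7 (hy : 0 < y)
  rw [slope_def_field]
  simp only [ofReal_zero, zero_mul, add_zero, h0, sub_zero]
  positivity

/-- A function that is real on a real interval and has nonnegative imaginary part above it is
nondecreasing on the interval. -/
theorem monotoneOn_re_ofReal {h : ℂ → ℂ} {U : Set ℝ} (hU : Convex ℝ U) (hUo : IsOpen U)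
    (hd : ∀ x ∈ U, DifferentiableAt ℂ h (x : ℝ)) (h0 : ∀ x ∈ U, (h (x : ℝ)).im = 0)
    (hp : ∀ x ∈ U, ∀ᶠ z in 𝓝[UHP] ((x : ℝ) : ℂ), 0 ≤ (h z).im) :
    MonotoneOn (fun x : ℝ => (h x).re) U := by
  have h1 : ∀ x ∈ U, HasDerivAt (fun x : ℝ => (h x).re) (deriv h (x : ℝ)).re x := fun x hx =>
    (hd x hx).hasDerivAt.real_of_complex
  refine monotoneOn_of_deriv_nonneg hU (fun x hx => (h1 x hx).continuousAt.continuousWithinAt)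
    (fun x hx => ?_) (fun x hx => ?_)
  · rw [hUo.interior_eq] at hx
    exact (h1 x hx).differentiableAt.differentiableWithinAt
  · rw [hUo.interior_eq] at hx
    rw [(h1 x hx).deriv]
    exact re_deriv_nonneg (hd x hx) (h0 x hx) (hp x hx)

theorem isClosed_Kdoub (K : Set ℂ) : IsClosed (Kdoub K) :=
  isClosed_closure.union
    ((Complex.conjCLE.toHomeomorph.isClosedMap) _ isClosed_closure)

theorem ofReal_mem_Kdoub {K : Set ℂ} {x : ℝ} : (x : ℂ) ∈ Kdoub K ↔ (x : ℂ) ∈ closure K := by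
  refine ⟨?_, Or.inl⟩
  rintro (h | ⟨y, hy, h⟩)
  · exact h
  · have : y = x := by rw [← Complex.conj_conj y, h, conj_ofReal]
    exact this ▸ hy

/-- The leftmost real point of the closed hull. -/
def leftPt (w : ℝ → ℝ) (K : ℝ → Set ℂ) (t : ℝ) : ℝ := if t = 0 then w 0 else aK (K t)

/-- The left end of the image of the boundary of the hull. -/
def leftIm (w : ℝ → ℝ) (S : ℝ → Set ℝ) (t : ℝ) : ℝ := if t = 0 then w 0 else sInf (S t)

namespace LoewnerCurve

variable {T : ℝ} {w : ℝ → ℝ} {η : ℝ → ℂ} {K : ℝ → Set ℂ} {g : ℝ → ℂ → ℂ}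
    {S : ℝ → Set ℝ} {f : ℝ → ℂ → ℂ} {s t τ x y : ℝ}

theorem w_zero_mem_closure (L : LoewnerCurve T w η K g S f) (ht : t ∈ Ioo 0 T) :
    ((w 0 : ℝ) : ℂ) ∈ closure (K t) := by
  have h := L.drive 0 ⟨le_rfl, ht.1.trans ht.2⟩ t ht.1 (by rw [zero_add]; exact ht.2)
  have hg : g 0 = id := funext L.g_zero
  rwa [zero_add, hg, image_id, L.K_zero, sdiff_empty] at h

theorem isCompact_real_closure (L : LoewnerCurve T w η K g S f) (ht : t ∈ Ico 0 T) :
    IsCompact {x : ℝ | (x : ℂ) ∈ closure (K t)} := by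
  have h1 : IsCompact (closure (K t)) := (L.isBounded_hull ht).isCompact_closure
  exact Complex.isometry_ofReal.isClosedEmbedding.isCompact_preimage h1

theorem leftPt_mem_closure (L : LoewnerCurve T w η K g S f) (ht : t ∈ Ioo 0 T) :
    ((leftPt w K t : ℝ) : ℂ) ∈ closure (K t) := by
  rw [leftPt, if_neg ht.1.ne']
  exact (L.isCompact_real_closure ⟨ht.1.le, ht.2⟩).sInf_mem ⟨w 0, L.w_zero_mem_closure ht⟩

theorem leftPt_le_of_mem (L : LoewnerCurve T w η K g S f) (ht : t ∈ Ico 0 T)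
    (hx : (x : ℂ) ∈ closure (K t)) : leftPt w K t ≤ x := by
  rcases ht.1.eq_or_lt with rfl | h
  · rw [L.K_zero, closure_empty] at hx
    exact hx.elim
  · rw [leftPt, if_neg h.ne']
    exact csInf_le (L.isCompact_real_closure ht).bddBelow hx

theorem notMem_closure_of_lt (L : LoewnerCurve T w η K g S f) (ht : t ∈ Ico 0 T)
    (hx : x < leftPt w K t) : (x : ℂ) ∉ closure (K t) :=
  fun h => hx.not_ge (L.leftPt_le_of_mem ht h)

theorem leftPt_le_zero (L : LoewnerCurve T w η K g S f) (ht : t ∈ Ico 0 T) :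
    leftPt w K t ≤ w 0 := by
  rcases ht.1.eq_or_lt with rfl | h
  · rw [leftPt, if_pos rfl]
  · exact L.leftPt_le_of_mem ht (L.w_zero_mem_closure ⟨h, ht.2⟩)

theorem leftPt_anti (L : LoewnerCurve T w η K g S f) (hs : 0 ≤ s) (hst : s ≤ t) (ht : t < T) :
    leftPt w K t ≤ leftPt w K s := by
  rcases hs.eq_or_lt with rfl | h
  · conv_rhs => rw [leftPt, if_pos rfl]
    exact L.leftPt_le_zero ⟨hst, ht⟩
  · exact L.leftPt_le_of_mem ⟨hs.trans hst, ht⟩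
      (closure_mono (L.mono s t hs hst ht) (L.leftPt_mem_closure ⟨h, hst.trans_lt ht⟩))

theorem differentiableAt_g (L : LoewnerCurve T w η K g S f) (ht : t ∈ Ico 0 T)
    (hx : (x : ℂ) ∉ closure (K t)) : DifferentiableAt ℂ (g t) x := by
  rcases ht.1.eq_or_lt with rfl | h
  · rw [show g 0 = id from funext L.g_zero]
    exact differentiableAt_id
  · obtain ⟨H, hne⟩ := L.hull t ⟨h, ht.2⟩
    refine (H.ext_holo hne).differentiableAt ((isClosed_Kdoub (K t)).isOpen_compl.mem_nhds ?_)
    exact fun h' => hx (ofReal_mem_Kdoub.1 h')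

theorem g_ofReal_im (L : LoewnerCurve T w η K g S f) (ht : t ∈ Ico 0 T)
    (hx : (x : ℂ) ∉ closure (K t)) : (g t x).im = 0 := by
  rcases ht.1.eq_or_lt with rfl | h
  · rw [L.g_zero, ofReal_im]
  · obtain ⟨H, hne⟩ := L.hull t ⟨h, ht.2⟩
    exact H.real_vals hne x fun h' => hx (ofReal_mem_Kdoub.1 h')

theorem ofReal_re_g (L : LoewnerCurve T w η K g S f) (ht : t ∈ Ico 0 T)
    (hx : (x : ℂ) ∉ closure (K t)) : (((g t x).re : ℝ) : ℂ) = g t x :=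
  Complex.ext rfl (by rw [ofReal_im, L.g_ofReal_im ht hx])

theorem eventually_mem_compl {K : Set ℂ} (hx : (x : ℂ) ∉ closure K) :
    ∀ᶠ z in 𝓝[UHP] (x : ℂ), z ∈ UHP \ K := by
  filter_upwards [self_mem_nhdsWithin,
    nhdsWithin_le_nhds (isClosed_closure.isOpen_compl.mem_nhds hx)] with z h1 h2
  exact ⟨h1, fun h => h2 (subset_closure h)⟩

theorem tendsto_g_ofReal (L : LoewnerCurve T w η K g S f) (ht : t ∈ Ico 0 T)
    (hx : (x : ℂ) ∉ closure (K t)) : Tendsto (g t) (𝓝[UHP] (x : ℂ)) (𝓝 (g t x)) :=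
  (L.differentiableAt_g ht hx).continuousAt.tendsto.mono_left nhdsWithin_le_nhds

theorem f_g_ofReal (L : LoewnerCurve T w η K g S f) (ht : t ∈ Ico 0 T)
    (hx : (x : ℂ) ∉ closure (K t)) : f t (g t x) = x := by
  have h1 : Tendsto (g t) (𝓝[UHP] (x : ℂ)) (𝓝[UHP] (g t x)) := by
    refine tendsto_nhdsWithin_iff.2 ⟨L.tendsto_g_ofReal ht hx, ?_⟩
    filter_upwards [eventually_mem_compl hx] with z hz
    exact L.g_mem ht hz
  have h2 := L.tendsto_f_ofReal ht (g t x).re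
  rw [L.ofReal_re_g ht hx] at h2
  have := nhdsWithin_UHP_neBot x
  refine tendsto_nhds_unique ((h2.comp h1).congr' ?_) (tendsto_id.mono_left nhdsWithin_le_nhds)
  filter_upwards [eventually_mem_compl hx] with z hz
  exact L.f_g ht hz

theorem re_g_injOn (L : LoewnerCurve T w η K g S f) (ht : t ∈ Ico 0 T) :
    InjOn (fun x : ℝ => (g t x).re) {x | (x : ℂ) ∉ closure (K t)} := by
  intro x hx y hy hxy
  have h1 : g t x = g t y := by
    rw [← L.ofReal_re_g ht hx, ← L.ofReal_re_g ht hy]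
    exact congrArg _ hxy
  have h2 := L.f_g_ofReal ht hx
  rw [h1, L.f_g_ofReal ht hy] at h2
  exact_mod_cast h2.symm

theorem re_g_strictMonoOn (L : LoewnerCurve T w η K g S f) (ht : t ∈ Ico 0 T) {U : Set ℝ}
    (hU : Convex ℝ U) (hUo : IsOpen U) (hUK : ∀ x ∈ U, ((x : ℝ) : ℂ) ∉ closure (K t)) :
    StrictMonoOn (fun x : ℝ => (g t x).re) U := by
  refine (monotoneOn_re_ofReal hU hUo (fun x hx => L.differentiableAt_g ht (hUK x hx))
    (fun x hx => L.g_ofReal_im ht (hUK x hx)) fun x hx => ?_).strictMonoOn_of_injOn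
    ((L.re_g_injOn ht).mono hUK)
  filter_upwards [eventually_mem_compl (hUK x hx)] with z hz
  exact UHP_subset (L.g_mem ht hz)

theorem re_g_strictMonoOn_Iio (L : LoewnerCurve T w η K g S f) (ht : t ∈ Ico 0 T) :
    StrictMonoOn (fun x : ℝ => (g t x).re) (Iio (leftPt w K t)) :=
  L.re_g_strictMonoOn ht (convex_Iio _) isOpen_Iio fun _ hx => L.notMem_closure_of_lt ht hx

theorem re_g_sub_monotoneOn (L : LoewnerCurve T w η K g S f) (hs : 0 ≤ s) (hst : s ≤ t)
    (ht : t < T) :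
    MonotoneOn (fun x : ℝ => (g s x).re - (g t x).re) (Iio (leftPt w K t)) := by
  have hs' : s ∈ Ico 0 T := ⟨hs, hst.trans_lt ht⟩
  have ht' : t ∈ Ico 0 T := ⟨hs.trans hst, ht⟩
  have hK := closure_mono (L.mono s t hs hst ht)
  have h1 : ∀ x < leftPt w K t, ((x : ℝ) : ℂ) ∉ closure (K t) := fun x hx =>
    L.notMem_closure_of_lt ht' hx
  have := monotoneOn_re_ofReal (h := fun z => g s z - g t z) (convex_Iio (leftPt w K t)) isOpen_Iio
    (fun x hx => (L.differentiableAt_g hs' fun h => h1 x hx (hK h)).sub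
      (L.differentiableAt_g ht' (h1 x hx)))
    (fun x hx => by
      rw [sub_im, L.g_ofReal_im hs' fun h => h1 x hx (hK h), L.g_ofReal_im ht' (h1 x hx), sub_zero])
    fun x hx => by
      filter_upwards [eventually_mem_compl (h1 x hx)] with z hz
      rw [sub_im, sub_nonneg]
      exact L.im_g_le hs hst ht hz
  simpa only [sub_re] using this

theorem re_g_sub_le (L : LoewnerCurve T w η K g S f) (ht : t ∈ Ico 0 T) (hxy : x ≤ y)
    (hy : y < leftPt w K t) : (g t y).re - (g t x).re ≤ y - x := by
  have := L.re_g_sub_monotoneOn le_rfl ht.1 ht.2 (hxy.trans_lt hy : x ∈ Iio _) hy hxy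
  simp only [L.g_zero, ofReal_re] at this
  linarith

theorem tendsto_re_g_sub (L : LoewnerCurve T w η K g S f) (ht : t ∈ Ico 0 T) :
    Tendsto (fun x : ℝ => (g t x).re - x) (cobounded ℝ) (𝓝 0) := by
  have h1 : Tendsto ((↑) : ℝ → ℂ) (cobounded ℝ) (cobounded ℂ) :=
    Complex.isometry_ofReal.antilipschitz.tendsto_cobounded
  have h2 := (Complex.continuous_re.tendsto _).comp ((L.tendsto_g_sub ht).comp h1)
  simpa [Function.comp_def] using h2

theorem exists_re_g_lt (L : LoewnerCurve T w η K g S f) (ht : t ∈ Ico 0 T) (a y : ℝ) :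
    ∃ x < a, (g t x).re < y := by
  have h1 := (L.tendsto_re_g_sub ht).mono_left
    (atBot_le_cocompact.trans_eq Metric.cobounded_eq_cocompact.symm)
  obtain ⟨x, h2, h3, h4⟩ := ((h1.eventually (gt_mem_nhds one_pos)).and
    ((eventually_lt_atBot a).and (eventually_lt_atBot (y - 1)))).exists
  exact ⟨x, h3, by linarith⟩

theorem exists_real_preimage (L : LoewnerCurve T w η K g S f) (ht : t ∈ Ioo 0 T) (hy : y ∉ S t) :
    ∃ x : ℝ, (x < aK (K t) ∨ bK (K t) < x) ∧ (g t x).re = y := by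
  obtain ⟨H, hne⟩ := L.hull t ht
  obtain ⟨z, ⟨hz1, hz2⟩, hzy⟩ := (H.extBij hne).surjOn
    (show (y : ℂ) ∈ {z : ℂ | ∀ s ∈ S t, z ≠ (s : ℂ)} from fun s hs h => hy (by
      have : y = s := by exact_mod_cast h
      exact this ▸ hs))
  have hpos : ∀ z : ℂ, z ∉ Kdoub (K t) → (g t z).im = 0 → ¬ 0 < z.im := fun z h1 h2 h3 => by
    have h4 : 0 < (g t z).im := H.bij.mapsTo ⟨h3, fun h => h1 (Or.inl (subset_closure h))⟩
    exact h4.ne' h2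
  have him : z.im = 0 := by
    rcases lt_trichotomy z.im 0 with h | h | h
    · exfalso
      refine hpos ((starRingEnd ℂ) z) ?_ ?_ (by simpa using h)
      · rintro (h' | ⟨u, hu, h'⟩)
        · exact hz1 (Or.inr ⟨_, h', Complex.conj_conj z⟩)
        · rw [(starRingEnd ℂ).injective h'] at hu
          exact hz1 (Or.inl hu)
      · rw [H.conj_symm hne z hz1, hzy, conj_ofReal, ofReal_im]
    · exact h
    · exact (hpos z hz1 (by rw [hzy, ofReal_im]) h).elim
  have hzr : ((z.re : ℝ) : ℂ) = z := Complex.ext rfl (by rw [ofReal_im, him])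
  refine ⟨z.re, ?_, by rw [hzr, hzy, ofReal_re]⟩
  by_contra! hcon
  exact hz2 ⟨z.re, hcon, hzr⟩

theorem le_bK_of_mem (L : LoewnerCurve T w η K g S f) (ht : t ∈ Ico 0 T)
    (hx : (x : ℂ) ∈ closure (K t)) : x ≤ bK (K t) :=
  le_csSup (L.isCompact_real_closure ht).bddAbove hx

theorem re_g_notMem (L : LoewnerCurve T w η K g S f) (ht : t ∈ Ioo 0 T)
    (hx : x < aK (K t) ∨ bK (K t) < x) : (g t x).re ∉ S t := by
  obtain ⟨H, hne⟩ := L.hull t ht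
  have ht' : t ∈ Ico 0 T := ⟨ht.1.le, ht.2⟩
  have hxK : (x : ℂ) ∉ closure (K t) := by
    intro h
    rcases hx with hx | hx
    · exact hx.not_ge (csInf_le (L.isCompact_real_closure ht').bddBelow h)
    · exact hx.not_ge (L.le_bK_of_mem ht' h)
  intro h
  refine (H.extBij hne).mapsTo (x := (x : ℂ)) ⟨fun h' => hxK (ofReal_mem_Kdoub.1 h'), ?_⟩ _ h
    (L.ofReal_re_g ht' hxK).symm
  rintro ⟨u, hu, h'⟩
  have : u = x := Complex.ofReal_injective h'
  subst this
  rcases hx with hx | hx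
  · exact hx.not_ge hu.1
  · exact hx.not_ge hu.2

/-- The image under `g t` of the real points to the left of the hull. -/
theorem image_re_g_Iio (L : LoewnerCurve T w η K g S f) (ht : t ∈ Ico 0 T) :
    (fun x : ℝ => (g t x).re) '' Iio (leftPt w K t) = Iio (leftIm w S t) := by
  rcases ht.1.eq_or_lt with rfl | ht0
  · simp [L.g_zero, leftPt, leftIm]
  have ht' : t ∈ Ioo 0 T := ⟨ht0, ht.2⟩
  have hleft : leftPt w K t = aK (K t) := by rw [leftPt, if_neg ht0.ne']
  set γ := fun x : ℝ => (g t x).re with hγ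
  have hA := L.re_g_strictMonoOn_Iio ht
  have hB : StrictMonoOn γ (Ioi (bK (K t))) :=
    L.re_g_strictMonoOn ht (convex_Ioi _) isOpen_Ioi fun x hx h =>
      (mem_Ioi.1 hx).not_ge (L.le_bK_of_mem ht h)
  have hAK : ∀ x < leftPt w K t, ((x : ℝ) : ℂ) ∉ closure (K t) := fun x hx =>
    L.notMem_closure_of_lt ht hx
  have hcontγ : ∀ x : ℝ, (x : ℂ) ∉ closure (K t) → ContinuousAt γ x := fun x hx =>
    (L.differentiableAt_g ht hx).hasDerivAt.real_of_complex.continuousAt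
  set A := γ '' Iio (leftPt w K t) with hAdef
  have hAoc : A.OrdConnected := ((ordConnected_Iio.isPreconnected).image _
    fun x hx => (hcontγ x (hAK x hx)).continuousWithinAt).ordConnected
  have hAlow : ∀ y ∈ A, ∀ y' ≤ y, y' ∈ A := by
    intro y hy y' hy'
    obtain ⟨x, hx, hxy⟩ := L.exists_re_g_lt ht (leftPt w K t) y'
    exact hAoc.out (mem_image_of_mem γ hx) hy ⟨hxy.le, hy'⟩
  have hAne : A.Nonempty := ⟨_, mem_image_of_mem γ (show leftPt w K t - 1 ∈ Iio _ by simp)⟩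
  have hab : leftPt w K t ≤ bK (K t) := L.le_bK_of_mem ht (L.leftPt_mem_closure ht')
  have hAB : ∀ y ∈ A, ∀ x > bK (K t), y < γ x := by
    intro y hy x hx
    by_contra! hle
    obtain ⟨x', hx', h⟩ := hAlow y hy _ hle
    have := L.re_g_injOn ht (hAK x' hx')
      (fun h => (mem_Ioi.1 hx).not_ge (L.le_bK_of_mem ht h)) h
    rw [mem_Iio] at hx'
    linarith
  have hAb : BddAbove A := ⟨γ (bK (K t) + 1), fun y hy => (hAB y hy _ (by simp)).le⟩
  have hAS : ∀ y ∈ A, y ∉ S t := by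
    rintro _ ⟨x, hx, rfl⟩
    exact L.re_g_notMem ht' (Or.inl (hleft ▸ hx))
  have hnotA : sSup A ∉ A := by
    rintro ⟨x, hx, h⟩
    obtain ⟨x', h1, h2⟩ := exists_between (mem_Iio.1 hx)
    have h3 := hA hx (mem_Iio.2 h2) h1
    have h4 := le_csSup hAb (mem_image_of_mem γ (mem_Iio.2 h2))
    rw [← h] at h4
    exact h3.not_ge h4
  have hlt : ∀ y < sSup A, y ∈ A := by
    intro y hy
    obtain ⟨y', h1, h2⟩ := exists_lt_of_lt_csSup hAne hy
    exact hAlow y' h1 y h2.le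
  have hsup : sSup A ∈ S t := by
    by_contra hS
    obtain ⟨x, hx | hx, h⟩ := L.exists_real_preimage ht' hS
    · exact hnotA ⟨x, hleft ▸ hx, h⟩
    · obtain ⟨x', h1, h2⟩ := exists_between hx
      have h3 : γ x' < γ x := hB h1 hx h2
      have h4 : sSup A ≤ γ x' := csSup_le hAne fun y hy => (hAB y hy x' h1).le
      exact (h4.trans_lt h3).ne' h
  have hinf : sInf (S t) = sSup A := by
    refine IsLeast.csInf_eq ⟨hsup, fun y hy => ?_⟩
    by_contra! h
    exact hAS y (hlt y h) hy
  rw [leftIm, if_neg ht0.ne', hinf]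
  ext y
  refine ⟨fun hy => lt_of_le_of_ne (le_csSup hAb hy) ?_, hlt y⟩
  rintro rfl
  exact hnotA hy

theorem re_g_lt_leftIm (L : LoewnerCurve T w η K g S f) (ht : t ∈ Ico 0 T)
    (hx : x < leftPt w K t) : (g t x).re < leftIm w S t := by
  have h := mem_image_of_mem (fun x : ℝ => (g t x).re) (mem_Iio.2 hx)
  rwa [L.image_re_g_Iio ht] at h

theorem exists_re_g_eq (L : LoewnerCurve T w η K g S f) (ht : t ∈ Ico 0 T)
    (hy : y < leftIm w S t) : ∃ x < leftPt w K t, (g t x).re = y := by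
  have h : y ∈ Iio (leftIm w S t) := hy
  rwa [← L.image_re_g_Iio ht] at h

theorem eta_zero (L : LoewnerCurve T w η K g S f) (hT : 0 < T) : η 0 = w 0 := by
  have h0 : (0 : ℝ) ∈ Ico 0 T := ⟨le_rfl, hT⟩
  rw [L.curve 0 h0]
  have := L.f_g_ofReal h0 (x := w 0) (by simp [L.K_zero])
  rwa [L.g_zero] at this

/-- The left end of the image of the hull lies to the left of the driving point. -/
theorem leftIm_le (L : LoewnerCurve T w η K g S f) (ht : t ∈ Ico 0 T) :
    leftIm w S t ≤ w t := by
  rcases ht.1.eq_or_lt with rfl | ht0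
  · rw [leftIm, if_pos rfl]
  by_contra! hlt
  obtain ⟨x, hx, hxw⟩ := L.exists_re_g_eq ht hlt
  have hxK := L.notMem_closure_of_lt ht hx
  have hη : η t = x := by
    rw [L.curve t ht, ← hxw, L.ofReal_re_g ht hxK, L.f_g_ofReal ht hxK]
  obtain ⟨ρ, hρ, hball⟩ := Metric.isOpen_iff.1 isClosed_closure.isOpen_compl (x : ℂ) hxK
  have h0 : ρ ≤ ‖η 0 - x‖ := by
    rw [L.eta_zero (ht0.trans ht.2)]
    by_contra! h
    exact hball (by rwa [mem_ball, dist_eq_norm]) (L.w_zero_mem_closure ⟨ht0, ht.2⟩)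
  have hsub : ∀ v ∈ Ioo 0 ρ, ((x + v : ℝ) : ℂ) ∈ η '' Ico 0 T ∨
      ((x - v : ℝ) : ℂ) ∈ η '' Ico 0 T := by
    intro v hv
    have hc : ContinuousOn (fun r => ‖η r - x‖) (Icc 0 t) :=
      ((L.η_cont.mono fun r hr => ⟨hr.1, hr.2.trans_lt ht.2⟩).sub continuousOn_const).norm
    obtain ⟨r, hr, hrv⟩ := intermediate_value_Icc' ht.1 hc
      (show v ∈ Icc _ _ from ⟨by simp only [hη, sub_self, norm_zero]; exact hv.1.le,
        hv.2.le.trans h0⟩)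
    have hrT : r ∈ Ico 0 T := ⟨hr.1, hr.2.trans_lt ht.2⟩
    simp only at hrv
    have him : (η r).im = 0 := by
      refine le_antisymm ?_ (L.η_im r hrT)
      by_contra! h
      have : η r ∈ K t := (L.gen t ht).1 ⟨⟨r, hr, rfl⟩, h⟩
      refine hball (show η r ∈ ball (x : ℂ) ρ from ?_) (subset_closure this)
      rw [mem_ball, dist_eq_norm, hrv]
      exact hv.2
    have hre : η r = ((η r).re : ℝ) := Complex.ext rfl (by rw [ofReal_im, him])
    rw [hre, ← ofReal_sub, Complex.norm_real, Real.norm_eq_abs] at hrv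
    rcases abs_eq hv.1.le |>.1 hrv with h | h
    · left
      rw [← h, add_sub_cancel, ← hre]
      exact ⟨r, hrT, rfl⟩
    · right
      have : x - v = (η r).re := by linarith
      rw [this, ← hre]
      exact ⟨r, hrT, rfl⟩
  set N := {x : ℝ | (x : ℂ) ∈ η '' Set.Ico 0 T} with hN
  have hN1 : MeasureTheory.volume ((fun v => x + v) ⁻¹' N) = 0 := by
    rw [MeasureTheory.measure_preimage_add]
    exact L.null
  have hN2 : MeasureTheory.volume ((fun v => x - v) ⁻¹' N) = 0 := by
    rw [(MeasureTheory.Measure.measurePreserving_sub_left MeasureTheory.volume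
      x).measure_preimage (MeasureTheory.NullMeasurableSet.of_null L.null)]
    exact L.null
  have h3 := MeasureTheory.measure_mono_null (s := Ioo 0 ρ) (fun v hv => hsub v hv)
    (MeasureTheory.measure_union_null hN1 hN2)
  rw [Real.volume_Ioo, ENNReal.ofReal_eq_zero] at h3
  linarith

theorem exists_norm_g_sub_ofReal_le (L : LoewnerCurve T w η K g S f) (ht : t ∈ Ico 0 T)
    (hx : (x : ℂ) ∉ closure (K t)) : ∃ δ, 0 < δ ∧ (∀ z ∈ ball (x : ℂ) δ, z ∈ UHP → z ∈ UHP \ K t) ∧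
      ∀ r ∈ Icc 0 t, ∀ z ∈ ball (x : ℂ) δ, ‖g r z - g r x‖ ≤ 32 * ‖z - x‖ := by
  obtain ⟨ε, hε, hball⟩ := Metric.isOpen_iff.1 isClosed_closure.isOpen_compl (x : ℂ) hx
  have hmem : ∀ z ∈ ball (x : ℂ) ε, z ∈ UHP → z ∈ UHP \ K t := fun z hz h =>
    ⟨h, fun h' => hball hz (subset_closure h')⟩
  refine ⟨ε / 2, by linarith, fun z hz => hmem z (ball_subset_ball (by linarith) hz), ?_⟩
  intro r hr z hz
  rcases hr.1.eq_or_lt with rfl | hr0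
  · rw [L.g_zero, L.g_zero]
    linarith [norm_nonneg (z - x)]
  have hrT : r ∈ Ioo 0 T := ⟨hr0, hr.2.trans_lt ht.2⟩
  obtain ⟨H, hne⟩ := L.hull r hrT
  have hKr := closure_mono (L.mono r t hr.1 hr.2 ht.2)
  have hconj : ∀ z ∈ ball (x : ℂ) ε, (starRingEnd ℂ) z ∈ ball (x : ℂ) ε := fun z hz => by
    rw [mem_ball, dist_eq_norm] at hz ⊢
    rwa [← conj_ofReal, ← map_sub, RCLike.norm_conj]
  have hdoub : ∀ z ∈ ball (x : ℂ) ε, z ∉ Kdoub (K r) := by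
    rintro z hz (h | ⟨u, hu, rfl⟩)
    · exact hball hz (hKr h)
    · have := hconj _ hz
      rw [Complex.conj_conj] at this
      exact hball this (hKr hu)
  have hup : ∀ z ∈ ball (x : ℂ) ε, z ∈ UHP → |(g r z).im| ≤ ε := by
    intro z hz hzU
    have h1 := hmem z hz hzU
    have h2 := L.im_g_le le_rfl hr.1 hrT.2 (L.compl_subset hr.1 hr.2 ht.2 h1)
    have h3 : 0 < (g r z).im :=
      L.g_mem ⟨hr.1, hrT.2⟩ (L.compl_subset hr.1 hr.2 ht.2 h1)
    rw [L.g_zero] at h2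
    rw [abs_of_pos h3]
    rw [mem_ball, dist_eq_norm] at hz
    have h4 := Complex.im_le_norm (z - x)
    rw [sub_im, ofReal_im, sub_zero] at h4
    linarith
  have him : ∀ z ∈ ball (x : ℂ) ε, |(g r z).im| ≤ ε := by
    intro z hz
    rcases lt_trichotomy z.im 0 with h | h | h
    · have h1 := hup _ (hconj z hz) (by simpa [UHP] using h)
      rwa [H.conj_symm hne z (hdoub z hz), conj_im, abs_neg] at h1
    · have hzr : ((z.re : ℝ) : ℂ) = z := Complex.ext rfl (by rw [ofReal_im, h])
      have := H.real_vals hne z.re (by rw [hzr]; exact hdoub z hz)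
      rw [hzr] at this
      rw [this, abs_zero]
      exact hε.le
    · exact hup z hz h
  have hdiff : DifferentiableOn ℂ (g r) (ball (x : ℂ) ε) := (H.ext_holo hne).mono hdoub
  have hsub : ball (x : ℂ) (ε / 2) ⊆ ball (x : ℂ) ε := ball_subset_ball (by linarith)
  refine (convex_ball (x : ℂ) (ε / 2)).norm_image_sub_le_of_norm_deriv_le
    (fun u hu => hdiff.differentiableAt (isOpen_ball.mem_nhds (hsub hu))) (fun u hu => ?_)
    (mem_ball_self (by linarith)) hz
  have hsub' : ball u (ε / 2) ⊆ ball (x : ℂ) ε := ball_subset_ball' (by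
    rw [mem_ball] at hu
    linarith)
  refine (norm_deriv_le_of_abs_im_le (by linarith) hε (hdiff.mono hsub')
    fun ζ hζ => him ζ (hsub' hζ)).trans_eq ?_
  field_simp
  norm_num

theorem exists_gap (L : LoewnerCurve T w η K g S f) (ht : t ∈ Ico 0 T) (hx : x < leftPt w K t) :
    ∃ κ, 0 < κ ∧ ∀ r ∈ Icc 0 t, κ ≤ w r - (g r x).re := by
  obtain ⟨x', h1, h2⟩ := exists_between hx
  refine ⟨(g t x').re - (g t x).re, sub_pos.2 (L.re_g_strictMonoOn_Iio ht hx h2 h1), ?_⟩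
  intro r hr
  have hrT : r ∈ Ico 0 T := ⟨hr.1, hr.2.trans_lt ht.2⟩
  have h3 := L.re_g_sub_monotoneOn hr.1 hr.2 ht.2 (mem_Iio.2 hx) (mem_Iio.2 h2) h1.le
  have h4 := L.re_g_lt_leftIm hrT (h2.trans_le (L.leftPt_anti hr.1 hr.2 ht.2))
  have h5 := L.leftIm_le hrT
  simp only at h3
  linarith

theorem g_sub_w_ne_zero (L : LoewnerCurve T w η K g S f) (ht : t ∈ Ico 0 T) {z : ℂ}
    (hz : z ∈ UHP \ K t) (v : ℝ) : g t z - v ≠ 0 := fun h => by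
  have h1 : 0 < (g t z).im := L.g_mem ht hz
  have := congrArg im h
  simp only [sub_im, ofReal_im, sub_zero, zero_im] at this
  exact h1.ne' this

theorem continuousOn_g (L : LoewnerCurve T w η K g S f) (ht : t ∈ Ico 0 T) {z : ℂ}
    (hz : z ∈ UHP \ K t) : ContinuousOn (fun r => g r z) (Icc 0 t) := by
  have h0 : 0 < (g t z).im := L.g_mem ht hz
  refine (LipschitzOnWith.of_dist_le_mul
    (K := .mk (2 / (g t z).im) (by positivity)) ?_).continuousOn
  intro a ha b hb
  rw [NNReal.coe_mk, dist_eq_norm, Real.dist_eq]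
  rcases le_total a b with h | h
  · refine (L.norm_g_sub_le ha.1 h hb.2 ht.2 hz).trans_eq ?_
    rw [abs_sub_comm, abs_of_nonneg (by linarith)]
    ring
  · rw [norm_sub_rev]
    refine (L.norm_g_sub_le hb.1 h ha.2 ht.2 hz).trans_eq ?_
    rw [abs_of_nonneg (by linarith)]
    ring

theorem continuousOn_w (L : LoewnerCurve T w η K g S f) (ht : t ∈ Ico 0 T) :
    ContinuousOn w (Icc 0 t) :=
  L.w_cont.mono fun _ hr => ⟨hr.1, hr.2.trans_lt ht.2⟩

theorem continuousOn_field (L : LoewnerCurve T w η K g S f) (ht : t ∈ Ico 0 T) {z : ℂ}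
    (hz : z ∈ UHP \ K t) : ContinuousOn (fun r => 2 / (g r z - w r)) (Icc 0 t) := by
  refine continuousOn_const.div ((L.continuousOn_g ht hz).sub
    (Complex.continuous_ofReal.comp_continuousOn (L.continuousOn_w ht))) fun r hr => ?_
  exact L.g_sub_w_ne_zero ⟨hr.1, hr.2.trans_lt ht.2⟩ (L.compl_subset hr.1 hr.2 ht.2 hz) _

theorem integral_g (L : LoewnerCurve T w η K g S f) (hs : 0 ≤ s) (hst : s ≤ t) (ht : t < T) {z : ℂ}
    (hz : z ∈ UHP \ K t) : ∫ r in s..t, 2 / (g r z - w r) = g t z - g s z := by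
  have ht' : t ∈ Ico 0 T := ⟨hs.trans hst, ht⟩
  have hsub : uIcc s t ⊆ Icc 0 t := by
    rw [uIcc_of_le hst]
    exact Icc_subset_Icc_left hs
  refine intervalIntegral.integral_eq_sub_of_hasDeriv_right ((L.continuousOn_g ht' hz).mono hsub)
    (fun r hr => ?_) ((L.continuousOn_field ht' hz).mono hsub).intervalIntegrable
  rw [min_eq_left hst, max_eq_right hst] at hr
  exact (L.hasDerivWithinAt_g ⟨hs.trans hr.1.le, hr.2.trans ht⟩
    (L.compl_subset (hs.trans hr.1.le) hr.2.le ht hz)).mono Ioi_subset_Ici_self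

/-- The Loewner equation in integrated form, at real points to the left of the hull. -/
theorem integral_re_g (L : LoewnerCurve T w η K g S f) (hs : 0 ≤ s) (hst : s ≤ t) (ht : t < T)
    (hx : x < leftPt w K t) :
    ∫ r in s..t, 2 / (w r - (g r x).re) = (g s x).re - (g t x).re := by
  have ht' : t ∈ Ico 0 T := ⟨hs.trans hst, ht⟩
  have hxK := L.notMem_closure_of_lt ht' hx
  have hxr : ∀ r ∈ Icc 0 t, (x : ℂ) ∉ closure (K r) := fun r hr =>
    L.notMem_closure_of_lt ⟨hr.1, hr.2.trans_lt ht⟩ (hx.trans_le (L.leftPt_anti hr.1 hr.2 ht))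
  obtain ⟨κ, hκ, hgap⟩ := L.exists_gap ht' hx
  obtain ⟨δ, hδ, hmem, hlip⟩ := L.exists_norm_g_sub_ofReal_le ht' hxK
  have hz := tendsto_add_mul_I x
  have hz' := hz.mono_right nhdsWithin_le_nhds
  have hIoc : ∀ r ∈ uIoc s t, r ∈ Icc 0 t := fun r hr => by
    rw [uIoc_of_le hst] at hr
    exact ⟨hs.trans hr.1.le, hr.2⟩
  have hev : ∀ᶠ y : ℝ in 𝓝[>] 0, (x : ℂ) + y * I ∈ UHP \ K t ∧
      ∀ r ∈ Icc 0 t, κ / 2 ≤ ‖g r (x + y * I) - w r‖ := by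
    have h1 : 0 < min δ (κ / 64) := by positivity
    filter_upwards [hz.eventually self_mem_nhdsWithin, hz'.eventually (ball_mem_nhds _ h1)]
      with y h2 h3
    have h4 : (x : ℂ) + y * I ∈ ball (x : ℂ) δ := ball_subset_ball (min_le_left _ _) h3
    refine ⟨hmem _ h4 h2, fun r hr => ?_⟩
    have h5 := hlip r hr _ h4
    have h6 : ‖(x : ℂ) + y * I - x‖ < κ / 64 := by
      rw [← dist_eq_norm]
      exact (mem_ball.1 h3).trans_le (min_le_right _ _)
    have h7 := hgap r hr
    have h8 := Complex.abs_re_le_norm (g r (x + y * I) - g r x)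
    have h9 := Complex.abs_re_le_norm (g r (x + y * I) - w r)
    rw [sub_re] at h8
    rw [sub_re, ofReal_re] at h9
    have h10 := (abs_le.1 h8).2
    have h11 := (abs_le.1 h9).1
    linarith
  have hlim := intervalIntegral.tendsto_integral_filter_of_dominated_convergence
    (μ := MeasureTheory.volume) (a := s) (b := t) (l := 𝓝[>] (0 : ℝ))
    (F := fun y r => 2 / (g r (x + y * I) - w r)) (f := fun r => 2 / (g r x - w r))
    (fun _ => 4 / κ) ?_ ?_ intervalIntegrable_const ?_
  · have h1 : Tendsto (fun y : ℝ => g t (x + y * I) - g s (x + y * I)) (𝓝[>] 0)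
        (𝓝 (g t x - g s x)) :=
      ((L.tendsto_g_ofReal ht' hxK).comp hz).sub
        ((L.tendsto_g_ofReal ⟨hs, hst.trans_lt ht⟩ (hxr s ⟨hs, hst⟩)).comp hz)
    have h2 : ∫ r in s..t, 2 / (g r x - w r) = g t x - g s x := by
      refine tendsto_nhds_unique (hlim.congr' ?_) h1
      filter_upwards [hev] with y hy
      exact L.integral_g hs hst ht hy.1
    have h3 : ∫ r in s..t, 2 / (g r x - w r) =
        ∫ r in s..t, ((-(2 / (w r - (g r x).re)) : ℝ) : ℂ) := by
      refine intervalIntegral.integral_congr fun r hr => ?_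
      rw [uIcc_of_le hst] at hr
      have hr' : r ∈ Icc 0 t := ⟨hs.trans hr.1, hr.2⟩
      conv_lhs => rw [← L.ofReal_re_g ⟨hr'.1, hr'.2.trans_lt ht⟩ (hxr r hr')]
      push_cast
      rw [← neg_sub, div_neg]
    rw [h3, intervalIntegral.integral_ofReal, intervalIntegral.integral_neg] at h2
    have h4 := congrArg re h2
    rw [ofReal_re, sub_re] at h4
    linarith
  · filter_upwards [hev] with y hy
    refine ((L.continuousOn_field ht' hy.1).mono hIoc).aestronglyMeasurable measurableSet_uIoc
  · filter_upwards [hev] with y hy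
    refine MeasureTheory.ae_of_all _ fun r hr => ?_
    rw [norm_div, Complex.norm_ofNat]
    calc (2 : ℝ) / ‖g r (x + y * I) - w r‖ ≤ 2 / (κ / 2) := by
          have := hy.2 r (hIoc r hr)
          gcongr
      _ = 4 / κ := by ring
  · refine MeasureTheory.ae_of_all _ fun r hr => ?_
    have hr' := hIoc r hr
    have hrT : r ∈ Ico 0 T := ⟨hr'.1, hr'.2.trans_lt ht⟩
    refine tendsto_const_nhds.div
      (((L.tendsto_g_ofReal hrT (hxr r hr')).comp hz).sub_const _) fun h => ?_
    have h1 := hgap r hr'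
    have h2 := congrArg re h
    rw [sub_re, ofReal_re, zero_re] at h2
    linarith

theorem re_g_continuousOn (L : LoewnerCurve T w η K g S f) (ht : t ∈ Ico 0 T)
    (hx : x < leftPt w K t) : ContinuousOn (fun r => (g r x).re) (Icc 0 t) := by
  obtain ⟨κ, hκ, hgap⟩ := L.exists_gap ht hx
  have hmain : ∀ a ∈ Icc 0 t, ∀ b ∈ Icc 0 t, a ≤ b →
      |(g a x).re - (g b x).re| ≤ 2 / κ * |b - a| := by
    intro a ha b hb hab
    rw [← L.integral_re_g ha.1 hab (hb.2.trans_lt ht.2)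
      (hx.trans_le (L.leftPt_anti hb.1 hb.2 ht.2)), ← Real.norm_eq_abs]
    refine intervalIntegral.norm_integral_le_of_norm_le_const fun r hr => ?_
    rw [uIoc_of_le hab] at hr
    have h1 := hgap r ⟨ha.1.trans hr.1.le, hr.2.trans hb.2⟩
    rw [Real.norm_of_nonneg (by have := hκ.trans_le h1; positivity)]
    gcongr
  refine (LipschitzOnWith.of_dist_le_mul (K := .mk (2 / κ) (by positivity)) ?_).continuousOn
  intro a ha b hb
  rw [NNReal.coe_mk, Real.dist_eq, Real.dist_eq]
  rcases le_total a b with h | h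
  · rw [abs_sub_comm a b]
    exact hmain a ha b hb h
  · rw [abs_sub_comm]
    exact hmain b hb a ha h

theorem continuousOn_real_field (L : LoewnerCurve T w η K g S f) (ht : t ∈ Ico 0 T)
    (hx : x < leftPt w K t) : ContinuousOn (fun r => 2 / (w r - (g r x).re)) (Icc 0 t) := by
  obtain ⟨κ, hκ, hgap⟩ := L.exists_gap ht hx
  exact continuousOn_const.div ((L.continuousOn_w ht).sub (L.re_g_continuousOn ht hx))
    fun r hr => (hκ.trans_le (hgap r hr)).ne'

/-- The leftmost real point of the hull moves right-continuously. -/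
theorem eventually_lt_leftPt (L : LoewnerCurve T w η K g S f) (ht : t ∈ Ico 0 T)
    (hx : x < leftPt w K t) : ∀ᶠ s in 𝓝[>] t, x < leftPt w K s := by
  have h1 : (g t x).re < w t := (L.re_g_lt_leftIm ht hx).trans_le (L.leftIm_le ht)
  obtain ⟨ρ, -, hρ, hev⟩ := L.local_growth ht (sub_pos.2 h1)
  filter_upwards [hev, self_mem_nhdsWithin] with s hs hts
  obtain ⟨hsT, hA, -⟩ := hs
  rw [mem_Ioi] at hts
  by_contra hcon
  rw [not_lt] at hcon
  have hpt := hcon.trans_lt hx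
  have hpK := L.notMem_closure_of_lt ht hpt
  have h2 : (g t (leftPt w K s)).re ≤ (g t x).re :=
    (L.re_g_strictMonoOn_Iio ht).monotoneOn hpt hx hcon
  have h3 : ρ < ‖g t (leftPt w K s) - w t‖ := by
    have h4 := Complex.abs_re_le_norm (g t (leftPt w K s) - w t)
    rw [sub_re, ofReal_re, abs_sub_comm] at h4
    have h5 := le_abs_self (w t - (g t (leftPt w K s)).re)
    linarith
  have h6 : ∀ᶠ z in 𝓝 ((leftPt w K s : ℝ) : ℂ), ρ < ‖g t z - w t‖ :=
    ((L.differentiableAt_g ht hpK).continuousAt.sub continuousAt_const).norm.eventually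
      (lt_mem_nhds h3)
  obtain ⟨z, hz, h7, h8⟩ := ((mem_closure_iff_frequently.1
    (L.leftPt_mem_closure ⟨ht.1.trans_lt hts, hsT⟩)).and_eventually
      (h6.and (isClosed_closure.isOpen_compl.mem_nhds hpK))).exists
  exact (hA z ⟨L.hull_subset ⟨ht.1.trans hts.le, hsT⟩ hz, fun h => h8 (subset_closure h)⟩
    h7.le).2 hz

theorem leftPt_mem_trace (L : LoewnerCurve T w η K g S f) (ht : t ∈ Ico 0 T) :
    ((leftPt w K t : ℝ) : ℂ) ∈ η '' Icc 0 t := by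
  rcases ht.1.eq_or_lt with rfl | h
  · refine ⟨0, left_mem_Icc.2 le_rfl, ?_⟩
    rw [L.eta_zero ht.2, leftPt, if_pos rfl]
  by_contra hcon
  obtain ⟨r, hr, hball⟩ := Metric.isOpen_iff.1 (L.isCompact_trace ht).isClosed.isOpen_compl _ hcon
  set p := leftPt w K t with hp
  have h1 := eventually_mem_compl (L.notMem_closure_of_lt ht (x := p - r / 2) (by linarith))
  have h2 : ((p - r / 2 : ℝ) : ℂ) ∈ ball (p : ℂ) r := by
    rw [mem_ball, dist_eq_norm, ← ofReal_sub, Complex.norm_real, Real.norm_eq_abs, abs_lt]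
    constructor <;> linarith
  have := nhdsWithin_UHP_neBot (p - r / 2)
  obtain ⟨q, hq, hqb⟩ := (h1.and (nhdsWithin_le_nhds (isOpen_ball.mem_nhds h2))).exists
  have h3 := L.subset_compl_of_isPreconnected ht
    ((convex_ball (p : ℂ) r).inter convex_UHP).isPreconnected inter_subset_right
    (disjoint_left.2 fun z hz hz' => hball hz.1 hz') (p := q) ⟨hqb, hq.1⟩ hq.2
  obtain ⟨z, hz, hzb⟩ := ((mem_closure_iff_frequently.1
    (L.leftPt_mem_closure ⟨h, ht.2⟩)).and_eventually (ball_mem_nhds _ hr)).exists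
  exact (h3 ⟨hzb, L.hull_subset ht hz⟩).2 hz

theorem volume_image_leftPt (L : LoewnerCurve T w η K g S f) :
    MeasureTheory.volume (leftPt w K '' Ico 0 T) = 0 := by
  refine MeasureTheory.measure_mono_null ?_ L.null
  rintro _ ⟨t, ht, rfl⟩
  obtain ⟨r, hr, h⟩ := L.leftPt_mem_trace ht
  exact ⟨r, ⟨hr.1, hr.2.trans_lt ht.2⟩, h⟩

theorem re_g_sub_le_leftIm_sub (L : LoewnerCurve T w η K g S f) (hs : 0 ≤ s) (hst : s ≤ t)
    (ht : t < T) (hx : x < leftPt w K t) :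
    (g s x).re - (g t x).re ≤ leftIm w S s - leftIm w S t := by
  have ht' : t ∈ Ico 0 T := ⟨hs.trans hst, ht⟩
  have hs' : s ∈ Ico 0 T := ⟨hs, hst.trans_lt ht⟩
  rw [le_sub_comm]
  refine le_of_forall_lt fun y hy => ?_
  obtain ⟨x₀, hx₀, rfl⟩ := L.exists_re_g_eq ht' hy
  have hx₁ : max x₀ x < leftPt w K t := max_lt hx₀ hx
  have h1 := (L.re_g_strictMonoOn_Iio ht').monotoneOn hx₀ hx₁ (le_max_left _ _)
  have h2 := L.re_g_sub_monotoneOn hs hst ht hx hx₁ (le_max_right _ _)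
  have h3 := L.re_g_lt_leftIm hs' (hx₁.trans_le (L.leftPt_anti hs hst ht))
  simp only at h1 h2
  linarith

theorem leftIm_anti (L : LoewnerCurve T w η K g S f) (hs : 0 ≤ s) (hst : s ≤ t) (ht : t < T) :
    leftIm w S t ≤ leftIm w S s := by
  have ht' : t ∈ Ico 0 T := ⟨hs.trans hst, ht⟩
  have hs' : s ∈ Ico 0 T := ⟨hs, hst.trans_lt ht⟩
  obtain ⟨x, hx⟩ := exists_lt (leftPt w K t)
  have h1 := L.re_g_sub_le_leftIm_sub hs hst ht hx
  rw [← L.integral_re_g hs hst ht hx] at h1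
  refine sub_nonneg.1 ((intervalIntegral.integral_nonneg hst fun r hr => ?_).trans h1)
  have hr' : r ∈ Ico 0 T := ⟨hs.trans hr.1, hr.2.trans_lt ht⟩
  have h2 := L.re_g_lt_leftIm hr' (hx.trans_le (L.leftPt_anti hr'.1 hr.2 ht))
  have h3 := L.leftIm_le hr'
  have : 0 < w r - (g r x).re := by linarith
  positivity

theorem leftIm_strictAntiOn (L : LoewnerCurve T w η K g S f) :
    StrictAntiOn (leftIm w S) (Ico 0 T) := by
  intro s hs t ht hst
  obtain ⟨x, hx⟩ := exists_lt (leftPt w K t)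
  have h1 := L.re_g_sub_le_leftIm_sub hs.1 hst.le ht.2 hx
  rw [← L.integral_re_g hs.1 hst.le ht.2 hx] at h1
  refine sub_pos.1 (lt_of_lt_of_le ?_ h1)
  refine intervalIntegral.intervalIntegral_pos_of_pos_on
    ((L.continuousOn_real_field ht hx).mono ?_).intervalIntegrable (fun r hr => ?_) hst
  · rw [uIcc_of_le hst.le]
    exact Icc_subset_Icc_left hs.1
  · obtain ⟨κ, hκ, hgap⟩ := L.exists_gap ht hx
    have := hκ.trans_le (hgap r ⟨hs.1.trans hr.1.le, hr.2.le⟩)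
    positivity

/-- Where the left end moves differentiably, its speed is at least `2 / (w - c)`. -/
theorem two_le_neg_deriv_mul (L : LoewnerCurve T w η K g S f) (ht : t ∈ Ioo 0 T) {m : ℝ}
    (hm : HasDerivAt (leftIm w S) m t) : 2 ≤ -m * (w t - leftIm w S t) := by
  have ht' : t ∈ Ico 0 T := ⟨ht.1.le, ht.2⟩
  have key : ∀ x < leftPt w K t, 2 / (w t - (g t x).re) ≤ -m := by
    intro x hx
    obtain ⟨s₁, hs₁, hts₁, hs₁T⟩ := ((L.eventually_lt_leftPt ht' hx).and
      (Ioo_mem_nhdsGT ht.2)).exists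
    have hs₁' : s₁ ∈ Ico 0 T := ⟨ht.1.le.trans hts₁.le, hs₁T⟩
    have hcont := L.continuousOn_real_field hs₁' hs₁
    have h1 : Tendsto (fun s => 2 / (w s - (g s x).re)) (𝓝[>] t) (𝓝 (2 / (w t - (g t x).re))) := by
      refine (hcont t ⟨ht.1.le, hts₁.le⟩).mono_left ?_
      exact nhdsWithin_le_iff.2 (mem_of_superset (Ioo_mem_nhdsGT hts₁)
        fun r hr => ⟨ht.1.le.trans hr.1.le, hr.2.le⟩)
    have hF : HasDerivWithinAt (fun s => ∫ r in t..s, 2 / (w r - (g r x).re))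
        (2 / (w t - (g t x).re)) (Ioi t) t := by
      refine (intervalIntegral.integral_hasDerivWithinAt_right (s := Ici t) (t := Ioi t)
        (by simp) ?_ ?_).mono Ioi_subset_Ici_self
      · exact ⟨Icc t s₁, mem_of_superset (Ioo_mem_nhdsGT hts₁) Ioo_subset_Icc_self,
          (hcont.mono (Icc_subset_Icc_left ht.1.le)).aestronglyMeasurable measurableSet_Icc⟩
      · exact h1
    have hG := hm.neg.hasDerivWithinAt (s := Ioi t)
    have h2 := hasDerivWithinAt_iff_tendsto_slope.1 hF
    have h3 := hasDerivWithinAt_iff_tendsto_slope.1 hG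
    rw [sdiff_singleton_eq_self self_notMem_Ioi] at h2 h3
    refine le_of_tendsto_of_tendsto h2 h3 ?_
    filter_upwards [Ioo_mem_nhdsGT hts₁] with s hs
    have hxs : x < leftPt w K s := hs₁.trans_le (L.leftPt_anti (ht.1.le.trans hs.1.le) hs.2.le hs₁T)
    have h4 := L.re_g_sub_le_leftIm_sub ht.1.le hs.1.le (hs.2.trans hs₁T) hxs
    rw [← L.integral_re_g ht.1.le hs.1.le (hs.2.trans hs₁T) hxs] at h4
    rw [slope_def_field, slope_def_field, intervalIntegral.integral_same]
    have h5 : 0 < s - t := sub_pos.2 hs.1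
    simp only [Pi.neg_apply]
    exact div_le_div_of_nonneg_right (by linarith) h5.le
  have h6 : ∀ y < leftIm w S t, 2 ≤ -m * (w t - y) := by
    intro y hy
    obtain ⟨x, hx, rfl⟩ := L.exists_re_g_eq ht' hy
    have := L.leftIm_le ht'
    exact (div_le_iff₀ (by linarith)).1 (key x hx)
  have h7 : Tendsto (fun y => -m * (w t - y)) (𝓝[<] leftIm w S t)
      (𝓝 (-m * (w t - leftIm w S t))) :=
    ((continuous_const.mul (continuous_const.sub continuous_id)).tendsto _).mono_left
      nhdsWithin_le_nhds
  exact ge_of_tendsto h7 (eventually_mem_nhdsWithin.mono h6)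

theorem ae_differentiableAt_leftIm (L : LoewnerCurve T w η K g S f) :
    ∀ᵐ t, t ∈ Ioo 0 T → DifferentiableAt ℝ (leftIm w S) t := by
  have hmono : MonotoneOn (fun t => -leftIm w S t) (Ioo 0 T) := fun s hs t ht hst =>
    neg_le_neg (L.leftIm_anti hs.1.le hst ht.2)
  filter_upwards [hmono.ae_differentiableWithinAt_of_mem] with t h ht
  have := (h ht).differentiableAt (Ioo_mem_nhds ht.1 ht.2)
  simpa using this.neg

theorem ae_two_div_le (L : LoewnerCurve T w η K g S f) :
    ∀ᵐ t, t ∈ Ioo 0 T → leftIm w S t < w t ∧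
      2 / (w t - leftIm w S t) ≤ -deriv (leftIm w S) t := by
  filter_upwards [L.ae_differentiableAt_leftIm] with t h ht
  have h1 := L.two_le_neg_deriv_mul ht (h ht).hasDerivAt
  have h2 : leftIm w S t < w t := by
    refine lt_of_le_of_ne (L.leftIm_le ⟨ht.1.le, ht.2⟩) fun h => ?_
    rw [h, sub_self, mul_zero] at h1
    linarith
  exact ⟨h2, (div_le_iff₀ (sub_pos.2 h2)).2 h1⟩

/-- As long as the driving function stays to the right of `m + δ`, a point starting to the left
of `m` stays there, and its height decays at most exponentially. -/
theorem re_g_le_and_le_im_g (L : LoewnerCurve T w η K g S f) (hs : 0 ≤ s) (hst : s ≤ t)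
    (ht : t < T) {z : ℂ} (hz : z ∈ UHP \ K t) {m δ : ℝ} (hδ : 0 < δ) (hm : (g s z).re ≤ m)
    (hw : ∀ u ∈ Icc s t, m + δ ≤ w u) :
    (g s z).im * Real.exp (-(4 / δ ^ 2) * (t - s)) ≤ (g t z).im := by
  have ht' : t ∈ Ico 0 T := ⟨hs.trans hst, ht⟩
  have hcont : ContinuousOn (fun r => g r z) (Icc s t) :=
    (L.continuousOn_g ht' hz).mono (Icc_subset_Icc_left hs)
  have hmem : ∀ u ∈ Icc s t, z ∈ UHP \ K u := fun u hu =>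
    L.compl_subset (hs.trans hu.1) hu.2 ht hz
  have him : ∀ u ∈ Icc s t, 0 < (g u z).im := fun u hu =>
    L.g_mem ⟨hs.trans hu.1, hu.2.trans_lt ht⟩ (hmem u hu)
  have hder : ∀ u ∈ Ico s t, HasDerivWithinAt (fun r => g r z) (2 / (g u z - w u)) (Ici u) u :=
    fun u hu => L.hasDerivWithinAt_g ⟨hs.trans hu.1, hu.2.trans ht⟩ (hmem u ⟨hu.1, hu.2.le⟩)
  have hnorm : ∀ u ∈ Icc s t, 0 < normSq (g u z - w u) := fun u hu =>
    normSq_pos.2 (L.g_sub_w_ne_zero ⟨hs.trans hu.1, hu.2.trans_lt ht⟩ (hmem u hu) _)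
  have hre : ∀ u ∈ Icc s t, (g u z).re ≤ m := by
    refine image_le_of_deriv_right_lt_deriv_boundary'
      (f' := fun u => (2 / (g u z - w u)).re) (B := fun _ => m) (B' := fun _ => 0)
      (Complex.continuous_re.comp_continuousOn hcont)
      (fun u hu => Complex.reCLM.hasFDerivAt.comp_hasDerivWithinAt u (hder u hu)) hm
      continuousOn_const (fun u _ => hasDerivWithinAt_const _ _ _) fun u hu hum => ?_
    replace hum : (g u z).re = m := hum
    have h1 := hnorm u ⟨hu.1, hu.2.le⟩
    have h2 := hw u ⟨hu.1, hu.2.le⟩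
    have h3 : (2 / (g u z - w u)).re = 2 * ((g u z).re - w u) / normSq (g u z - w u) := by
      rw [Complex.div_re]
      simp
    rw [h3]
    exact div_neg_of_neg_of_pos (by linarith) h1
  have h := image_le_of_deriv_right_lt_deriv_boundary' (a := s) (b := t)
      (f := fun u => -(g u z).im) (f' := fun u => -(2 / (g u z - w u)).im)
      (B := fun u => -((g s z).im * Real.exp (-(4 / δ ^ 2) * (u - s))))
      (B' := fun u => -((g s z).im * (Real.exp (-(4 / δ ^ 2) * (u - s)) * -(4 / δ ^ 2))))
      (Complex.continuous_im.comp_continuousOn hcont).neg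
      (fun u hu => (Complex.imCLM.hasFDerivAt.comp_hasDerivWithinAt u (hder u hu)).neg) (by simp)
      (by fun_prop) (fun u _ => ?_) (fun u hu hum => ?_) (right_mem_Icc.2 hst)
  · exact neg_le_neg_iff.1 h
  · have h1 : HasDerivAt (fun v => -(4 / δ ^ 2) * (v - s)) (-(4 / δ ^ 2)) u := by
      simpa using ((hasDerivAt_id u).sub_const s).const_mul (-(4 / δ ^ 2))
    exact (h1.exp.const_mul _).neg.hasDerivWithinAt
  · have hu' : u ∈ Icc s t := ⟨hu.1, hu.2.le⟩
    have h1 := hnorm u hu'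
    have h2 := hw u hu'
    have h3 : -(2 / (g u z - w u)).im = 2 * (g u z).im / normSq (g u z - w u) := by
      rw [Complex.div_im]
      simp
    have h4 : δ ^ 2 ≤ normSq (g u z - w u) := by
      rw [normSq_apply, sub_re, ofReal_re]
      have := hre u hu'
      nlinarith [mul_self_nonneg (g u z - w u).im]
    rw [← mul_assoc, mul_neg, neg_neg, h3, ← neg_inj.1 hum]
    have h5 := him u hu'
    rw [mul_div_assoc', div_lt_div_iff₀ h1 (by positivity)]
    nlinarith [mul_pos h5 (pow_pos hδ 2), mul_le_mul_of_nonneg_left h4 h5.le]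

/-- Points whose image stays away from the driving function are not swallowed. -/
theorem mem_compl_of_re_g_le (L : LoewnerCurve T w η K g S f) (hs : 0 ≤ s) (hst : s ≤ t)
    (ht : t < T) {z : ℂ} (hz : z ∈ UHP \ K s) {m δ : ℝ} (hδ : 0 < δ) (hm : (g s z).re ≤ m)
    (hw : ∀ u ∈ Icc s t, m + δ ≤ w u) : z ∈ UHP \ K t := by
  have h0 : 0 < (g s z).im := L.g_mem ⟨hs, hst.trans_lt ht⟩ hz
  set Y := (g s z).im * Real.exp (-(4 / δ ^ 2) * (t - s)) with hY
  have hYpos : 0 < Y := by positivity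
  set h := (Y / 4) ^ 2 / 2 with hh
  have hhpos : 0 < h := by positivity
  have hsq : 2 * √(2 * h) < Y := by
    rw [show 2 * h = (Y / 4) ^ 2 by rw [hh]; ring, Real.sqrt_sq (by positivity)]
    linarith
  have hstep : ∀ n : ℕ, z ∈ UHP \ K (min t (s + n * h)) := by
    intro n
    induction n with
    | zero => simpa [hst] using hz
    | succ n ih =>
      set u := min t (s + n * h) with hu
      set v := min t (s + (n + 1 : ℕ) * h) with hv
      have hsu : s ≤ u := le_min hst (by linarith [mul_nonneg n.cast_nonneg hhpos.le])
      have hut : u ≤ t := min_le_left _ _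
      have hvt : v ≤ t := min_le_left _ _
      have huv : u ≤ v := min_le_min_left _ (by push_cast; linarith)
      have hvu : v ≤ u + h := by
        rw [hv, hu, ← min_add_add_right]
        refine min_le_min (by linarith) (by push_cast; linarith)
      rcases huv.eq_or_lt with h1 | h1
      · rwa [← h1]
      refine (L.survive (hs.trans hsu) h1 (hvt.trans_lt ht) ih ?_).1
      have h2 := L.re_g_le_and_le_im_g hs hsu (hut.trans_lt ht) ih hδ hm
        fun r hr => hw r ⟨hr.1, hr.2.trans hut⟩
      have h3 : Y ≤ (g s z).im * Real.exp (-(4 / δ ^ 2) * (u - s)) := by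
        rw [hY, neg_mul, neg_mul]
        gcongr
      have h4 : √(2 * (v - u)) ≤ √(2 * h) := Real.sqrt_le_sqrt (by linarith)
      linarith
  obtain ⟨n, hn⟩ := exists_nat_ge ((t - s) / h)
  rw [div_le_iff₀ hhpos] at hn
  have := hstep n
  rwa [min_eq_left (by linarith)] at this

/-- When the leftmost real point jumps at time `t`, the driving function sits at the left end. -/
theorem le_leftIm_of_forall_lt (L : LoewnerCurve T w η K g S f) (ht : t ∈ Ioo 0 T)
    (h : ∀ r ∈ Ico 0 t, leftPt w K t < leftPt w K r) : w t ≤ leftIm w S t := by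
  have ht' : t ∈ Ico 0 T := ⟨ht.1.le, ht.2⟩
  by_contra! hcon
  set δ := (w t - leftIm w S t) / 4 with hδ'
  have hδ : 0 < δ := by rw [hδ']; linarith
  have hwc : ∀ᶠ r in 𝓝[<] t, ∀ u ∈ Icc r t, w t - δ < w u := by
    have h1 : ∀ᶠ r in 𝓝[Icc 0 t] t, w t - δ < w r :=
      (L.continuousOn_w ht' t (right_mem_Icc.2 ht.1.le)).eventually (lt_mem_nhds (by linarith))
    rw [nhdsWithin_Icc_eq_nhdsLE ht.1] at h1
    obtain ⟨l, hl, hsub⟩ := (mem_nhdsLE_iff_exists_Ioc_subset' ht.1).1 h1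
    filter_upwards [Ioo_mem_nhdsLT hl] with r hr u hu
    exact hsub ⟨hr.1.trans_le hu.1, hu.2⟩
  have hkey : ∀ᶠ r in 𝓝[<] t, w t - 2 * δ ≤ (g r (leftPt w K t)).re := by
    filter_upwards [hwc, Ioo_mem_nhdsLT ht.1] with r hr hrt
    by_contra! hlt
    have hr' : r ∈ Ico 0 T := ⟨hrt.1.le, hrt.2.trans ht.2⟩
    have h1 := L.notMem_closure_of_lt hr' (h r ⟨hrt.1.le, hrt.2⟩)
    have h2 : ∀ᶠ z in 𝓝[UHP] ((leftPt w K t : ℝ) : ℂ), z ∉ K t := by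
      filter_upwards [eventually_mem_compl h1, ((Complex.continuous_re.tendsto _).comp
        (L.tendsto_g_ofReal hr' h1)).eventually (gt_mem_nhds hlt)] with z hz hz'
      exact (L.mem_compl_of_re_g_le hrt.1.le hrt.2.le ht.2 hz hδ (le_of_lt hz')
        fun u hu => by linarith [hr u hu]).2
    obtain ⟨z, hz, hz'⟩ := ((mem_closure_iff_frequently.1
      (L.leftPt_mem_closure ht)).and_eventually (eventually_nhdsWithin_iff.1 h2)).exists
    exact hz' (L.hull_subset ht' hz) hz
  have hx : leftPt w K t - δ < leftPt w K t := by linarith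
  have h1 : Tendsto (fun r => (g r ((leftPt w K t - δ : ℝ) : ℂ)).re) (𝓝[<] t)
      (𝓝 (g t ((leftPt w K t - δ : ℝ) : ℂ)).re) := by
    refine (L.re_g_continuousOn ht' hx t (right_mem_Icc.2 ht.1.le)).mono_left ?_
    rw [nhdsWithin_Icc_eq_nhdsLE ht.1]
    exact nhdsWithin_mono _ Iio_subset_Iic_self
  have h2 : w t - 3 * δ ≤ (g t ((leftPt w K t - δ : ℝ) : ℂ)).re := by
    refine ge_of_tendsto h1 ?_
    filter_upwards [hkey, Ioo_mem_nhdsLT ht.1] with r hr hrt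
    have := L.re_g_sub_le ⟨hrt.1.le, hrt.2.trans ht.2⟩ hx.le (h r ⟨hrt.1.le, hrt.2⟩)
    linarith
  have h3 := L.re_g_lt_leftIm ht' hx
  linarith

theorem monotoneOn_neg_leftIm (L : LoewnerCurve T w η K g S f) (hs : 0 ≤ s) (hst : s ≤ t)
    (ht : t < T) : MonotoneOn (fun r => -leftIm w S r) (uIcc s t) := by
  rw [uIcc_of_le hst]
  exact fun a ha b hb hab => neg_le_neg (L.leftIm_anti (hs.trans ha.1) hab (hb.2.trans_lt ht))

theorem ae_norm_le (L : LoewnerCurve T w η K g S f) (hs : 0 ≤ s) (hst : s ≤ t) (ht : t < T) :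
    ∀ᵐ r ∂MeasureTheory.volume.restrict (uIoc s t), leftIm w S r < w r ∧
      2 / (w r - leftIm w S r) ≤ deriv (fun r => -leftIm w S r) r := by
  rw [MeasureTheory.ae_restrict_iff' measurableSet_uIoc, uIoc_of_le hst]
  filter_upwards [L.ae_two_div_le] with r h hr
  rw [deriv.fun_neg]
  exact h ⟨hs.trans_lt hr.1, hr.2.trans_lt ht⟩

theorem intervalIntegrable_leftIm (L : LoewnerCurve T w η K g S f) (hs : 0 ≤ s) (hst : s ≤ t)
    (ht : t < T) :
    IntervalIntegrable (fun r => 2 / (w r - leftIm w S r)) MeasureTheory.volume s t := by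
  refine (L.monotoneOn_neg_leftIm hs hst ht).intervalIntegrable_deriv.mono_fun' ?_ ?_
  · have hsub : uIoc s t ⊆ Icc 0 t := by
      rw [uIoc_of_le hst]
      exact fun r hr => ⟨hs.trans hr.1.le, hr.2⟩
    have h1 : AEMeasurable (leftIm w S) (MeasureTheory.volume.restrict (uIoc s t)) :=
      aemeasurable_restrict_of_antitoneOn measurableSet_uIoc fun a ha b hb hab =>
        L.leftIm_anti (hsub ha).1 hab ((hsub hb).2.trans_lt ht)
    have h2 : AEMeasurable w (MeasureTheory.volume.restrict (uIoc s t)) :=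
      ((L.continuousOn_w ⟨hs.trans hst, ht⟩).mono hsub).aemeasurable measurableSet_uIoc
    exact ((h2.sub h1).const_div 2).aestronglyMeasurable
  · filter_upwards [L.ae_norm_le hs hst ht] with r hr
    have := sub_pos.2 hr.1
    rw [Real.norm_of_nonneg (by positivity)]
    exact hr.2

theorem integral_le_leftIm_sub (L : LoewnerCurve T w η K g S f) (hs : 0 ≤ s) (hst : s ≤ t)
    (ht : t < T) : ∫ r in s..t, 2 / (w r - leftIm w S r) ≤ leftIm w S s - leftIm w S t := by
  have hmono := L.monotoneOn_neg_leftIm hs hst ht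
  have h1 := hmono.intervalIntegral_deriv_mem_uIcc
  rw [uIcc_of_le (by linarith [L.leftIm_anti hs hst ht])] at h1
  have h2 := L.ae_norm_le hs hst ht
  rw [uIoc_of_le hst, MeasureTheory.restrict_Ioc_eq_restrict_Icc] at h2
  have h3 := intervalIntegral.integral_mono_ae_restrict hst
    (L.intervalIntegrable_leftIm hs hst ht) hmono.intervalIntegrable_deriv
    (h2.mono fun r hr => hr.2)
  linarith [h1.2]

theorem leftIm_sub_le (L : LoewnerCurve T w η K g S f) (hs : 0 ≤ s) (hst : s ≤ t) (ht : t < T) :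
    leftIm w S s - leftIm w S t ≤
      leftPt w K s - leftPt w K t + ∫ r in s..t, 2 / (w r - leftIm w S r) := by
  have hs' : s ∈ Ico 0 T := ⟨hs, hst.trans_lt ht⟩
  have ht' : t ∈ Ico 0 T := ⟨hs.trans hst, ht⟩
  have key : ∀ x < leftPt w K t, x ≤ leftPt w K s +
      (∫ r in s..t, 2 / (w r - leftIm w S r)) - (leftIm w S s - leftIm w S t) := by
    intro x hx
    have hxs := hx.trans_le (L.leftPt_anti hs hst ht)
    have h1 : leftIm w S s ≤ (g s x).re + (leftPt w K s - x) := by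
      refine le_of_forall_lt fun y hy => ?_
      obtain ⟨x₀, hx₀, rfl⟩ := L.exists_re_g_eq hs' hy
      have hx₁ : max x₀ x < leftPt w K s := max_lt hx₀ hxs
      have h2 := (L.re_g_strictMonoOn_Iio hs').monotoneOn hx₀ hx₁ (le_max_left _ _)
      have h3 := L.re_g_sub_le hs' (le_max_right x₀ x) hx₁
      linarith
    have h2 := L.re_g_lt_leftIm ht' hx
    have h3 := L.integral_re_g hs hst ht hx
    have h4 := L.ae_norm_le hs hst ht
    rw [uIoc_of_le hst, MeasureTheory.restrict_Ioc_eq_restrict_Icc] at h4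
    have h5 : ∫ r in s..t, 2 / (w r - (g r x).re) ≤ ∫ r in s..t, 2 / (w r - leftIm w S r) := by
      refine intervalIntegral.integral_mono_ae_restrict hst
        ((L.continuousOn_real_field ht' hx).mono ?_).intervalIntegrable
        (L.intervalIntegrable_leftIm hs hst ht) ?_
      · rw [uIcc_of_le hst]
        exact Icc_subset_Icc_left hs
      · filter_upwards [h4, MeasureTheory.ae_restrict_mem measurableSet_Icc] with r hr hrm
        have h6 := sub_pos.2 hr.1
        have h7 := L.re_g_lt_leftIm ⟨hs.trans hrm.1, hrm.2.trans_lt ht⟩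
          (hx.trans_le (L.leftPt_anti (hs.trans hrm.1) hrm.2 ht))
        gcongr
    linarith
  have := le_of_forall_lt_imp_le_of_dense key
  linarith

theorem continuousOn_integral_leftIm (L : LoewnerCurve T w η K g S f) (ht : t ∈ Ico 0 T) :
    ContinuousOn (fun s => ∫ r in (0 : ℝ)..s, 2 / (w r - leftIm w S r)) (Icc 0 t) := by
  rw [← uIcc_of_le ht.1]
  exact intervalIntegral.continuousOn_primitive_interval'
    (L.intervalIntegrable_leftIm le_rfl ht.1 ht.2) left_mem_uIcc

theorem integral_leftIm_add (L : LoewnerCurve T w η K g S f) (hs : 0 ≤ s) (hst : s ≤ t)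
    (ht : t < T) : (∫ r in (0 : ℝ)..s, 2 / (w r - leftIm w S r)) +
      ∫ r in s..t, 2 / (w r - leftIm w S r) = ∫ r in (0 : ℝ)..t, 2 / (w r - leftIm w S r) :=
  intervalIntegral.integral_add_adjacent_intervals
    (L.intervalIntegrable_leftIm le_rfl hs (hst.trans_lt ht))
    (L.intervalIntegrable_leftIm hs hst ht)

theorem eventually_lt_leftIm (L : LoewnerCurve T w η K g S f) (ht : t ∈ Ico 0 T)
    (hy : y < leftIm w S t) : ∀ᶠ s in 𝓝[>] t, y < leftIm w S s := by
  obtain ⟨y', h1, h2⟩ := exists_between hy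
  obtain ⟨x, hx, rfl⟩ := L.exists_re_g_eq ht h2
  obtain ⟨s₁, hs₁, hts₁, hs₁T⟩ := ((L.eventually_lt_leftPt ht hx).and
    (Ioo_mem_nhdsGT ht.2)).exists
  have h3 := L.re_g_continuousOn ⟨ht.1.trans hts₁.le, hs₁T⟩ hs₁ t ⟨ht.1, hts₁.le⟩
  have h4 : ∀ᶠ s in 𝓝[>] t, s ∈ Icc 0 s₁ :=
    mem_of_superset (Ioo_mem_nhdsGT hts₁) fun r hr => ⟨ht.1.trans hr.1.le, hr.2.le⟩
  filter_upwards [h4, (h3.mono_left (nhdsWithin_le_iff.2 h4)).eventually (lt_mem_nhds h1)]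
    with s hs hys
  exact hys.trans (L.re_g_lt_leftIm ⟨hs.1, hs.2.trans_lt hs₁T⟩
    (hs₁.trans_le (L.leftPt_anti hs.1 hs.2 hs₁T)))

theorem eventually_leftIm_lt (L : LoewnerCurve T w η K g S f) (ht : t ∈ Ioo 0 T)
    (hy : leftIm w S t < y) : ∀ᶠ s in 𝓝[<] t, leftIm w S s < y := by
  have ht' : t ∈ Ico 0 T := ⟨ht.1.le, ht.2⟩
  have hsub : 𝓝[<] t ≤ 𝓝[Icc 0 t] t := by
    rw [nhdsWithin_Icc_eq_nhdsLE ht.1]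
    exact nhdsWithin_mono _ Iio_subset_Iic_self
  by_cases h : ∀ r ∈ Ico 0 t, leftPt w K t < leftPt w K r
  · have h1 := (L.le_leftIm_of_forall_lt ht h).trans_lt hy
    filter_upwards [((L.continuousOn_w ht' t (right_mem_Icc.2 ht.1.le)).mono_left hsub).eventually
      (gt_mem_nhds h1), Ioo_mem_nhdsLT ht.1] with s hs hst
    exact (L.leftIm_le ⟨hst.1.le, hst.2.trans ht.2⟩).trans_lt hs
  · push Not at h
    obtain ⟨r₀, hr₀, h1⟩ := h
    have h2 : (∫ r in (0 : ℝ)..t, 2 / (w r - leftIm w S r)) - (y - leftIm w S t) <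
        ∫ r in (0 : ℝ)..t, 2 / (w r - leftIm w S r) := by linarith
    filter_upwards [((L.continuousOn_integral_leftIm ht' t (right_mem_Icc.2 ht.1.le)).mono_left
      hsub).eventually (lt_mem_nhds h2), Ioo_mem_nhdsLT hr₀.2] with s hs hst
    have hs0 := hr₀.1.trans hst.1.le
    have h3 := L.leftIm_sub_le hs0 hst.2.le ht.2
    have h4 := L.integral_leftIm_add hs0 hst.2.le ht.2
    have h5 := L.leftPt_anti hr₀.1 hst.1.le (hst.2.trans ht.2)
    linarith

theorem continuousOn_leftIm (L : LoewnerCurve T w η K g S f) :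
    ContinuousOn (leftIm w S) (Ico 0 T) := by
  intro t ht
  refine tendsto_order.2 ⟨fun y hy => ?_, fun y hy => ?_⟩
  · filter_upwards [eventually_nhdsWithin_iff.1 (L.eventually_lt_leftIm ht hy) |>.filter_mono
      nhdsWithin_le_nhds, self_mem_nhdsWithin] with s h1 hs
    rcases lt_or_ge t s with h | h
    · exact h1 h
    · exact hy.trans_le (L.leftIm_anti hs.1 h ht.2)
  · rcases ht.1.eq_or_lt with rfl | h0
    · filter_upwards [self_mem_nhdsWithin] with s hs
      exact (L.leftIm_anti le_rfl hs.1 hs.2).trans_lt hy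
    · filter_upwards [eventually_nhdsWithin_iff.1 (L.eventually_leftIm_lt ⟨h0, ht.2⟩ hy)
        |>.filter_mono nhdsWithin_le_nhds, self_mem_nhdsWithin] with s h1 hs
      rcases lt_or_ge s t with h | h
      · exact h1 h
      · exact (L.leftIm_anti ht.1 h hs.2).trans_lt hy

/-- The left end is absolutely continuous and solves the Loewner equation. -/
theorem leftIm_sub_eq (L : LoewnerCurve T w η K g S f) (hs : 0 ≤ s) (hst : s ≤ t) (ht : t < T) :
    leftIm w S t - leftIm w S s = ∫ r in s..t, 2 / (leftIm w S r - w r) := by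
  suffices h : ∀ t ∈ Ico 0 T, leftIm w S 0 - leftIm w S t =
      ∫ r in (0 : ℝ)..t, 2 / (w r - leftIm w S r) by
    have h1 := h s ⟨hs, hst.trans_lt ht⟩
    have h2 := h t ⟨hs.trans hst, ht⟩
    have h3 := L.integral_leftIm_add hs hst ht
    have h4 : ∫ r in s..t, 2 / (leftIm w S r - w r) = -∫ r in s..t, 2 / (w r - leftIm w S r) := by
      rw [← intervalIntegral.integral_neg]
      refine intervalIntegral.integral_congr fun r _ => ?_
      rw [← neg_sub, div_neg]
    linarith
  intro t ht
  set v : ℝ → ℝ := fun s => leftIm w S s + ∫ r in (0 : ℝ)..s, 2 / (w r - leftIm w S r) with hv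
  have hsub : Icc 0 t ⊆ Ico 0 T := fun r hr => ⟨hr.1, hr.2.trans_lt ht.2⟩
  have hcont : ContinuousOn v (Icc 0 t) :=
    (L.continuousOn_leftIm.mono hsub).add (L.continuousOn_integral_leftIm ht)
  have hv₁ : ∀ a ∈ Icc 0 t, ∀ b ∈ Icc 0 t, a ≤ b →
      0 ≤ v a - v b ∧ v a - v b ≤ leftPt w K a - leftPt w K b := by
    intro a ha b hb hab
    have h1 := L.integral_le_leftIm_sub ha.1 hab (hsub hb).2
    have h2 := L.leftIm_sub_le ha.1 hab (hsub hb).2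
    have h3 := L.integral_leftIm_add ha.1 hab (hsub hb).2
    simp only [hv]
    constructor <;> linarith
  have hdist : ∀ a ∈ Icc 0 t, ∀ b ∈ Icc 0 t, |v a - v b| ≤ |leftPt w K a - leftPt w K b| := by
    intro a ha b hb
    rcases le_total a b with h | h
    · obtain ⟨h1, h2⟩ := hv₁ a ha b hb h
      exact abs_le_abs_of_nonneg h1 h2
    · obtain ⟨h1, h2⟩ := hv₁ b hb a ha h
      rw [abs_sub_comm (v a), abs_sub_comm (leftPt w K a)]
      exact abs_le_abs_of_nonneg h1 h2
  set A := leftPt w K '' Icc 0 t with hA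
  have hA0 : MeasureTheory.volume A = 0 :=
    MeasureTheory.measure_mono_null (image_mono hsub) L.volume_image_leftPt
  set V : ℝ → ℝ := fun a => v (Function.invFunOn (leftPt w K) (Icc 0 t) a) with hV
  have hVa : ∀ a ∈ Icc 0 t, V (leftPt w K a) = v a := by
    intro a ha
    have h1 : leftPt w K a ∈ A := mem_image_of_mem _ ha
    have h2 := hdist _ (Function.invFunOn_mem h1) a ha
    rw [Function.invFunOn_eq h1, sub_self, abs_zero] at h2
    exact sub_eq_zero.1 (abs_nonpos_iff.1 h2)
  have hlip : LipschitzOnWith 1 V A := by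
    refine LipschitzOnWith.of_dist_le_mul ?_
    rintro _ ⟨a, ha, rfl⟩ _ ⟨b, hb, rfl⟩
    rw [hVa a ha, hVa b hb, NNReal.coe_one, one_mul, Real.dist_eq, Real.dist_eq]
    exact hdist a ha b hb
  have hnull : MeasureTheory.volume (v '' Icc 0 t) = 0 := by
    have h1 := hlip.hausdorffMeasure_image_le zero_le_one
    rw [MeasureTheory.hausdorffMeasure_real, hA0, mul_zero, hA, image_image] at h1
    rw [← nonpos_iff_eq_zero]
    refine le_trans (MeasureTheory.measure_mono ?_) h1
    rintro _ ⟨a, ha, rfl⟩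
    exact ⟨a, ha, hVa a ha⟩
  have hle : v 0 ≤ v t := by
    by_contra! hlt
    have h1 := MeasureTheory.measure_mono_null (intermediate_value_Icc' ht.1 hcont) hnull
    rw [Real.volume_Icc, ENNReal.ofReal_eq_zero] at h1
    linarith
  have h1 := (hv₁ 0 (left_mem_Icc.2 ht.1) t (right_mem_Icc.2 ht.1) ht.1).1
  have h2 : v 0 = v t := by linarith
  simp only [hv, intervalIntegral.integral_same, add_zero] at h2
  linarith

end LoewnerCurve

/-- The reflection `z ↦ -conj z` of the plane across the imaginary axis. -/
def mirror : ℂ ≃ₗᵢ[ℝ] ℂ := Complex.conjLIE.trans (LinearIsometryEquiv.neg ℝ)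

theorem mirror_apply (z : ℂ) : mirror z = -(starRingEnd ℂ) z := rfl

@[simp] theorem mirror_mirror (z : ℂ) : mirror (mirror z) = z := by simp [mirror_apply]

@[simp] theorem mirror_im (z : ℂ) : (mirror z).im = z.im := by simp [mirror_apply]

@[simp] theorem mirror_ofReal (x : ℝ) : mirror (x : ℂ) = ((-x : ℝ) : ℂ) := by simp [mirror_apply]

theorem mirror_conj (z : ℂ) : mirror ((starRingEnd ℂ) z) = (starRingEnd ℂ) (mirror z) := by
  simp [mirror_apply]

theorem image_mirror (A : Set ℂ) : mirror '' A = mirror ⁻¹' A :=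
  congrFun (image_eq_preimage_of_inverse mirror_mirror mirror_mirror) A

theorem closure_preimage_mirror (A : Set ℂ) : closure (mirror ⁻¹' A) = mirror ⁻¹' closure A :=
  (mirror.toHomeomorph.preimage_closure A).symm

theorem mirror_preimage_UHP : mirror ⁻¹' UHP = UHP := by
  ext z
  simp [UHP]

theorem tendsto_mirror_cobounded : Tendsto mirror (cobounded ℂ) (cobounded ℂ) :=
  mirror.isometry.antilipschitz.tendsto_cobounded

theorem DifferentiableAt.mirror_comp_mirror {g : ℂ → ℂ} {z : ℂ}
    (hg : DifferentiableAt ℂ g (mirror z)) :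
    DifferentiableAt ℂ (fun z => mirror (g (mirror z))) z := by
  have h1 : DifferentiableAt ℂ (fun u => g (-u)) ((starRingEnd ℂ) z) :=
    DifferentiableAt.comp ((starRingEnd ℂ) z) (g := g) (f := fun u => -u) hg
      differentiableAt_id.neg
  have h2 := (h1.conj_conj).neg
  simpa [Function.comp_def, mirror_apply] using h2

theorem DifferentiableOn.mirror_comp_mirror {g : ℂ → ℂ} {U : Set ℂ} (hU : IsOpen U)
    (hg : DifferentiableOn ℂ g U) :
    DifferentiableOn ℂ (fun z => mirror (g (mirror z))) (mirror ⁻¹' U) := fun _ hz =>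
  (hg.differentiableAt (hU.mem_nhds hz)).mirror_comp_mirror.differentiableWithinAt

theorem Set.BijOn.mirror_comp_mirror {g : ℂ → ℂ} {U V : Set ℂ} (hg : BijOn g U V) :
    BijOn (fun z => mirror (g (mirror z))) (mirror ⁻¹' U) (mirror ⁻¹' V) := by
  refine ⟨fun z hz => ?_, fun z hz u hu h => ?_, fun z hz => ?_⟩
  · simpa using hg.mapsTo hz
  · exact mirror.injective (hg.injOn hz hu (mirror.injective h))
  · obtain ⟨u, hu, h⟩ := hg.surjOn hz
    exact ⟨mirror u, by simpa using hu, by simp [h]⟩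

theorem mem_Kdoub {K : Set ℂ} {z : ℂ} :
    z ∈ Kdoub K ↔ z ∈ closure K ∨ (starRingEnd ℂ) z ∈ closure K := by
  refine or_congr_right ⟨?_, fun h => ⟨_, h, Complex.conj_conj z⟩⟩
  rintro ⟨u, hu, rfl⟩
  rwa [Complex.conj_conj]

theorem Kdoub_preimage_mirror (K : Set ℂ) : Kdoub (mirror ⁻¹' K) = mirror ⁻¹' Kdoub K := by
  ext z
  rw [mem_preimage, mem_Kdoub, mem_Kdoub, closure_preimage_mirror, mem_preimage, mem_preimage,
    mirror_conj]

theorem real_closure_preimage_mirror (K : Set ℂ) :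
    {x : ℝ | (x : ℂ) ∈ closure (mirror ⁻¹' K)} = Neg.neg ⁻¹' {x : ℝ | (x : ℂ) ∈ closure K} := by
  ext x
  rw [Set.mem_ofPred_eq, closure_preimage_mirror, mem_preimage, mirror_ofReal]
  rfl

theorem aK_preimage_mirror (K : Set ℂ) : aK (mirror ⁻¹' K) = -bK K := by
  rw [aK, bK, real_closure_preimage_mirror, Real.sInf_def, Set.neg_preimage, neg_neg]

theorem bK_preimage_mirror (K : Set ℂ) : bK (mirror ⁻¹' K) = -aK K := by
  rw [aK, bK, real_closure_preimage_mirror, Real.sInf_def, Set.neg_preimage, neg_neg]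

theorem seg_preimage_mirror (K : Set ℂ) : seg (mirror ⁻¹' K) = mirror ⁻¹' seg K := by
  ext z
  rw [seg, seg, aK_preimage_mirror, bK_preimage_mirror]
  constructor
  · rintro ⟨x, hx, rfl⟩
    exact ⟨-x, ⟨le_neg.1 hx.2, neg_le.1 hx.1⟩, (mirror_ofReal x).symm⟩
  · rintro ⟨x, hx, h⟩
    refine ⟨-x, ⟨neg_le_neg hx.2, neg_le_neg hx.1⟩, ?_⟩
    rw [← mirror_mirror z, ← h, mirror_ofReal]

theorem IsHullMap.isOpen_compl {K : Set ℂ} {g : ℂ → ℂ} {S : Set ℝ} (H : IsHullMap K g S) :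
    IsOpen (UHP \ K) := by
  have : UHP \ K = UHP \ closure K := by
    ext z
    exact and_congr_right fun hz => not_congr
      ⟨fun h => subset_closure h, fun h => H.relClosed z h hz⟩
  rw [this]
  exact isOpen_UHP.sdiff isClosed_closure

theorem IsHullMap.reflect {K : Set ℂ} {g : ℂ → ℂ} {S : Set ℝ} (H : IsHullMap K g S) :
    IsHullMap (mirror ⁻¹' K) (fun z => mirror (g (mirror z))) (Neg.neg ⁻¹' S) := by
  have hne : (mirror ⁻¹' K).Nonempty → K.Nonempty := fun ⟨z, hz⟩ => ⟨_, hz⟩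
  have hcompl : UHP \ mirror ⁻¹' K = mirror ⁻¹' (UHP \ K) := by
    rw [preimage_sdiff, mirror_preimage_UHP]
  have hKd : ∀ z : ℂ, z ∉ Kdoub (mirror ⁻¹' K) → mirror z ∉ Kdoub K := by
    intro z hz
    rwa [Kdoub_preimage_mirror] at hz
  refine ⟨?_, ?_, ?_, ?_, ?_, ?_, ?_, ?_, ?_, ?_, ?_⟩
  · rw [← mirror_preimage_UHP]
    exact preimage_mono H.subset_UHP
  · rw [← image_mirror]
    exact mirror.lipschitz.isBounded_image H.bounded
  · intro z hz h0
    rw [closure_preimage_mirror] at hz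
    exact H.relClosed _ hz (by rwa [mirror_im])
  · rw [hcompl]
    exact H.holo.mirror_comp_mirror H.isOpen_compl
  · rw [hcompl]
    conv_rhs => rw [← mirror_preimage_UHP]
    exact H.bij.mirror_comp_mirror
  · have h1 := (mirror.continuous.tendsto 0).comp (H.hydro.comp tendsto_mirror_cobounded)
    rw [map_zero] at h1
    refine h1.congr fun z => ?_
    simp [map_sub]
  · exact (Homeomorph.neg ℝ).isClosedEmbedding.isCompact_preimage H.compactS
  · intro h
    have h1 := (H.ext_holo (hne h)).mirror_comp_mirror (isClosed_Kdoub K).isOpen_compl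
    refine h1.mono fun z hz => hKd z hz
  · intro h x hx
    rw [mirror_im, mirror_ofReal]
    refine H.real_vals (hne h) _ ?_
    rw [← mirror_ofReal]
    exact hKd _ hx
  · intro h z hz
    rw [mirror_conj, H.conj_symm (hne h) _ (hKd z hz), mirror_conj]
  · intro h
    have h1 := (H.extBij (hne h)).mirror_comp_mirror
    convert h1 using 1
    · ext z
      rw [Set.mem_ofPred_eq, Kdoub_preimage_mirror, seg_preimage_mirror]
      rfl
    · ext z
      constructor
      · intro hz s hs h
        refine hz (-s) (by simpa using hs) ?_
        rw [← mirror_ofReal, ← h, mirror_mirror]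
      · rintro hz s hs rfl
        exact hz (-s) hs (mirror_ofReal s)

namespace LoewnerCurve

variable {T : ℝ} {w : ℝ → ℝ} {η : ℝ → ℂ} {K : ℝ → Set ℂ} {g : ℝ → ℂ → ℂ}
    {S : ℝ → Set ℝ} {f : ℝ → ℂ → ℂ}

/-- The mirror image of a Loewner curve is a Loewner curve. -/
theorem reflect (L : LoewnerCurve T w η K g S f) :
    LoewnerCurve T (fun t => -w t) (fun t => mirror (η t)) (fun t => mirror ⁻¹' K t)
      (fun t z => mirror (g t (mirror z))) (fun t => Neg.neg ⁻¹' S t)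
      (fun t z => mirror (f t (mirror z))) := by
  have hcompl : ∀ t, UHP \ mirror ⁻¹' K t = mirror ⁻¹' (UHP \ K t) := fun t => by
    rw [preimage_sdiff, mirror_preimage_UHP]
  have himage : ∀ A : Set ℝ, (fun t => mirror (η t)) '' A = mirror ⁻¹' (η '' A) :=
    fun A => by rw [← image_mirror, image_image]
  refine ⟨L.w_cont.neg, mirror.continuous.comp_continuousOn L.η_cont, ?_, ?_, ?_, ?_, ?_,
    ?_, ?_, ?_, ?_, ?_, ?_⟩
  · intro t ht
    rw [mirror_im]
    exact L.η_im t ht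
  · rw [L.K_zero, preimage_empty]
  · intro z
    rw [L.g_zero, mirror_mirror]
  · intro t ht
    obtain ⟨H, z, hz⟩ := L.hull t ht
    exact ⟨H.reflect, mirror z, by simpa using hz⟩
  · exact fun s t hs hst ht => preimage_mono (L.mono s t hs hst ht)
  · intro t ht
    have h1 := (Complex.continuous_conj.tendsto _).comp
      ((L.cap t ht).comp tendsto_mirror_cobounded)
    rw [HasHcap, ← conj_ofReal]
    refine h1.congr fun z => ?_
    simp [mirror_apply]
    ring
  · intro t ht
    obtain ⟨h1, h2, z₀, hz₀, h3⟩ := L.gen t ht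
    have hU : UHP \ closure ((fun t => mirror (η t)) '' Icc 0 t) =
        mirror ⁻¹' (UHP \ closure (η '' Icc 0 t)) := by
      rw [preimage_sdiff, mirror_preimage_UHP, himage, closure_preimage_mirror]
    refine ⟨?_, fun h => h2 ?_, mirror z₀, ?_, ?_⟩
    · rw [himage]
      conv_lhs => rw [← mirror_preimage_UHP]
      exact preimage_mono h1
    · rw [hcompl] at h
      have := mirror.lipschitz.isBounded_image h
      rwa [image_preimage_eq _ mirror.surjective] at this
    · rw [hU]
      simpa using hz₀
    · rw [hcompl, h3, hU, ← image_mirror, ← image_mirror]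
      exact mirror.toHomeomorph.image_connectedComponentIn hz₀
  · intro t ht
    obtain ⟨h1, h2⟩ := L.f_spec t ht
    refine ⟨mirror.continuous.comp_continuousOn
      (h1.comp mirror.continuous.continuousOn fun z hz => ?_), fun z hz => ?_⟩
    · rw [Set.mem_ofPred_eq, mirror_im]
      exact hz
    · rw [hcompl] at hz
      rw [mirror_mirror, h2 _ hz, mirror_mirror]
  · intro t ht
    rw [mirror_ofReal, neg_neg, L.curve t ht]
  · intro t ht δ hδ hδT
    have h1 : (fun z => mirror (g t (mirror z))) ''
        (mirror ⁻¹' K (t + δ) \ mirror ⁻¹' K t) =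
        mirror ⁻¹' (g t '' (K (t + δ) \ K t)) := by
      rw [← preimage_sdiff, ← image_mirror, ← image_mirror, image_image, image_image]
      simp only [mirror_mirror]
    rw [h1, closure_preimage_mirror, mem_preimage, mirror_ofReal, neg_neg]
    exact L.drive t ht δ hδ hδT
  · have h1 : {x : ℝ | (x : ℂ) ∈ (fun t => mirror (η t)) '' Ico 0 T} =
        Neg.neg ⁻¹' {x : ℝ | (x : ℂ) ∈ η '' Ico 0 T} := by
      ext x
      rw [Set.mem_ofPred_eq, himage, mem_preimage, mirror_ofReal]
      rfl
    rw [h1, MeasureTheory.Measure.measure_preimage_neg]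
    exact L.null

theorem leftIm_eqOn {c : ℝ → ℝ} (hc0 : c 0 = w 0) (hc : ∀ t ∈ Ioo 0 T, c t = sInf (S t)) :
    EqOn c (leftIm w S) (Ico 0 T) := by
  intro t ht
  rcases ht.1.eq_or_lt with rfl | h
  · rw [hc0, leftIm, if_pos rfl]
  · rw [hc t ⟨h, ht.2⟩, leftIm, if_neg h.ne']

theorem left_ode (L : LoewnerCurve T w η K g S f) {c : ℝ → ℝ} (hc0 : c 0 = w 0)
    (hc : ∀ t ∈ Ioo 0 T, c t = sInf (S t)) :
    (∀ t ∈ Ico 0 T, c t ≤ w t) ∧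
    MeasureTheory.volume {t : ℝ | t ∈ Ico 0 T ∧ c t = w t} = 0 ∧
    (∀ t₁ ∈ Ico 0 T, ∀ t₂ ∈ Ico 0 T, t₁ ≤ t₂ →
      c t₂ - c t₁ = ∫ s in t₁..t₂, 2 / (c s - w s)) ∧
    StrictAntiOn c (Ico 0 T) := by
  have heq := leftIm_eqOn hc0 hc
  refine ⟨fun t ht => heq ht ▸ L.leftIm_le ht, ?_, fun t₁ h₁ t₂ h₂ h => ?_,
    L.leftIm_strictAntiOn.congr heq.symm⟩
  · refine MeasureTheory.measure_mono_null (t := {0} ∪ {t | ¬(t ∈ Ioo 0 T → leftIm w S t < w t ∧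
      2 / (w t - leftIm w S t) ≤ -deriv (leftIm w S) t)}) ?_
      (MeasureTheory.measure_union_null (MeasureTheory.measure_singleton 0) L.ae_two_div_le)
    rintro t ⟨ht, h⟩
    rcases ht.1.eq_or_lt with rfl | h0
    · exact Or.inl rfl
    · exact Or.inr fun h' => (h' ⟨h0, ht.2⟩).1.ne (heq ht ▸ h)
  · rw [heq h₁, heq h₂, L.leftIm_sub_eq h₁.1 h h₂.2]
    refine intervalIntegral.integral_congr fun r hr => ?_
    rw [uIcc_of_le h] at hr
    rw [heq ⟨h₁.1.trans hr.1, hr.2.trans_lt h₂.2⟩]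

theorem right_ode (L : LoewnerCurve T w η K g S f) {d : ℝ → ℝ} (hd0 : d 0 = w 0)
    (hd : ∀ t ∈ Ioo 0 T, d t = sSup (S t)) :
    (∀ t ∈ Ico 0 T, w t ≤ d t) ∧
    MeasureTheory.volume {t : ℝ | t ∈ Ico 0 T ∧ d t = w t} = 0 ∧
    (∀ t₁ ∈ Ico 0 T, ∀ t₂ ∈ Ico 0 T, t₁ ≤ t₂ →
      d t₂ - d t₁ = ∫ s in t₁..t₂, 2 / (d s - w s)) ∧
    StrictMonoOn d (Ico 0 T) := by
  obtain ⟨h1, h2, h3, h4⟩ := L.reflect.left_ode (c := fun t => -d t) (by rw [hd0]) fun t ht => by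
    rw [hd t ht, Real.sInf_def, Set.neg_preimage, neg_neg]
  refine ⟨fun t ht => neg_le_neg_iff.1 (h1 t ht), ?_, fun t₁ h₁ t₂ h₂ h => ?_, ?_⟩
  · simpa only [neg_inj] using h2
  · have h5 := h3 t₁ h₁ t₂ h₂ h
    have h6 : ∫ s in t₁..t₂, 2 / (-d s - -w s) = -∫ s in t₁..t₂, 2 / (d s - w s) := by
      rw [← intervalIntegral.integral_neg]
      refine intervalIntegral.integral_congr fun r _ => ?_
      rw [← div_neg, neg_sub, neg_sub_neg]
    linarith
  · exact fun a ha b hb hab => neg_lt_neg_iff.1 (h4 ha hb hab)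

end LoewnerCurve

/-- **The ODEs for `c(t) = c_{K_t}` and `d(t) = d_{K_t}` along a Loewner curve.**
Suppose `ŵ` generates a chordal Loewner curve `η` with hulls `K_t`, such that `η[0,T) ∩ ℝ`
has Lebesgue measure zero. With `c(0) = d(0) = ŵ(0)`, `c(t) = c_{K_t}`, `d(t) = d_{K_t}`:
(i) `c ≤ ŵ ≤ d`; (ii) `{t : c(t) = ŵ(t) ∨ d(t) = ŵ(t)}` is Lebesgue-null;
(iii) `c` and `d` satisfy the integrated ODEs `c' = 2/(c - ŵ)`, `d' = 2/(d - ŵ)` a.e.;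
hence (iv) `c` is strictly decreasing and `d` strictly increasing on `[0,T)`. -/
theorem stmt_8 (T : ℝ) (hT : 0 < T) (wD : ℝ → ℝ) (hwD : ContinuousOn wD (Set.Ico 0 T))
    (η : ℝ → ℂ) (hη : ContinuousOn η (Set.Ico 0 T))
    (hηim : ∀ t ∈ Set.Ico 0 T, 0 ≤ (η t).im)
    (K : ℝ → Set ℂ) (g : ℝ → ℂ → ℂ) (S : ℝ → Set ℝ) (f : ℝ → ℂ → ℂ)
    (hK0 : K 0 = ∅) (hg0 : ∀ z, g 0 z = z)
    (hhull : ∀ t ∈ Set.Ioo 0 T, IsHullMap (K t) (g t) (S t) ∧ (K t).Nonempty)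
    (hmono : ∀ s t : ℝ, 0 ≤ s → s ≤ t → t < T → K s ⊆ K t)
    (hcap : ∀ t ∈ Set.Ico 0 T, HasHcap (g t) (2 * t))
    (hgen : ∀ t ∈ Set.Ico 0 T,
      η '' Set.Icc 0 t ∩ UHP ⊆ K t ∧
      ¬ IsBounded (UHP \ K t) ∧
      ∃ z₀ ∈ UHP \ closure (η '' Set.Icc 0 t),
        UHP \ K t = connectedComponentIn (UHP \ closure (η '' Set.Icc 0 t)) z₀)
    (hf : ∀ t ∈ Set.Ico 0 T,
      ContinuousOn (f t) {z : ℂ | 0 ≤ z.im} ∧ ∀ z ∈ UHP \ K t, f t (g t z) = z)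
    (hcurve : ∀ t ∈ Set.Ico 0 T, η t = f t ((wD t : ℝ) : ℂ))
    (hdrive : ∀ t ∈ Set.Ico 0 T, ∀ δ > (0:ℝ), t + δ < T →
      ((wD t : ℝ) : ℂ) ∈ closure (g t '' (K (t + δ) \ K t)))
    (hmeas : MeasureTheory.volume {x : ℝ | (x : ℂ) ∈ η '' Set.Ico 0 T} = 0)
    (c d : ℝ → ℝ) (hc0 : c 0 = wD 0) (hd0 : d 0 = wD 0)
    (hc : ∀ t ∈ Set.Ioo 0 T, c t = sInf (S t)) (hd : ∀ t ∈ Set.Ioo 0 T, d t = sSup (S t)) :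
    (∀ t ∈ Set.Ico 0 T, c t ≤ wD t ∧ wD t ≤ d t)
    ∧ MeasureTheory.volume {t : ℝ | t ∈ Set.Ico 0 T ∧ (c t = wD t ∨ d t = wD t)} = 0
    ∧ (∀ t₁ ∈ Set.Ico 0 T, ∀ t₂ ∈ Set.Ico 0 T, t₁ ≤ t₂ →
        c t₂ - c t₁ = (∫ s in t₁..t₂, 2 / (c s - wD s)) ∧
        d t₂ - d t₁ = (∫ s in t₁..t₂, 2 / (d s - wD s)))
    ∧ StrictAntiOn c (Set.Ico 0 T) ∧ StrictMonoOn d (Set.Ico 0 T) := by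
  have L : LoewnerCurve T wD η K g S f := ⟨hwD, hη, hηim, hK0, hg0, hhull, hmono, hcap, hgen, hf,
    hcurve, hdrive, hmeas⟩
  obtain ⟨hl1, hl2, hl3, hl4⟩ := L.left_ode hc0 hc
  obtain ⟨hr1, hr2, hr3, hr4⟩ := L.right_ode hd0 hd
  refine ⟨fun t ht => ⟨hl1 t ht, hr1 t ht⟩, ?_, fun t₁ h₁ t₂ h₂ h =>
    ⟨hl3 t₁ h₁ t₂ h₂ h, hr3 t₁ h₁ t₂ h₂ h⟩, hl4, hr4⟩
  refine MeasureTheory.measure_mono_null ?_ (MeasureTheory.measure_union_null hl2 hr2)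
  rintro t ⟨ht, h | h⟩
  · exact Or.inl ⟨ht, h⟩
  · exact Or.inr ⟨ht, h⟩
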